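/- Let n ≥ 3, let 0 < ρ ≤ 1, and let W ⊆ Q be a finite set with |W| = n. If for every finite set B ⊆ Q with |B| = n one has μ({q ∈ Q : infDist(q, B) < infDist(q, W)}) ≤ ρ/2, then W = {((2i−1)/(2n), ρ/2) : i = 1, …, n}. (For n ≥ 3, Wilma can only avoid losing by placing her points in a 1×n grid along the long side.) -/

import Mathlib

open MeasureTheory Metric Set
open scoped ENNReal

/-- The point `(x, y)` in the Euclidean plane. -/
noncomputable def pt (x y : ℝ) : EuclideanSpace ℝ (Fin 2) :=
  (WithLp.equiv 2 (Fin 2 → ℝ)).symm ![x, y]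

/-- The rectangular board `[0,1] × [0,ρ]`. -/
def board (ρ : ℝ) : Set (EuclideanSpace ℝ (Fin 2)) :=
  {q | q 0 ∈ Set.Icc (0:ℝ) 1 ∧ q 1 ∈ Set.Icc (0:ℝ) ρ}

namespace Vor

/-- Data of a Voronoi cell, in coordinates centred at its site. -/
structure Cell where
  e1 : ℝ
  e2 : ℝ
  d1 : ℝ
  d2 : ℝ
  V : Finset (ℝ × ℝ)

/-- The box. -/
def Cell.Box (c : Cell) : Set (ℝ × ℝ) :=
  {y | -c.e1 ≤ y.1 ∧ y.1 ≤ c.e2 ∧ -c.d1 ≤ y.2 ∧ y.2 ≤ c.d2}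

/-- The cell itself. -/
def Cell.K (c : Cell) : Set (ℝ × ℝ) :=
  {y | y ∈ c.Box ∧ ∀ v ∈ c.V, 2 * (y.1 * v.1 + y.2 * v.2) ≤ v.1 ^ 2 + v.2 ^ 2}

/-- The region claimed by a single point `b`. -/
def Cell.R (c : Cell) (b : ℝ × ℝ) : Set (ℝ × ℝ) :=
  {y | y ∈ c.Box ∧ (y.1 - b.1) ^ 2 + (y.2 - b.2) ^ 2 < y.1 ^ 2 + y.2 ^ 2 ∧
    ∀ v ∈ c.V, (y.1 - b.1) ^ 2 + (y.2 - b.2) ^ 2 < (y.1 - v.1) ^ 2 + (y.2 - v.2) ^ 2}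

/-- The properties of the cells of a non-losing configuration. -/
structure Good (c : Cell) : Prop where
  e1 : 0 < c.e1
  e2 : 0 < c.e2
  d1 : 0 < c.d1
  d2 : 0 < c.d2
  ne : ∀ v ∈ c.V, v ≠ 0
  mem : ∀ v ∈ c.V, v ∈ c.Box
  sym : ∀ y ∈ c.K, -y ∈ c.K
  claim : ∀ b ∈ c.Box, volume (c.R b) ≤ volume c.K / 2

lemma vol_preimage (a b c d : ℝ) (h : a * d - b * c ≠ 0) (S : Set (ℝ × ℝ)) :
    volume {y : ℝ × ℝ | (a * y.1 + b * y.2, c * y.1 + d * y.2) ∈ S}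
      = ENNReal.ofReal |(a * d - b * c)⁻¹| * volume S := by
  have hd : LinearMap.det (Matrix.toLin (Module.Basis.finTwoProd ℝ) (Module.Basis.finTwoProd ℝ)
      !![a, b; c, d]) = a * d - b * c := by
    rw [LinearMap.det_toLin, Matrix.det_fin_two_of]
  have := Measure.addHaar_preimage_linearMap (volume : Measure (ℝ × ℝ))
    (f := Matrix.toLin (Module.Basis.finTwoProd ℝ) (Module.Basis.finTwoProd ℝ) !![a, b; c, d])
    (by rw [hd]; exact h) S
  rw [hd] at this
  rw [← this]
  congr 1
  ext y
  simp [Matrix.toLin_finTwoProd_apply]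

lemma line_null (a b c : ℝ) (h : a ^ 2 + b ^ 2 ≠ 0) :
    volume {y : ℝ × ℝ | a * y.1 + b * y.2 = c} = 0 := by
  have := vol_preimage a b (-b) a (by ring_nf; ring_nf at h; exact h) ({c} ×ˢ univ)
  simp only [mem_prod, mem_singleton_iff, mem_univ, and_true] at this
  rw [this, Measure.volume_eq_prod, Measure.prod_prod]
  simp

lemma strip_vol (u y0 v : ℝ × ℝ) (a s : ℝ) (ha : 0 < a) (hs : 0 ≤ s)
    (hu : u.1 ^ 2 + u.2 ^ 2 = 1)
    (hy : y0.1 ^ 2 + y0.2 ^ 2 = a ^ 2) (hyu : y0.1 * u.1 + y0.2 * u.2 = 0)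
    (hv : 0 < v.1 ^ 2 + v.2 ^ 2)
    (hyv : 2 * (y0.1 * v.1 + y0.2 * v.2) = v.1 ^ 2 + v.2 ^ 2) :
    volume {y : ℝ × ℝ | |2 * (y.1 * v.1 + y.2 * v.2)| ≤ v.1 ^ 2 + v.2 ^ 2 ∧
      0 ≤ y.1 * u.1 + y.2 * u.2 ∧ y.1 * u.1 + y.2 * u.2 ≤ s} = ENNReal.ofReal (2 * a * s) := by
  set l := y0.1 * u.2 - y0.2 * u.1 with hl
  have h1 : y0.1 = l * u.2 := by rw [hl]; linear_combination (-y0.1) * hu + u.1 * hyu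
  have h2 : y0.2 = -l * u.1 := by rw [hl]; linear_combination (-y0.2) * hu + u.2 * hyu
  have hl2 : l ^ 2 = a ^ 2 := by
    rw [← hy, h1, h2]; linear_combination (-l ^ 2) * hu
  set N := v.1 ^ 2 + v.2 ^ 2 with hN
  have h3 : 2 * l * (v.1 * u.2 - v.2 * u.1) = N := by
    rw [← hyv, h1, h2]; ring
  have habs : |2 * v.1 * u.2 - 2 * v.2 * u.1| = N / a := by
    have hal : |l| = a := by
      have := sq_eq_sq_iff_abs_eq_abs l a |>.1 hl2
      rw [this, abs_of_pos ha]
    have : |l| * |2 * v.1 * u.2 - 2 * v.2 * u.1| = N := by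
      rw [← abs_mul, show l * (2 * v.1 * u.2 - 2 * v.2 * u.1) = N by rw [← h3]; ring]
      exact abs_of_pos hv
    rw [hal] at this
    rw [eq_div_iff ha.ne', mul_comm]
    exact this
  have hdet : 2 * v.1 * u.2 - 2 * v.2 * u.1 ≠ 0 := by
    intro h0
    have : 0 < N / a := by positivity
    rw [← habs, h0, abs_zero] at this
    exact lt_irrefl _ this
  have := vol_preimage (2 * v.1) (2 * v.2) u.1 u.2 hdet (Icc (-N) N ×ˢ Icc 0 s)
  have e : {y : ℝ × ℝ | |2 * (y.1 * v.1 + y.2 * v.2)| ≤ N ∧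
      0 ≤ y.1 * u.1 + y.2 * u.2 ∧ y.1 * u.1 + y.2 * u.2 ≤ s} =
      {y : ℝ × ℝ | (2 * v.1 * y.1 + 2 * v.2 * y.2, u.1 * y.1 + u.2 * y.2) ∈
        Icc (-N) N ×ˢ Icc 0 s} := by
    ext y
    simp only [mem_ofPred_eq, mem_prod, mem_Icc, abs_le]
    rw [show 2 * (y.1 * v.1 + y.2 * v.2) = 2 * v.1 * y.1 + 2 * v.2 * y.2 by ring,
      show y.1 * u.1 + y.2 * u.2 = u.1 * y.1 + u.2 * y.2 by ring]
  rw [e, this, Measure.volume_eq_prod, Measure.prod_prod, Real.volume_Icc, Real.volume_Icc, abs_inv,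
    habs, ← ENNReal.ofReal_mul (by linarith), ← ENNReal.ofReal_mul (by positivity)]
  congr 1
  field_simp
  ring

end Vor

namespace Vor

open Filter Topology

lemma Cell.Box_eq (c : Cell) : c.Box = Icc (-c.e1) c.e2 ×ˢ Icc (-c.d1) c.d2 := by
  ext y; simp only [Cell.Box, mem_ofPred_eq, mem_prod, mem_Icc, and_assoc]

lemma Cell.isClosed_Box (c : Cell) : IsClosed c.Box := by
  rw [c.Box_eq]; exact isClosed_Icc.prod isClosed_Icc

lemma Cell.isClosed_K (c : Cell) : IsClosed c.K := by
  have : c.K = c.Box ∩ ⋂ v ∈ c.V, {y | 2 * (y.1 * v.1 + y.2 * v.2) ≤ v.1 ^ 2 + v.2 ^ 2} := by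
    ext y; simp [Cell.K]
  rw [this]
  refine c.isClosed_Box.inter (isClosed_biInter fun v _ => ?_)
  exact isClosed_le (by fun_prop) (by fun_prop)

lemma Cell.measurableSet_R (c : Cell) (b : ℝ × ℝ) : MeasurableSet (c.R b) := by
  have : c.R b = c.Box ∩ ({y | (y.1 - b.1) ^ 2 + (y.2 - b.2) ^ 2 < y.1 ^ 2 + y.2 ^ 2} ∩
      ⋂ v ∈ c.V, {y | (y.1 - b.1) ^ 2 + (y.2 - b.2) ^ 2 < (y.1 - v.1) ^ 2 + (y.2 - v.2) ^ 2}) := by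
    ext y; simp only [Cell.R, mem_ofPred_eq, mem_inter_iff, mem_iInter]
  rw [this]
  refine c.isClosed_Box.measurableSet.inter (MeasurableSet.inter ?_
    (Finset.measurableSet_biInter _ fun v _ => ?_))
  · exact (isOpen_lt (by fun_prop) (by fun_prop)).measurableSet
  · exact (isOpen_lt (by fun_prop) (by fun_prop)).measurableSet

lemma Cell.isCompact_K (c : Cell) : IsCompact c.K := by
  have : IsCompact c.Box := by
    rw [c.Box_eq]; exact isCompact_Icc.prod isCompact_Icc
  exact this.of_isClosed_subset c.isClosed_K fun y hy => hy.1

lemma Cell.vol_K_ne_top (c : Cell) : volume c.K ≠ ⊤ := c.isCompact_K.measure_lt_top.ne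

/-- the half of `K` -/
lemma half_K (c : Cell) (hc : Good c) (u : ℝ × ℝ) (hu : u.1 ^ 2 + u.2 ^ 2 = 1) :
    volume c.K ≤ 2 * volume (c.K ∩ {y | 0 < y.1 * u.1 + y.2 * u.2}) := by
  have h1 : c.K ⊆ (c.K ∩ {y | 0 < y.1 * u.1 + y.2 * u.2}) ∪
      ((c.K ∩ {y | y.1 * u.1 + y.2 * u.2 < 0}) ∪ {y | u.1 * y.1 + u.2 * y.2 = 0}) := by
    intro y hy
    rcases lt_trichotomy (y.1 * u.1 + y.2 * u.2) 0 with h | h | h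
    · exact Or.inr (Or.inl ⟨hy, h⟩)
    · exact Or.inr (Or.inr (by rw [mem_ofPred_eq, ← h]; ring))
    · exact Or.inl ⟨hy, h⟩
  have h2 : volume (c.K ∩ {y | y.1 * u.1 + y.2 * u.2 < 0}) =
      volume (c.K ∩ {y | 0 < y.1 * u.1 + y.2 * u.2}) := by
    have := Measure.measure_preimage_neg (volume : Measure (ℝ × ℝ)) (c.K ∩ {y | 0 < y.1 * u.1 + y.2 * u.2})
    rw [← this]
    congr 1
    ext y
    constructor
    · rintro ⟨hy, h⟩
      refine ⟨hc.sym y hy, ?_⟩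
      simp only [mem_ofPred_eq, Prod.fst_neg, Prod.snd_neg] at h ⊢
      linarith
    · rintro ⟨hy, h⟩
      refine ⟨by simpa using hc.sym _ hy, ?_⟩
      simp only [mem_ofPred_eq, Prod.fst_neg, Prod.snd_neg] at h ⊢
      linarith
  calc volume c.K ≤ _ := measure_mono h1
    _ ≤ _ := measure_union_le _ _
    _ ≤ _ := add_le_add_right (measure_union_le _ _) _
    _ = _ := by rw [line_null u.1 u.2 0 (by rw [hu]; norm_num), h2, add_zero, two_mul]

lemma claim_diff (c : Cell) (hc : Good c) (u y0 v0 : ℝ × ℝ) (a t : ℝ) (ha : 0 < a) (ht : 0 < t)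
    (hu : u.1 ^ 2 + u.2 ^ 2 = 1) (htb : ((t * u.1, t * u.2) : ℝ × ℝ) ∈ c.Box)
    (hy : y0.1 ^ 2 + y0.2 ^ 2 = a ^ 2) (hyu : y0.1 * u.1 + y0.2 * u.2 = 0)
    (hv : v0 ∈ c.V)
    (hyv : 2 * (y0.1 * v0.1 + y0.2 * v0.2) = v0.1 ^ 2 + v0.2 ^ 2) :
    volume (c.R (t * u.1, t * u.2) \ c.K) ≤ ENNReal.ofReal (t * a) := by
  have hv0 : 0 < v0.1 ^ 2 + v0.2 ^ 2 := by
    have := hc.ne v0 hv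
    by_contra h
    apply this
    ext
    · simp; nlinarith [sq_nonneg v0.1, sq_nonneg v0.2]
    · simp; nlinarith [sq_nonneg v0.1, sq_nonneg v0.2]
  have hcl := hc.claim _ htb
  have hK := half_K c hc u hu
  have hstrip := strip_vol u y0 v0 a (t / 2) ha (by linarith) hu hy hyu hv0 hyv
  set P := c.K ∩ {y | t / 2 < y.1 * u.1 + y.2 * u.2}
  have e1 : volume (c.K ∩ {y | 0 < y.1 * u.1 + y.2 * u.2}) ≤ volume P + ENNReal.ofReal (t * a) := by
    rw [show t * a = 2 * a * (t / 2) by ring, ← hstrip]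
    refine (measure_mono ?_).trans (measure_union_le _ _)
    rintro y ⟨hy, h⟩
    by_cases h' : t / 2 < y.1 * u.1 + y.2 * u.2
    · exact Or.inl ⟨hy, h'⟩
    · refine Or.inr ⟨?_, le_of_lt h, not_lt.1 h'⟩
      have q1 := hy.2 v0 hv
      have q2 := (hc.sym y hy).2 v0 hv
      simp only [Prod.fst_neg, Prod.snd_neg] at q2
      rw [abs_le]; constructor <;> linarith
  have e2 : volume P + volume (c.R (t * u.1, t * u.2) \ c.K) ≤ volume c.K / 2 := by
    refine le_trans ?_ hcl
    rw [← measure_union']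
    · apply measure_mono
      rintro y (⟨hy, h⟩ | hy)
      · simp only [mem_ofPred_eq] at h
        have h1 : (y.1 - t * u.1) ^ 2 + (y.2 - t * u.2) ^ 2 < y.1 ^ 2 + y.2 ^ 2 := by
          have : (y.1 - t * u.1) ^ 2 + (y.2 - t * u.2) ^ 2 = y.1 ^ 2 + y.2 ^ 2
            - 2 * t * (y.1 * u.1 + y.2 * u.2) + t ^ 2 * (u.1 ^ 2 + u.2 ^ 2) := by ring
          rw [this, hu]; nlinarith
        refine ⟨hy.1, h1, fun v hv => lt_of_lt_of_le h1 ?_⟩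
        have := hy.2 v hv
        nlinarith
      · exact hy.1
    · exact disjoint_left.2 fun y h1 h2 => h2.2 h1.1
    · exact c.isClosed_K.measurableSet.inter (isOpen_lt (by fun_prop) (by fun_prop)).measurableSet
  have e3 : volume c.K / 2 ≤ volume P + ENNReal.ofReal (t * a) := by
    refine le_trans ?_ e1
    rw [ENNReal.div_le_iff_le_mul (by simp) (by simp), mul_comm]
    exact hK
  have hP : volume P ≠ ⊤ := (measure_mono inter_subset_left).trans_lt (lt_top_iff_ne_top.2 c.vol_K_ne_top) |>.ne
  exact (ENNReal.add_le_add_iff_left hP).1 (e2.trans e3)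

/-- radial density -/
noncomputable def rad (A : Set (ℝ × ℝ)) (θ : ℝ) : ℝ≥0∞ :=
  ∫⁻ s in Ioi (0:ℝ), ENNReal.ofReal s * A.indicator 1 (s * Real.cos θ, s * Real.sin θ)

lemma rad_aux (A : Set (ℝ × ℝ)) (hA : MeasurableSet A) :
    Measurable (fun p : ℝ × ℝ => ENNReal.ofReal p.1 *
      A.indicator (1 : ℝ × ℝ → ℝ≥0∞) (p.1 * Real.cos p.2, p.1 * Real.sin p.2)) := by
  have h1 : Measurable (A.indicator (1 : ℝ × ℝ → ℝ≥0∞)) := measurable_one.indicator hA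
  have h2 : Measurable (fun p : ℝ × ℝ => ((p.1 * Real.cos p.2, p.1 * Real.sin p.2) : ℝ × ℝ)) := by
    fun_prop
  exact (by fun_prop : Measurable fun p : ℝ × ℝ => ENNReal.ofReal p.1).mul (h1.comp h2)

lemma rad_meas (A : Set (ℝ × ℝ)) (hA : MeasurableSet A) : Measurable (rad A) :=
  Measurable.lintegral_prod_left' (μ := volume.restrict (Ioi (0:ℝ))) (rad_aux A hA)

lemma rad_int (A : Set (ℝ × ℝ)) (hA : MeasurableSet A) :
    ∫⁻ θ in Ioo (-Real.pi) Real.pi, rad A θ = volume A := by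
  rw [← lintegral_indicator_one hA, ← lintegral_comp_polarCoord_symm]
  rw [polarCoord_target, Measure.volume_eq_prod, ← Measure.prod_restrict,
    lintegral_prod_symm']
  · rfl
  · exact rad_aux A hA

lemma rad_lower (A : Set (ℝ × ℝ)) (θ r k : ℝ) (hr : 0 < r) (hk : 0 < k)
    (h : ∀ l, 1 < l → l < 1 + k → ((l * r * Real.cos θ, l * r * Real.sin θ) : ℝ × ℝ) ∈ A) :
    ENNReal.ofReal (r ^ 2 * k) ≤ rad A θ := by
  have : ∫⁻ s in Ioo r ((1 + k) * r), ENNReal.ofReal r ≤ rad A θ := by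
    refine le_trans ?_ (lintegral_mono_set (s := Ioo r ((1 + k) * r)) fun s hs => hr.trans hs.1)
    refine setLIntegral_mono_ae' measurableSet_Ioo (ae_of_all _ fun s hs => ?_)
    have : ((s * Real.cos θ, s * Real.sin θ) : ℝ × ℝ) ∈ A := by
      have := h (s / r) (by rw [lt_div_iff₀ hr]; linarith [hs.1])
        (by rw [div_lt_iff₀ hr]; exact hs.2)
      rwa [div_mul_cancel₀ _ hr.ne'] at this
    rw [indicator_of_mem this]
    simp only [Pi.one_apply, mul_one]
    exact ENNReal.ofReal_le_ofReal hs.1.le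
  refine le_trans (le_of_eq ?_) this
  rw [setLIntegral_const, Real.volume_Ioo, ← ENNReal.ofReal_mul hr.le]
  congr 1
  ring

lemma ev_claim (c : Cell) (u y : ℝ × ℝ) (D k : ℝ) (hD : 0 < D) (hk : 0 < k)
    (hu : u.1 ^ 2 + u.2 ^ 2 = 1) (hyK : y ∈ c.K)
    (hb : -c.e1 < y.1 ∧ y.1 < c.e2 ∧ -c.d1 < y.2 ∧ y.2 < c.d2)
    (hact : ∀ v ∈ c.V, 2 * (y.1 * v.1 + y.2 * v.2) = v.1 ^ 2 + v.2 ^ 2 →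
      v.1 ^ 2 + v.2 ^ 2 ≤ 4 * D ^ 2)
    (hkD : k * (2 * D ^ 2) < y.1 * u.1 + y.2 * u.2) :
    ∀ᶠ t in 𝓝[>] (0:ℝ), ∀ l, 1 < l → l < 1 + k * t →
      ((l * y.1, l * y.2) : ℝ × ℝ) ∈ c.R (t * u.1, t * u.2) := by
  have htend : Tendsto (fun t : ℝ => t) (𝓝[>] 0) (𝓝 0) := tendsto_nhdsWithin_of_tendsto_nhds tendsto_id
  have small : ∀ C x : ℝ, 0 < x → ∀ᶠ t in 𝓝[>] (0:ℝ), C * t < x := by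
    intro C x hx
    have : Tendsto (fun t : ℝ => C * t) (𝓝[>] 0) (𝓝 0) := by
      simpa using htend.const_mul C
    exact this.eventually_lt_const hx
  have hyu : 0 < y.1 * u.1 + y.2 * u.2 := lt_trans (by positivity) hkD
  have hV : ∀ᶠ t in 𝓝[>] (0:ℝ), ∀ v ∈ c.V, ∀ l, 1 < l → l < 1 + k * t →
      (l * y.1 - t * u.1) ^ 2 + (l * y.2 - t * u.2) ^ 2 < (l * y.1 - v.1) ^ 2 + (l * y.2 - v.2) ^ 2 := by
    rw [Filter.eventually_all_finset]
    intro v hv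
    have ex : ∀ t l : ℝ, (l * y.1 - t * u.1) ^ 2 + (l * y.2 - t * u.2) ^ 2
      = l ^ 2 * (y.1 ^ 2 + y.2 ^ 2) - 2 * l * t * (y.1 * u.1 + y.2 * u.2) + t ^ 2 := by
      intro t l; linear_combination t ^ 2 * hu
    have ey : ∀ l : ℝ, (l * y.1 - v.1) ^ 2 + (l * y.2 - v.2) ^ 2
      = l ^ 2 * (y.1 ^ 2 + y.2 ^ 2) - l * (2 * (y.1 * v.1 + y.2 * v.2)) + (v.1 ^ 2 + v.2 ^ 2) := by
      intro l; ring
    rcases (hyK.2 v hv).lt_or_eq with hlt | heq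
    · set M := |2 * (y.1 * v.1 + y.2 * v.2)|
      filter_upwards [small (k * M + 1) _ (sub_pos.2 hlt), small 1 1 one_pos, self_mem_nhdsWithin] with t h1 h2 ht l hl1 hl2
      rw [ex, ey]
      have ht : 0 < t := ht
      have : (l - 1) * (2 * (y.1 * v.1 + y.2 * v.2)) ≤ k * t * M :=
        calc _ ≤ (l - 1) * M := by gcongr; exact le_abs_self _
          _ ≤ _ := by gcongr; linarith
      have : 0 < l * t * (y.1 * u.1 + y.2 * u.2) := by positivity
      nlinarith
    · have hD2 := hact v hv heq
      filter_upwards [small 1 (2 * (y.1 * u.1 + y.2 * u.2) - 4 * k * D ^ 2) (by linarith), self_mem_nhdsWithin] with t h1 ht l hl1 hl2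
      rw [ex, ey, heq]
      have ht : 0 < t := ht
      have h3 : (l - 1) * (v.1 ^ 2 + v.2 ^ 2) ≤ k * t * (4 * D ^ 2) :=
        mul_le_mul (by linarith) hD2 (by positivity) (by positivity)
      have h4 : t * (y.1 * u.1 + y.2 * u.2) < l * (t * (y.1 * u.1 + y.2 * u.2)) := by
        have : 0 < t * (y.1 * u.1 + y.2 * u.2) := by positivity
        nlinarith
      have h5 : t * t < t * (2 * (y.1 * u.1 + y.2 * u.2) - 4 * k * D ^ 2) :=
        mul_lt_mul_of_pos_left (by linarith) ht
      nlinarith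
  have m1 := abs_nonneg y.1
  have m2 := abs_nonneg y.2
  filter_upwards [hV, small (k * |y.1|) (y.1 + c.e1) (by linarith), small (k * |y.1|) (c.e2 - y.1) (by linarith),
    small (k * |y.2|) (y.2 + c.d1) (by linarith), small (k * |y.2|) (c.d2 - y.2) (by linarith),
    small 1 (2 * (y.1 * u.1 + y.2 * u.2)) (by linarith), self_mem_nhdsWithin] with t h1 h2 h3 h4 h5 h6 ht l hl1 hl2
  have ht : 0 < t := ht
  have b1 : |(l - 1) * y.1| ≤ k * |y.1| * t := by
    rw [abs_mul, abs_of_pos (by linarith)]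
    nlinarith
  have b2 : |(l - 1) * y.2| ≤ k * |y.2| * t := by
    rw [abs_mul, abs_of_pos (by linarith)]
    nlinarith
  rw [abs_le] at b1 b2
  refine ⟨⟨?_, ?_, ?_, ?_⟩, ?_, fun v hv => h1 v hv l hl1 hl2⟩
  · show -c.e1 ≤ l * y.1; nlinarith
  · show l * y.1 ≤ _; nlinarith
  · show _ ≤ l * y.2; nlinarith
  · show l * y.2 ≤ _; nlinarith
  · show (l * y.1 - t * u.1) ^ 2 + (l * y.2 - t * u.2) ^ 2 < (l * y.1) ^ 2 + (l * y.2) ^ 2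
    have : (l * y.1 - t * u.1) ^ 2 + (l * y.2 - t * u.2) ^ 2 = (l * y.1) ^ 2 + (l * y.2) ^ 2
      - 2 * (l * (t * (y.1 * u.1 + y.2 * u.2))) + t ^ 2 := by linear_combination t ^ 2 * hu
    rw [this]
    have h4 : t * (y.1 * u.1 + y.2 * u.2) < l * (t * (y.1 * u.1 + y.2 * u.2)) := by
      have : 0 < t * (y.1 * u.1 + y.2 * u.2) := by positivity
      nlinarith
    nlinarith

theorem FO (c : Cell) (hc : Good c) (φ a : ℝ) (y0 v0 : ℝ × ℝ) (ha : 0 < a)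
    (hy : y0.1 ^ 2 + y0.2 ^ 2 = a ^ 2) (hyu : y0.1 * Real.cos φ + y0.2 * Real.sin φ = 0)
    (hv : v0 ∈ c.V)
    (hyv : 2 * (y0.1 * v0.1 + y0.2 * v0.2) = v0.1 ^ 2 + v0.2 ^ 2)
    (g : ℝ → ℝ) (hg : IntegrableOn g (Ioo (-Real.pi) Real.pi))
    (hpt : ∀ θ ∈ Ioo (-Real.pi) Real.pi, 0 < g θ → ∃ r D, 0 < r ∧ 0 < D ∧
      ((r * Real.cos θ, r * Real.sin θ) : ℝ × ℝ) ∈ c.K ∧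
      (∀ s, r < s → ((s * Real.cos θ, s * Real.sin θ) : ℝ × ℝ) ∉ c.K) ∧
      (-c.e1 < r * Real.cos θ ∧ r * Real.cos θ < c.e2 ∧ -c.d1 < r * Real.sin θ ∧
        r * Real.sin θ < c.d2) ∧ 0 < Real.cos (θ - φ) ∧
      (∀ v ∈ c.V, 2 * (r * Real.cos θ * v.1 + r * Real.sin θ * v.2) = v.1 ^ 2 + v.2 ^ 2 →
        v.1 ^ 2 + v.2 ^ 2 ≤ 4 * D ^ 2) ∧
      g θ ≤ r ^ 3 * Real.cos (θ - φ) / (2 * D ^ 2)) :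
    ∫ θ in Ioo (-Real.pi) Real.pi, g θ ≤ a := by
  set u : ℝ × ℝ := (Real.cos φ, Real.sin φ) with hudef
  have hu : u.1 ^ 2 + u.2 ^ 2 = 1 := Real.cos_sq_add_sin_sq φ
  set A : ℝ → Set (ℝ × ℝ) := fun t => c.R (t * u.1, t * u.2) \ c.K with hA
  have hAm : ∀ t, MeasurableSet (A t) := fun t =>
    (c.measurableSet_R _).diff c.isClosed_K.measurableSet
  have hbox : ∀ᶠ t in 𝓝[>] (0:ℝ), ((t * u.1, t * u.2) : ℝ × ℝ) ∈ c.Box := by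
    have ht : Tendsto (fun t : ℝ => ((t * u.1, t * u.2) : ℝ × ℝ)) (𝓝[>] 0) (𝓝 (0, 0)) := by
      apply tendsto_nhdsWithin_of_tendsto_nhds
      have : Continuous (fun t : ℝ => ((t * u.1, t * u.2) : ℝ × ℝ)) := by fun_prop
      simpa using this.tendsto 0
    refine ht.eventually ?_
    have := hc.e1; have := hc.e2; have := hc.d1; have := hc.d2
    rw [c.Box_eq]
    exact prod_mem_nhds (Icc_mem_nhds (by linarith) (by linarith)) (Icc_mem_nhds (by linarith) (by linarith))
  have hle : ∀ᶠ t in 𝓝[>] (0:ℝ), ∫⁻ θ in Ioo (-Real.pi) Real.pi,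
      ENNReal.ofReal t⁻¹ * rad (A t) θ ≤ ENNReal.ofReal a := by
    filter_upwards [hbox, self_mem_nhdsWithin] with t h1 ht
    have ht : 0 < t := ht
    rw [lintegral_const_mul _ (rad_meas _ (hAm t)), rad_int _ (hAm t)]
    calc _ ≤ ENNReal.ofReal t⁻¹ * ENNReal.ofReal (t * a) := by
          gcongr
          exact claim_diff c hc u y0 v0 a t ha ht hu h1 hy hyu hv hyv
      _ = _ := by
          rw [← ENNReal.ofReal_mul (by positivity)]; congr 1; field_simp
  have hfat : ∫⁻ θ in Ioo (-Real.pi) Real.pi, liminf (fun t => ENNReal.ofReal t⁻¹ * rad (A t) θ) (𝓝[>] (0:ℝ))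
      ≤ ENNReal.ofReal a := by
    refine (lintegral_liminf_le fun t => (rad_meas _ (hAm t)).const_mul _).trans ?_
    exact liminf_le_of_frequently_le' hle.frequently
  have hlow : ∀ θ ∈ Ioo (-Real.pi) Real.pi, ENNReal.ofReal (g θ) ≤
      liminf (fun t => ENNReal.ofReal t⁻¹ * rad (A t) θ) (𝓝[>] (0:ℝ)) := by
    intro θ hθ
    rcases le_or_gt (g θ) 0 with h0 | h0
    · rw [ENNReal.ofReal_of_nonpos h0]; exact zero_le
    obtain ⟨r, D, hr, hD, hK, hnK, hb, hcos, hact, hgle⟩ := hpt θ hθ h0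
    have huy : r * Real.cos θ * u.1 + r * Real.sin θ * u.2 = r * Real.cos (θ - φ) := by
      rw [Real.cos_sub]; simp [hudef]; ring
    refine le_of_forall_lt fun x hx => ?_
    obtain ⟨x', hxx, hx'⟩ := exists_between hx
    have hx'top : x' ≠ ⊤ := (hx'.trans_le le_top).ne
    refine hxx.trans_le ?_
    set k := x'.toReal / r ^ 2 with hk
    have hxpos : 0 < x' := lt_of_le_of_lt zero_le hxx
    have hkpos : 0 < k := div_pos (ENNReal.toReal_pos hxpos.ne' hx'top) (by positivity)
    have hxg : x'.toReal < g θ := by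
      rw [ENNReal.lt_ofReal_iff_toReal_lt hx'top] at hx'; exact hx'
    have hkD : k * (2 * D ^ 2) < r * Real.cos θ * u.1 + r * Real.sin θ * u.2 := by
      rw [huy, hk, div_mul_eq_mul_div, div_lt_iff₀ (by positivity)]
      have := hxg.trans_le hgle
      rw [lt_div_iff₀ (by positivity)] at this
      linarith
    have hev := ev_claim c u (r * Real.cos θ, r * Real.sin θ) D k hD hkpos hu hK hb hact hkD
    refine le_liminf_of_le (by isBoundedDefault) ?_
    filter_upwards [hev, self_mem_nhdsWithin] with t h1 ht
    have ht : 0 < t := ht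
    have := rad_lower (A t) θ r (k * t) hr (by positivity) (fun l hl1 hl2 => by
      refine ⟨?_, ?_⟩
      · have := h1 l hl1 hl2
        simpa only [mul_assoc] using this
      · exact hnK (l * r) (by nlinarith))
    calc x' = ENNReal.ofReal t⁻¹ * ENNReal.ofReal (r ^ 2 * (k * t)) := by
          rw [← ENNReal.ofReal_mul (by positivity), ← ENNReal.ofReal_toReal hx'top, hk]
          congr 1; field_simp
      _ ≤ _ := by gcongr
  have hfin : ∫⁻ θ in Ioo (-Real.pi) Real.pi, ENNReal.ofReal (g θ) ≤ ENNReal.ofReal a :=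
    (setLIntegral_mono_ae' measurableSet_Ioo (ae_of_all _ hlow)).trans hfat
  rw [integral_eq_lintegral_pos_part_sub_lintegral_neg_part hg]
  have := ENNReal.toReal_mono (by simp) hfin
  rw [ENNReal.toReal_ofReal ha.le] at this
  have h2 : 0 ≤ (∫⁻ θ in Ioo (-Real.pi) Real.pi, ENNReal.ofReal (-g θ)).toReal := ENNReal.toReal_nonneg
  linarith

end Vor

namespace Vor

open Filter Topology

/-- some bisector passes through `y` -/
def Act (c : Cell) (y : ℝ × ℝ) : Prop :=
  ∃ v ∈ c.V, 2 * (y.1 * v.1 + y.2 * v.2) = v.1 ^ 2 + v.2 ^ 2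

/-- strictly inside the box -/
def SB (c : Cell) (y : ℝ × ℝ) : Prop :=
  -c.e1 < y.1 ∧ y.1 < c.e2 ∧ -c.d1 < y.2 ∧ y.2 < c.d2

lemma Good.pos {c : Cell} (hc : Good c) {v : ℝ × ℝ} (hv : v ∈ c.V) : 0 < v.1 ^ 2 + v.2 ^ 2 := by
  have := hc.ne v hv
  by_contra h
  apply this
  ext
  · simp; nlinarith [sq_nonneg v.1, sq_nonneg v.2]
  · simp; nlinarith [sq_nonneg v.1, sq_nonneg v.2]

lemma near (c : Cell) (z : ℝ × ℝ)
    (h : ∀ v ∈ c.V, 2 * (z.1 * v.1 + z.2 * v.2) < v.1 ^ 2 + v.2 ^ 2) :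
    ∀ᶠ y in 𝓝 z, y ∈ c.Box → y ∈ c.K := by
  have : ∀ᶠ y in 𝓝 z, ∀ v ∈ c.V, 2 * (y.1 * v.1 + y.2 * v.2) < v.1 ^ 2 + v.2 ^ 2 := by
    rw [Filter.eventually_all_finset]
    intro v hv
    have : Continuous fun y : ℝ × ℝ => 2 * (y.1 * v.1 + y.2 * v.2) := by fun_prop
    exact (this.tendsto z).eventually_lt_const (h v hv)
  filter_upwards [this] with y hy hb
  exact ⟨hb, fun v hv => (hy v hv).le⟩

lemma strict_of_not_act {c : Cell} {z : ℝ × ℝ} (hz : z ∈ c.K) (h : ¬ Act c z) :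
    ∀ v ∈ c.V, 2 * (z.1 * v.1 + z.2 * v.2) < v.1 ^ 2 + v.2 ^ 2 :=
  fun v hv => lt_of_le_of_ne (hz.2 v hv) fun he => h ⟨v, hv, he⟩

lemma SB.nhds {c : Cell} {z : ℝ × ℝ} (h : SB c z) : c.Box ∈ 𝓝 z := by
  rw [c.Box_eq]
  exact prod_mem_nhds (Icc_mem_nhds h.1 h.2.1) (Icc_mem_nhds h.2.2.1 h.2.2.2)

lemma nhds_of_strict {c : Cell} {z : ℝ × ℝ} (hs : SB c z)
    (h : ∀ v ∈ c.V, 2 * (z.1 * v.1 + z.2 * v.2) < v.1 ^ 2 + v.2 ^ 2) : c.K ∈ 𝓝 z := by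
  filter_upwards [near c z h, hs.nhds] with y h1 h2 using h1 h2

lemma Good.zero_nhds {c : Cell} (hc : Good c) : c.K ∈ 𝓝 (0 : ℝ × ℝ) := by
  apply nhds_of_strict
  · have := hc.e1; have := hc.e2; have := hc.d1; have := hc.d2
    simp only [SB, Prod.fst_zero, Prod.snd_zero]; refine ⟨?_, ?_, ?_, ?_⟩ <;> linarith
  · intro v hv; simpa using hc.pos hv

lemma seg {c : Cell} {y z : ℝ × ℝ} (hy : y ∈ c.K) (hz : z ∈ c.K) {t : ℝ} (h0 : 0 ≤ t) (h1 : t ≤ 1) :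
    ((1 - t) * y.1 + t * z.1, (1 - t) * y.2 + t * z.2) ∈ c.K := by
  obtain ⟨⟨a1, a2, a3, a4⟩, a5⟩ := hy
  obtain ⟨⟨b1, b2, b3, b4⟩, b5⟩ := hz
  have h1' : 0 ≤ 1 - t := by linarith
  refine ⟨⟨?_, ?_, ?_, ?_⟩, fun v hv => ?_⟩
  · show -c.e1 ≤ (1 - t) * y.1 + t * z.1; nlinarith
  · show (1 - t) * y.1 + t * z.1 ≤ _; nlinarith
  · show _ ≤ (1 - t) * y.2 + t * z.2; nlinarith
  · show (1 - t) * y.2 + t * z.2 ≤ _; nlinarith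
  · show 2 * (((1 - t) * y.1 + t * z.1) * v.1 + ((1 - t) * y.2 + t * z.2) * v.2) ≤ _
    have := mul_le_mul_of_nonneg_left (a5 v hv) h1'
    have := mul_le_mul_of_nonneg_left (b5 v hv) h0
    nlinarith

lemma Good.zero_mem {c : Cell} (hc : Good c) : (0 : ℝ × ℝ) ∈ c.K := mem_of_mem_nhds hc.zero_nhds

lemma Good.scale {c : Cell} (hc : Good c) {y : ℝ × ℝ} (hy : y ∈ c.K) {t : ℝ} (h0 : 0 ≤ t) (h1 : t ≤ 1) :
    (t * y.1, t * y.2) ∈ c.K := by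
  have := seg hc.zero_mem hy h0 h1
  simpa using this

lemma Good.scale_nhds {c : Cell} (hc : Good c) {y : ℝ × ℝ} (hy : y ∈ c.K) {t : ℝ} (h0 : 0 ≤ t) (h1 : t < 1) :
    c.K ∈ 𝓝 ((t * y.1, t * y.2) : ℝ × ℝ) := by
  obtain ⟨⟨a1, a2, a3, a4⟩, a5⟩ := hy
  have := hc.e1; have := hc.e2; have := hc.d1; have := hc.d2
  apply nhds_of_strict
  · refine ⟨?_, ?_, ?_, ?_⟩
    · show -c.e1 < t * y.1; nlinarith
    · show t * y.1 < _; nlinarith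
    · show _ < t * y.2; nlinarith
    · show t * y.2 < _; nlinarith
  · intro v hv
    show 2 * (t * y.1 * v.1 + t * y.2 * v.2) < _
    have := mul_le_mul_of_nonneg_left (a5 v hv) h0
    have := hc.pos hv
    nlinarith

lemma Good.radial {c : Cell} (hc : Good c) {w : ℝ × ℝ} (hw : w ≠ 0) :
    ∃ r, 0 < r ∧ (r * w.1, r * w.2) ∈ c.K ∧ ∀ s, r < s → (s * w.1, s * w.2) ∉ c.K := by
  set S : Set ℝ := {s | 0 ≤ s ∧ (s * w.1, s * w.2) ∈ c.K} with hS
  have hcont : Continuous fun s : ℝ => ((s * w.1, s * w.2) : ℝ × ℝ) := by fun_prop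
  have hcl : IsClosed S := isClosed_Ici.inter (c.isClosed_K.preimage hcont)
  have hne : (0 : ℝ) ∈ S := ⟨le_rfl, by simpa [← Prod.mk_zero_zero] using hc.zero_mem⟩
  have hbd : BddAbove S := by
    rcases ne_or_eq w.1 0 with h | h
    · refine ⟨(c.e1 + c.e2) / |w.1|, fun s hs => ?_⟩
      rw [le_div_iff₀ (abs_pos.2 h)]
      obtain ⟨h0, ⟨⟨a1, a2, a3, a4⟩, _⟩⟩ := hs
      simp only at a1 a2
      have : s * |w.1| = |s * w.1| := by rw [abs_mul, abs_of_nonneg h0]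
      rw [this, abs_le]
      have := hc.e1; have := hc.e2
      constructor <;> linarith
    · have h2 : w.2 ≠ 0 := fun h2 => hw (Prod.ext h h2)
      refine ⟨(c.d1 + c.d2) / |w.2|, fun s hs => ?_⟩
      rw [le_div_iff₀ (abs_pos.2 h2)]
      obtain ⟨h0, ⟨⟨a1, a2, a3, a4⟩, _⟩⟩ := hs
      simp only at a3 a4
      have : s * |w.2| = |s * w.2| := by rw [abs_mul, abs_of_nonneg h0]
      rw [this, abs_le]
      have := hc.d1; have := hc.d2
      constructor <;> linarith
  have hmem : sSup S ∈ S := hcl.csSup_mem ⟨0, hne⟩ hbd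
  refine ⟨sSup S, ?_, hmem.2, fun s hs h => ?_⟩
  · have : ∀ᶠ s in 𝓝 (0:ℝ), ((s * w.1, s * w.2) : ℝ × ℝ) ∈ c.K := by
      have h0 := hcont.tendsto 0
      simp only [zero_mul] at h0
      exact h0.eventually hc.zero_nhds
    obtain ⟨ε, hε, h⟩ := Metric.eventually_nhds_iff.1 this
    have h2 : ε / 2 ∈ S := ⟨by positivity, h (by simp [abs_of_pos hε]; linarith)⟩
    have := le_csSup hbd h2
    linarith
  · exact absurd (le_csSup hbd ⟨hmem.1.trans hs.le, h⟩) (not_le.2 hs)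

lemma exists_gt_of_ev {P : ℝ → Prop} {x : ℝ} (h : ∀ᶠ s in 𝓝 x, P s) : ∃ s, x < s ∧ P s := by
  have h1 : ∀ᶠ s in 𝓝[>] x, P s := h.filter_mono nhdsWithin_le_nhds
  obtain ⟨s, hs, h2⟩ := (h1.and self_mem_nhdsWithin).exists
  exact ⟨s, h2, hs⟩

lemma act_of_bd {c : Cell} {y : ℝ × ℝ} (hy : y ∈ c.K) (hs : SB c y)
    (h : ∀ s : ℝ, 1 < s → (s * y.1, s * y.2) ∉ c.K) : Act c y := by
  by_contra hn
  have h1 := nhds_of_strict hs (strict_of_not_act hy hn)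
  have hcont : Continuous fun s : ℝ => ((s * y.1, s * y.2) : ℝ × ℝ) := by fun_prop
  have h0 := hcont.tendsto 1
  simp only [one_mul] at h0
  obtain ⟨s, hs, h2⟩ := exists_gt_of_ev (h0.eventually h1)
  exact h s hs h2

lemma Good.act_notin {c : Cell} (hc : Good c) {y : ℝ × ℝ} (h : Act c y) {s : ℝ} (hs : 1 < s) :
    (s * y.1, s * y.2) ∉ c.K := by
  obtain ⟨v, hv, h⟩ := h
  intro hK
  have := hK.2 v hv
  have := hc.pos hv
  simp only at *
  nlinarith

lemma act_le {y v : ℝ × ℝ} (h : 2 * (y.1 * v.1 + y.2 * v.2) = v.1 ^ 2 + v.2 ^ 2) :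
    v.1 ^ 2 + v.2 ^ 2 ≤ 4 * (y.1 ^ 2 + y.2 ^ 2) := by
  nlinarith [sq_nonneg (2 * y.1 - v.1), sq_nonneg (2 * y.2 - v.2)]

/-- the swapped cell -/
noncomputable def Cell.sw (c : Cell) : Cell := ⟨c.d1, c.d2, c.e1, c.e2, c.V.image Prod.swap⟩

lemma sw_Box (c : Cell) (y : ℝ × ℝ) : y ∈ c.sw.Box ↔ y.swap ∈ c.Box := by
  simp only [Cell.Box, Cell.sw, mem_ofPred_eq, Prod.fst_swap, Prod.snd_swap]; tauto

lemma sw_K (c : Cell) (y : ℝ × ℝ) : y ∈ c.sw.K ↔ y.swap ∈ c.K := by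
  unfold Cell.K
  simp only [mem_ofPred_eq, sw_Box]
  refine and_congr_right fun _ => ?_
  simp only [Cell.sw, Finset.forall_mem_image, Prod.fst_swap, Prod.snd_swap]
  refine forall₂_congr fun v _ => ?_
  rw [add_comm (y.1 * _), add_comm (v.2 ^ 2)]

lemma sw_R (c : Cell) (b y : ℝ × ℝ) : y ∈ c.sw.R b ↔ y.swap ∈ c.R b.swap := by
  unfold Cell.R
  simp only [mem_ofPred_eq, sw_Box]
  refine and_congr_right fun _ => ?_
  simp only [Cell.sw, Finset.forall_mem_image, Prod.fst_swap, Prod.snd_swap]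
  rw [add_comm ((y.1 - _) ^ 2), add_comm (y.1 ^ 2)]
  refine and_congr_right fun _ => forall₂_congr fun v _ => ?_
  rw [add_comm ((y.1 - _) ^ 2)]

lemma vol_swap (S T : Set (ℝ × ℝ)) (h : ∀ y : ℝ × ℝ, y ∈ S ↔ y.swap ∈ T) : volume S = volume T := by
  have : S = (MeasurableEquiv.prodComm : ℝ × ℝ ≃ᵐ ℝ × ℝ) ⁻¹' T := by
    ext y; rw [h]; rfl
  rw [this]
  have hp : MeasurePreserving (MeasurableEquiv.prodComm : ℝ × ℝ ≃ᵐ ℝ × ℝ) volume volume :=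
    Measure.measurePreserving_swap
  exact hp.measure_preimage_equiv T

lemma Good.sw {c : Cell} (hc : Good c) : Good c.sw where
  e1 := hc.d1
  e2 := hc.d2
  d1 := hc.e1
  d2 := hc.e2
  ne := by
    simp only [Cell.sw, Finset.forall_mem_image]
    intro v hv h
    apply hc.ne v hv
    have := congrArg Prod.swap h
    simpa using this
  mem := by
    intro v hv
    rw [sw_Box]
    simp only [Cell.sw, Finset.mem_image] at hv
    obtain ⟨w, hw, rfl⟩ := hv
    simpa using hc.mem w hw
  sym := by
    intro y hy
    rw [sw_K] at hy ⊢
    exact hc.sym _ hy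
  claim := by
    intro b hb
    rw [sw_Box] at hb
    rw [vol_swap _ _ (sw_R c b), vol_swap _ _ (sw_K c)]
    exact hc.claim _ hb

lemma sw_Act (c : Cell) (y : ℝ × ℝ) : Act c.sw y ↔ Act c y.swap := by
  unfold Act
  simp only [Cell.sw, Finset.exists_mem_image, Prod.fst_swap, Prod.snd_swap]
  refine exists_congr fun v => and_congr_right fun _ => ?_
  rw [add_comm (y.1 * _), add_comm (v.2 ^ 2)]

/-- hypotheses of the main local lemma: right and top not touched -/
structure NT (c : Cell) : Prop where
  good : Good c
  r : ∀ y ∈ c.K, y.1 < c.e2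
  t : ∀ y ∈ c.K, y.2 < c.d2

lemma NT.sw {c : Cell} (h : NT c) : NT c.sw where
  good := h.good.sw
  r := fun y hy => h.t _ ((sw_K c y).1 hy)
  t := fun y hy => h.r _ ((sw_K c y).1 hy)

lemma NT.le1 {c : Cell} (h : NT c) {y : ℝ × ℝ} (hy : y ∈ c.K) : y.1 ≤ c.e1 := by
  have := (h.good.sym y hy).1.1
  simp at this; linarith

lemma NT.le2 {c : Cell} (h : NT c) {y : ℝ × ℝ} (hy : y ∈ c.K) : y.2 ≤ c.d1 := by
  have := (h.good.sym y hy).1.2.2.1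
  simp at this; linarith

/-- points on the boundary from both sides -/
def MS (c : Cell) : Set (ℝ × ℝ) := {y | y ∈ c.K ∧ Act c y ∧ Act c (-y)}

lemma MS_compact (c : Cell) : IsCompact (MS c) := by
  have h1 : IsClosed {y | Act c y} := by
    have : {y | Act c y} = ⋃ v ∈ c.V, {y | 2 * (y.1 * v.1 + y.2 * v.2) = v.1 ^ 2 + v.2 ^ 2} := by
      ext y; simp only [Act, mem_ofPred_eq, mem_iUnion, exists_prop]
    rw [this]
    exact isClosed_biUnion_finset fun v _ => isClosed_eq (by fun_prop) (by fun_prop)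
  have h2 : IsClosed {y | Act c (-y)} := h1.preimage continuous_neg
  exact c.isCompact_K.inter_right (h1.inter h2)

lemma chordT {c : Cell} (h : NT c) (hnc : (-c.e1, c.d1) ∉ c.K) {A : ℝ}
    (hA : ∀ y ∈ MS c, A ≤ y.1 ^ 2 + y.2 ^ 2) (hA2 : A ≤ c.e1 ^ 2 + c.d1 ^ 2) {x0 : ℝ}
    (h0 : (x0, c.d1) ∈ c.K) (h0A : x0 ^ 2 + c.d1 ^ 2 < A) {x : ℝ} (hx : x ^ 2 + c.d1 ^ 2 < A) :
    (x, c.d1) ∈ c.K := by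
  by_contra hxK
  have hc := h.good
  set τ := x - x0 with hτ
  set S : Set ℝ := {t | 0 ≤ t ∧ t ≤ 1 ∧ (x0 + t * τ, c.d1) ∈ c.K} with hS
  have hcont : Continuous fun s : ℝ => ((x0 + s * τ, c.d1) : ℝ × ℝ) := by fun_prop
  have hcl : IsClosed S := isClosed_Ici.inter (isClosed_Iic.inter (c.isClosed_K.preimage hcont))
  have hne : (0 : ℝ) ∈ S := ⟨le_rfl, zero_le_one, by simpa using h0⟩
  have hbd : BddAbove S := ⟨1, fun s hs => hs.2.1⟩
  obtain ⟨t0, t1, tK⟩ : sSup S ∈ S := hcl.csSup_mem ⟨0, hne⟩ hbd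
  set t := sSup S with ht
  have hout : ∀ s, t < s → (x0 + s * τ, c.d1) ∉ c.K := by
    intro s hs hK
    rcases le_or_gt s 1 with h1 | h1
    · exact absurd (le_csSup hbd ⟨t0.trans hs.le, h1, hK⟩) (not_le.2 hs)
    · apply hxK
      have := seg h0 hK (t := 1 / s) (by positivity) (by rw [div_le_one (by linarith)]; linarith)
      have e : ((1 - 1 / s) * x0 + 1 / s * (x0 + s * τ), (1 - 1 / s) * c.d1 + 1 / s * c.d1) = (x, c.d1) := by
        have : s ≠ 0 := by linarith
        ext
        · simp only [hτ]; field_simp; ring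
        · simp only; ring
      simp only at this
      rwa [e] at this
  have hlt : (x0 + t * τ) ^ 2 + c.d1 ^ 2 < A := by
    have : (x0 + t * τ) ^ 2 = (1 - t) * x0 ^ 2 + t * x ^ 2 - t * (1 - t) * τ ^ 2 := by
      simp only [hτ]; ring
    have h3 : 0 ≤ t * (1 - t) * τ ^ 2 := by
      have : 0 ≤ 1 - t := by linarith
      positivity
    rcases eq_or_lt_of_le t0 with h4 | h4
    · rw [← h4] at *; nlinarith
    · nlinarith
  have hM : (x0 + t * τ, c.d1) ∉ MS c := fun hm => absurd (hA _ hm) (not_le.2 hlt)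
  have := hc.d1
  have l1 : x0 + t * τ < c.e1 := by
    rcases (h.le1 tK).lt_or_eq with h5 | h5
    · exact h5
    · simp only at h5
      rw [h5] at hlt; linarith
  have l2 : -c.e1 < x0 + t * τ := by
    rcases tK.1.1.lt_or_eq with h5 | h5
    · exact h5
    · simp only at h5
      rw [← h5] at tK; exact absurd tK hnc
  have l3 := h.r _ tK
  have l4 := h.t _ tK
  have l5 := h.r _ (hc.sym _ tK)
  have l6 := h.t _ (hc.sym _ tK)
  simp only [Prod.fst_neg, Prod.snd_neg] at l3 l4 l5 l6
  by_cases ha : Act c (x0 + t * τ, c.d1)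
  · have hb : ¬ Act c (-(x0 + t * τ, c.d1)) := fun hb => hM ⟨tK, ha, hb⟩
    have hn := near c _ (strict_of_not_act (hc.sym _ tK) hb)
    have hcont2 : Continuous fun s : ℝ => -((x0 + s * τ, c.d1) : ℝ × ℝ) := by fun_prop
    have hev : ∀ᶠ s in 𝓝 t, -((x0 + s * τ, c.d1) : ℝ × ℝ) ∈ c.Box := by
      have hc3 : Continuous fun s : ℝ => x0 + s * τ := by fun_prop
      filter_upwards [(hc3.tendsto t).eventually_lt_const l1,
        (hc3.tendsto t).eventually_const_lt (u := -c.e2) (by linarith)] with s h1 h2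
      refine ⟨?_, ?_, ?_, ?_⟩ <;> simp <;> linarith
    obtain ⟨s, hs, h2, h3⟩ := exists_gt_of_ev (((hcont2.tendsto t).eventually hn).and hev)
    refine hout s hs ?_
    have := hc.sym _ (h2 h3)
    simpa using this
  · have hn := nhds_of_strict ⟨l2, l3, by simpa using by linarith, l4⟩ (strict_of_not_act tK ha)
    obtain ⟨s, hs, h2⟩ := exists_gt_of_ev ((hcont.tendsto t).eventually hn)
    exact hout s hs h2

lemma chordR {c : Cell} (h : NT c) (hnc : (-c.e1, c.d1) ∉ c.K) {A : ℝ}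
    (hA : ∀ y ∈ MS c, A ≤ y.1 ^ 2 + y.2 ^ 2) (hA2 : A ≤ c.e1 ^ 2 + c.d1 ^ 2) {x0 : ℝ}
    (h0 : (c.e1, x0) ∈ c.K) (h0A : c.e1 ^ 2 + x0 ^ 2 < A) {x : ℝ} (hx : c.e1 ^ 2 + x ^ 2 < A) :
    (c.e1, x) ∈ c.K := by
  have := chordT (c := c.sw) h.sw (A := A) (x0 := x0) (x := x) (by
    rw [sw_K]
    intro hk
    apply hnc
    have := h.good.sym _ hk
    simpa [Cell.sw] using this) (by
    intro y hy
    have : y.swap ∈ MS c := by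
      obtain ⟨a1, a2, a3⟩ := hy
      exact ⟨(sw_K _ _).1 a1, (sw_Act _ _).1 a2, (sw_Act _ _).1 a3⟩
    have := hA _ this
    simp at this; linarith) (by simp [Cell.sw]; linarith) (by rw [sw_K]; exact h0)
    (by simp [Cell.sw]; linarith) (by simp [Cell.sw]; linarith)
  rw [sw_K] at this
  exact this

lemma MS_sw (c : Cell) (y : ℝ × ℝ) : y ∈ MS c.sw ↔ y.swap ∈ MS c := by
  unfold MS
  simp only [mem_ofPred_eq, sw_K, sw_Act]
  rfl

lemma MS_neg {c : Cell} (hc : Good c) {y : ℝ × ℝ} (hy : y ∈ MS c) : -y ∈ MS c :=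
  ⟨hc.sym _ hy.1, hy.2.2, by simpa using hy.2.1⟩

/-- a point of the left side on the line through `w ∈ MS` is `± w` -/
lemma pm_of_line {c : Cell} (h : NT c) {w z : ℝ × ℝ} (hw : w ∈ MS c) (hz : z ∈ c.K)
    (hz1 : z.1 = -c.e1) (hn : -w.2 * z.1 + w.1 * z.2 = 0) : z ∈ MS c := by
  have hc := h.good
  have he := hc.e1
  have hw1 : w.1 ≠ 0 := by
    intro h0
    rw [h0, hz1] at hn
    have : w.2 = 0 := by
      have : w.2 * c.e1 = 0 := by linarith
      exact (mul_eq_zero.1 this).resolve_right he.ne'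
    obtain ⟨v, hv, hv2⟩ := hw.2.1
    rw [h0, this] at hv2
    have := hc.pos hv
    linarith
  set l := z.1 / w.1 with hl
  have e1 : z.1 = l * w.1 := by rw [hl]; field_simp
  have e2 : z.2 = l * w.2 := by rw [hl]; field_simp; linarith
  have habs : |l| = 1 := by
    apply le_antisymm
    · rw [abs_le]
      constructor
      · by_contra hlt
        refine hc.act_notin hw.2.2 (s := -l) (by linarith) ?_
        convert hz using 1
        ext <;> simp [e1, e2]
      · by_contra hlt
        refine hc.act_notin hw.2.1 (s := l) (by linarith) ?_
        convert hz using 1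
        ext <;> simp [e1, e2]
    · have h1 := h.le1 hw.1
      have h2 := hw.1.1.1
      have h3 : |w.1| ≤ c.e1 := abs_le.2 ⟨h2, h1⟩
      have h4 : |l| * |w.1| = c.e1 := by rw [← abs_mul, ← e1, hz1, abs_neg, abs_of_pos he]
      by_contra h5
      have : 0 < |w.1| := abs_pos.2 hw1
      nlinarith
  rcases eq_or_eq_neg_of_abs_eq habs with h1 | h1
  · have : z = w := by ext <;> simp [e1, e2, h1]
    rw [this]; exact hw
  · have : z = -w := by ext <;> simp [e1, e2, h1]
    rw [this]; exact MS_neg hc hw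

lemma signL {c : Cell} (h : NT c) {w y y' : ℝ × ℝ} (hw : w ∈ MS c) (hy : y ∈ c.K) (hy' : y' ∈ c.K)
    (h1 : y.1 = -c.e1) (h1' : y'.1 = -c.e1) (hp : 0 < -w.2 * y.1 + w.1 * y.2)
    (hm : -w.2 * y'.1 + w.1 * y'.2 < 0) : False := by
  have hc := h.good
  set p := -w.2 * y.1 + w.1 * y.2 with hpd
  set m := -w.2 * y'.1 + w.1 * y'.2 with hmd
  set t := p / (p - m) with ht
  have hpm : 0 < p - m := by linarith
  have t0 : 0 < t := div_pos hp hpm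
  have t1 : t < 1 := by rw [ht, div_lt_one hpm]; linarith
  have htp : t * (p - m) = p := by rw [ht]; field_simp
  have hz := seg hy hy' t0.le t1.le
  have hz1 : (1 - t) * y.1 + t * y'.1 = -c.e1 := by rw [h1, h1']; ring
  have hzM := pm_of_line h hw hz hz1 (by
    simp only [hpd, hmd] at htp ⊢; linear_combination -htp)
  obtain ⟨v, hv, hv2⟩ := hzM.2.1
  simp only at hv2
  have a1 := hy.2 v hv
  have a2 := hy'.2 v hv
  rw [h1] at a1; rw [h1'] at a2
  rw [hz1] at hv2
  have a3 : v.2 * (y.2 - y'.2) = 0 := by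
    have : 0 < 1 - t := by linarith
    nlinarith
  have hne : y.2 - y'.2 ≠ 0 := by
    intro h0
    have : y.2 = y'.2 := by linarith
    rw [hpd, h1, this] at hp
    rw [hmd, h1'] at hm
    linarith
  have v2 : v.2 = 0 := (mul_eq_zero.1 a3).resolve_right hne
  have hpos := hc.pos hv
  rw [v2] at hv2 hpos
  have hvb := (hc.mem v hv).1
  have he := hc.e1
  have : v.1 * (v.1 + 2 * c.e1) = 0 := by nlinarith
  rcases mul_eq_zero.1 this with h5 | h5
  · rw [h5] at hpos; norm_num at hpos
  · linarith

lemma signB {c : Cell} (h : NT c) {w y y' : ℝ × ℝ} (hw : w ∈ MS c) (hy : y ∈ c.K) (hy' : y' ∈ c.K)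
    (h1 : y.2 = -c.d1) (h1' : y'.2 = -c.d1) (hp : 0 < -w.2 * y.1 + w.1 * y.2)
    (hm : -w.2 * y'.1 + w.1 * y'.2 < 0) : False :=
  signL (c := c.sw) h.sw (w := w.swap) (y := y'.swap) (y' := y.swap) ((MS_sw _ _).2 (by simpa using hw))
    ((sw_K _ _).2 (by simpa using hy')) ((sw_K _ _).2 (by simpa using hy)) h1' h1
    (by simp; linarith) (by simp; linarith)

lemma signM {c : Cell} (h : NT c) (hcor : (-c.e1, -c.d1) ∈ c.K) {w y y' : ℝ × ℝ} (hw : w ∈ MS c)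
    (hy : y ∈ c.K) (hy' : y' ∈ c.K)
    (h1 : y.1 = -c.e1) (h1' : y'.2 = -c.d1) (hp : 0 < -w.2 * y.1 + w.1 * y.2)
    (hm : -w.2 * y'.1 + w.1 * y'.2 < 0) : False := by
  have hc := h.good
  rcases lt_trichotomy (-w.2 * -c.e1 + w.1 * -c.d1) 0 with h0 | h0 | h0
  · exact signL h hw hy hcor h1 rfl hp h0
  · obtain ⟨v, hv, hv2⟩ := (pm_of_line h hw hcor rfl h0).2.1
    simp only at hv2
    have a1 := hy.2 v hv
    have a2 := hy'.2 v hv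
    rw [h1] at a1; rw [h1'] at a2
    have b1 := hy.1.2.2.1
    have b2 := hy'.1.1
    have n1 : y.2 + c.d1 ≠ 0 := by
      intro hh
      rw [h1, show y.2 = -c.d1 by linarith] at hp; linarith
    have n2 : y'.1 + c.e1 ≠ 0 := by
      intro hh
      rw [h1', show y'.1 = -c.e1 by linarith] at hm; linarith
    have p1 : 0 < y.2 + c.d1 := lt_of_le_of_ne (by linarith) n1.symm
    have p2 : 0 < y'.1 + c.e1 := lt_of_le_of_ne (by linarith) n2.symm
    have v2 : v.2 ≤ 0 := by
      by_contra hh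
      have : 0 < v.2 * (y.2 + c.d1) := mul_pos (by linarith) p1
      nlinarith
    have v1 : v.1 ≤ 0 := by
      by_contra hh
      have : 0 < v.1 * (y'.1 + c.e1) := mul_pos (by linarith) p2
      nlinarith
    have hvb := hc.mem v hv
    have c1 := hvb.1
    have c2 := hvb.2.2.1
    have he := hc.e1
    have hd := hc.d1
    have := hc.pos hv
    have q1 : v.1 * (v.1 + c.e1) ≤ 0 := mul_nonpos_of_nonpos_of_nonneg v1 (by linarith)
    have q2 : v.2 * (v.2 + c.d1) ≤ 0 := mul_nonpos_of_nonpos_of_nonneg v2 (by linarith)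
    nlinarith [mul_nonneg_of_nonpos_of_nonpos v1 (neg_nonpos.2 he.le), mul_nonneg_of_nonpos_of_nonpos v2 (neg_nonpos.2 hd.le)]
  · exact signB h hw hcor hy' rfl h1' h0 hm

end Vor

namespace Vor

open Filter Topology

lemma ind_int {α β : ℝ} (h : α ≤ β) (h1 : -Real.pi ≤ α) (h2 : β ≤ Real.pi) (f F : ℝ → ℝ)
    (hF : ∀ x ∈ Icc α β, HasDerivAt F (f x) x) (hf : ContinuousOn f (Icc α β)) :
    IntegrableOn ((Ioo α β).indicator f) (Ioo (-Real.pi) Real.pi) ∧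
      ∫ θ in Ioo (-Real.pi) Real.pi, (Ioo α β).indicator f θ = F β - F α := by
  have hsub : Ioo α β ⊆ Ioo (-Real.pi) Real.pi := Ioo_subset_Ioo h1 h2
  have hi : IntegrableOn f (Ioo α β) :=
    (hf.integrableOn_Icc).mono_set Ioo_subset_Icc_self
  constructor
  · exact ((integrable_indicator_iff measurableSet_Ioo).2 hi).integrableOn
  · rw [setIntegral_indicator measurableSet_Ioo, inter_eq_right.2 hsub, ← integral_Ioc_eq_integral_Ioo,
      ← intervalIntegral.integral_of_le h]
    apply intervalIntegral.integral_eq_sub_of_hasDerivAt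
    · rw [uIcc_of_le h]; exact hF
    · rw [intervalIntegrable_iff_integrableOn_Ioc_of_le h]
      exact (hf.integrableOn_Icc).mono_set Ioc_subset_Icc_self

lemma chord_int (ψ σ φ D a : ℝ) (h0 : 0 ≤ σ) (hσ : σ < Real.pi / 2) (h1 : -Real.pi ≤ ψ - σ)
    (h2 : ψ + σ ≤ Real.pi) (hD : D * Real.tan σ = a * Real.sin σ) :
    IntegrableOn ((Ioo (ψ - σ) (ψ + σ)).indicator
      fun θ => (D / (2 * Real.cos (θ - ψ) ^ 3) - a / 2) * Real.cos (θ - φ)) (Ioo (-Real.pi) Real.pi) ∧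
    ∫ θ in Ioo (-Real.pi) Real.pi, (Ioo (ψ - σ) (ψ + σ)).indicator
      (fun θ => (D / (2 * Real.cos (θ - ψ) ^ 3) - a / 2) * Real.cos (θ - φ)) θ = 0 := by
  set b := ψ - φ with hb
  have hcos : ∀ θ ∈ Icc (ψ - σ) (ψ + σ), 0 < Real.cos (θ - ψ) := fun θ hθ =>
    Real.cos_pos_of_mem_Ioo ⟨by linarith [hθ.1], by linarith [hθ.2]⟩
  have := ind_int (α := ψ - σ) (β := ψ + σ) (by linarith) h1 h2
    (fun θ => (D / (2 * Real.cos (θ - ψ) ^ 3) - a / 2) * Real.cos (θ - φ))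
    (fun θ => (1/2) * (Real.cos b * (D * Real.tan (θ - ψ) - a * Real.sin (θ - ψ))
      - Real.sin b * (D / 2 * (Real.cos (θ - ψ) ^ 2)⁻¹ + a * Real.cos (θ - ψ)))) (by
      intro θ hθ
      have hc := (hcos θ hθ).ne'
      have e0 : HasDerivAt (fun θ : ℝ => θ - ψ) 1 θ := (hasDerivAt_id θ).sub_const ψ
      have e1 := (Real.hasDerivAt_tan hc).comp θ e0
      have e2 := (Real.hasDerivAt_sin (θ - ψ)).comp θ e0
      have e3 := (Real.hasDerivAt_cos (θ - ψ)).comp θ e0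
      have e4 := (e3.pow 2).inv (by simpa using hc)
      have e5 := ((((e1.const_mul D).sub (e2.const_mul a)).const_mul (Real.cos b)).sub
        (((e4.const_mul (D / 2)).add (e3.const_mul a)).const_mul (Real.sin b))).const_mul (1/2 : ℝ)
      refine HasDerivAt.congr_deriv (f := _) (e5.congr_of_eventuallyEq ?_) ?_
      · exact Filter.Eventually.of_forall fun x => rfl
      · have : Real.cos (θ - φ) = Real.cos b * Real.cos (θ - ψ) - Real.sin b * Real.sin (θ - ψ) := by
          rw [← Real.cos_add]; congr 1; rw [hb]; ring
        rw [this]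
        simp only [Function.comp, Pi.pow_apply]
        field_simp
        ring) (by
      intro θ hθ
      have hc := (hcos θ hθ).ne'
      apply ContinuousAt.continuousWithinAt
      have : 2 * Real.cos (θ - ψ) ^ 3 ≠ 0 := by positivity
      fun_prop (disch := assumption))
  refine ⟨this.1, this.2.trans ?_⟩
  simp only [show ψ + σ - ψ = σ by ring, show ψ - σ - ψ = -σ by ring, Real.tan_neg, Real.sin_neg,
    Real.cos_neg]
  linear_combination Real.cos b * hD

lemma cosplus_int (φ a : ℝ) :
    IntegrableOn (fun θ => a / 2 * max (Real.cos (θ - φ)) 0) (Ioo (-Real.pi) Real.pi) ∧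
    ∫ θ in Ioo (-Real.pi) Real.pi, a / 2 * max (Real.cos (θ - φ)) 0 = a := by
  have hpi := Real.pi_pos
  constructor
  · have : Continuous fun θ => a / 2 * max (Real.cos (θ - φ)) 0 := by fun_prop
    exact (this.integrableOn_Icc (a := -Real.pi) (b := Real.pi)).mono_set Ioo_subset_Icc_self
  · rw [← integral_Ioc_eq_integral_Ioo, ← intervalIntegral.integral_of_le (by linarith),
      intervalIntegral.integral_const_mul,
      intervalIntegral.integral_comp_sub_right (fun x => max (Real.cos x) 0) φ]
    have hper : Function.Periodic (fun x => max (Real.cos x) 0) (2 * Real.pi) := by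
      intro x; simp [Real.cos_add_two_pi]
    have e := hper.intervalIntegral_add_eq (-Real.pi - φ) (-(Real.pi / 2))
    rw [show -Real.pi - φ + 2 * Real.pi = Real.pi - φ by ring] at e
    rw [e]
    have hcont : Continuous fun x => max (Real.cos x) 0 := by fun_prop
    rw [← intervalIntegral.integral_add_adjacent_intervals (b := Real.pi / 2)
      (hcont.intervalIntegrable _ _) (hcont.intervalIntegrable _ _)]
    have i1 : ∫ x in (-(Real.pi / 2))..(Real.pi / 2), max (Real.cos x) 0 = 2 := by
      rw [intervalIntegral.integral_congr (g := Real.cos), integral_cos]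
      · simp; norm_num
      · intro x hx
        rw [uIcc_of_le (by linarith)] at hx
        simp only
        exact max_eq_left (Real.cos_nonneg_of_mem_Icc hx)
    have i2 : ∫ x in (Real.pi / 2)..(-(Real.pi / 2) + 2 * Real.pi), max (Real.cos x) 0 = 0 := by
      rw [intervalIntegral.integral_congr (g := fun _ => 0), intervalIntegral.integral_zero]
      intro x hx
      rw [uIcc_of_le (by linarith)] at hx
      simp only
      exact max_eq_right (Real.cos_nonpos_of_pi_div_two_le_of_le hx.1 (by linarith [hx.2]))
    rw [i1, i2]; ring

lemma const_int {α β : ℝ} (h : α ≤ β) (h1 : -Real.pi ≤ α) (h2 : β ≤ Real.pi) (k : ℝ) :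
    IntegrableOn ((Ioo α β).indicator fun _ => k) (Ioo (-Real.pi) Real.pi) ∧
      ∫ θ in Ioo (-Real.pi) Real.pi, (Ioo α β).indicator (fun _ => k) θ = k * β - k * α :=
  ind_int h h1 h2 (fun _ => k) (fun x => k * x)
    (fun x _ => by simpa using (hasDerivAt_id x).const_mul k) continuousOn_const

end Vor

namespace Vor

open Filter Topology

lemma actR {c : Cell} (hc : Good c) {E x x1 x2 : ℝ} (h1 : (E, x1) ∈ c.K) (h2 : (E, x2) ∈ c.K)
    (hx1 : x1 < x) (hx2 : x < x2) {v : ℝ × ℝ} (hv : v ∈ c.V)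
    (ha : 2 * (E * v.1 + x * v.2) = v.1 ^ 2 + v.2 ^ 2) : v.1 ^ 2 + v.2 ^ 2 ≤ 4 * E ^ 2 := by
  have a1 := h1.2 v hv
  have a2 := h2.2 v hv
  simp only at a1 a2
  have v0 : v.2 = 0 := by
    apply le_antisymm
    · by_contra hh
      have : 0 < v.2 * (x2 - x) := mul_pos (by linarith) (by linarith)
      nlinarith
    · by_contra hh
      have : 0 < -v.2 * (x - x1) := mul_pos (by linarith) (by linarith)
      nlinarith
  rw [v0] at ha ⊢
  nlinarith [sq_nonneg (2 * E - v.1)]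

lemma actT {c : Cell} (hc : Good c) {E x x1 x2 : ℝ} (h1 : (x1, E) ∈ c.K) (h2 : (x2, E) ∈ c.K)
    (hx1 : x1 < x) (hx2 : x < x2) {v : ℝ × ℝ} (hv : v ∈ c.V)
    (ha : 2 * (x * v.1 + E * v.2) = v.1 ^ 2 + v.2 ^ 2) : v.1 ^ 2 + v.2 ^ 2 ≤ 4 * E ^ 2 := by
  have := actR hc.sw (E := E) (x := x) (x1 := x1) (x2 := x2) (v := v.swap) ((sw_K _ _).2 h1)
    ((sw_K _ _).2 h2) hx1 hx2 (Finset.mem_image_of_mem _ hv) (by simp; linarith)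
  simp at this; linarith

lemma rect_mem {c : Cell} {e d : ℝ} (he : 0 < e) (hd : 0 < d) (h1 : (e, d) ∈ c.K) (h2 : (e, -d) ∈ c.K)
    (h3 : (-e, d) ∈ c.K) (h4 : (-e, -d) ∈ c.K) {x y : ℝ} (hx : |x| ≤ e) (hy : |y| ≤ d) :
    (x, y) ∈ c.K := by
  rw [abs_le] at hx hy
  have t0 : 0 ≤ (x + e) / (2 * e) := div_nonneg (by linarith) (by linarith)
  have t1 : (x + e) / (2 * e) ≤ 1 := by rw [div_le_one (by linarith)]; linarith
  have s0 : 0 ≤ (y + d) / (2 * d) := div_nonneg (by linarith) (by linarith)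
  have s1 : (y + d) / (2 * d) ≤ 1 := by rw [div_le_one (by linarith)]; linarith
  have a1 := seg h3 h1 t0 t1
  have a2 := seg h4 h2 t0 t1
  have a3 := seg a2 a1 s0 s1
  convert a3 using 1
  ext
  · simp only; field_simp; ring
  · simp only; field_simp; ring

theorem caseX {c : Cell} (h : NT c) (h3 : (-c.e1, c.d1) ∈ c.K) (h4 : (-c.e1, -c.d1) ∈ c.K) : False := by
  have hc := h.good
  have he := hc.e1
  have hd := hc.d1
  set e := c.e1 with hedef
  set d := c.d1 with hddef
  have h1 : (e, d) ∈ c.K := by simpa using hc.sym _ h4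
  have h2 : (e, -d) ∈ c.K := by simpa using hc.sym _ h3
  have hm : ∀ {x y : ℝ}, |x| ≤ e → |y| ≤ d → (x, y) ∈ c.K := fun hx hy =>
    rect_mem he hd h1 h2 h3 h4 hx hy
  have he2 : e < c.e2 := h.r _ h1
  have hd2 : d < c.d2 := h.t _ h1
  obtain ⟨v0, hv0, hv0'⟩ : Act c (0, d) := by
    refine act_of_bd (hm (by simp [he.le]) (by rw [abs_of_pos hd])) ⟨?_, ?_, ?_, ?_⟩ ?_
    · simp; exact he
    · simp; linarith
    · show -d < d; linarith
    · exact hd2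
    · intro s hs hK
      have := h.le2 hK
      simp only at this
      nlinarith
  have hpi := Real.pi_pos
  set θ0 := Real.arctan (d / e) with hθ0
  have t0 : 0 < θ0 := Real.arctan_pos.2 (by positivity)
  have t1 : θ0 < Real.pi / 2 := Real.arctan_lt_pi_div_two _
  have tt : Real.tan θ0 = d / e := Real.tan_arctan _
  have I1 := ind_int (α := -θ0) (β := θ0) (by linarith) (by linarith) (by linarith)
    (fun θ => e / 2 * (1 / Real.cos θ ^ 2)) (fun θ => e / 2 * Real.tan θ)
    (fun θ hθ => (Real.hasDerivAt_tan (Real.cos_pos_of_mem_Ioo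
      ⟨by linarith [hθ.1], by linarith [hθ.2]⟩).ne').const_mul _) (by
      intro θ hθ
      have : Real.cos θ ^ 2 ≠ 0 := pow_ne_zero _ (Real.cos_pos_of_mem_Ioo
        ⟨by linarith [hθ.1], by linarith [hθ.2]⟩).ne'
      apply ContinuousAt.continuousWithinAt
      fun_prop (disch := assumption))
  have I2 := ind_int (α := θ0) (β := Real.pi / 2) (by linarith) (by linarith) (by linarith)
    (fun θ => d / 2 * Real.cos θ) (fun θ => d / 2 * Real.sin θ)
    (fun θ hθ => (Real.hasDerivAt_sin θ).const_mul _) (by fun_prop)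
  have key := FO c hc 0 d (0, d) v0 hd (by simp) (by simp) hv0 hv0' _ (I1.1.add I2.1) (by
    intro θ hθ hg
    simp only [Pi.add_apply] at hg ⊢
    by_cases m1 : θ ∈ Ioo (-θ0) θ0
    · have m2 : θ ∉ Ioo θ0 (Real.pi / 2) := fun hh => by linarith [hh.1, m1.2]
      rw [indicator_of_mem m1, indicator_of_notMem m2]
      have hcos : 0 < Real.cos θ := Real.cos_pos_of_mem_Ioo ⟨by linarith [m1.1], by linarith [m1.2]⟩
      have ha : |e * Real.tan θ| < d := by
        rw [abs_mul, abs_of_pos he, mul_comm, ← lt_div_iff₀ he, ← tt, abs_lt, ← Real.tan_neg]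
        constructor
        · exact Real.tan_lt_tan_of_lt_of_lt_pi_div_two (by linarith) (by linarith [m1.2]) m1.1
        · exact Real.tan_lt_tan_of_lt_of_lt_pi_div_two (by linarith [m1.1]) (by linarith [m1.2]) m1.2
      have q1 : e / Real.cos θ * Real.cos θ = e := by field_simp
      have q2 : e / Real.cos θ * Real.sin θ = e * Real.tan θ := by rw [Real.tan_eq_sin_div_cos]; ring
      have ha' := abs_lt.1 ha
      refine ⟨e / Real.cos θ, e, by positivity, he, ?_, ?_, ?_, by simpa using hcos, ?_, ?_⟩
      · rw [q1, q2]; exact hm (by rw [abs_of_pos he]) ha.le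
      · intro s hs hK
        have := h.le1 hK
        rw [div_lt_iff₀ hcos] at hs
        simp only at this; linarith
      · rw [q1, q2]; refine ⟨by linarith, he2, ?_, ?_⟩ <;> linarith
      · intro v hv hva
        rw [q1, q2] at hva
        exact actR hc h2 h1 ha'.1 ha'.2 hv hva
      · rw [sub_zero]
        apply le_of_eq
        field_simp
        ring
    · by_cases m2 : θ ∈ Ioo θ0 (Real.pi / 2)
      · rw [indicator_of_notMem m1, indicator_of_mem m2]
        have hcos : 0 < Real.cos θ := Real.cos_pos_of_mem_Ioo ⟨by linarith [m2.1], by linarith [m2.2]⟩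
        have hsin : 0 < Real.sin θ := Real.sin_pos_of_pos_of_lt_pi (by linarith [m2.1]) (by linarith [m2.2])
        have htan : d / e < Real.tan θ := by
          rw [← tt]; exact Real.tan_lt_tan_of_lt_of_lt_pi_div_two (by linarith) m2.2 m2.1
        have q1 : d / Real.sin θ * Real.sin θ = d := by field_simp
        have q2 : d / Real.sin θ * Real.cos θ < e := by
          rw [Real.tan_eq_sin_div_cos, div_lt_div_iff₀ he hcos] at htan
          rw [div_mul_eq_mul_div, div_lt_iff₀ hsin]; linarith
        have q3 : 0 < d / Real.sin θ * Real.cos θ := by positivity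
        refine ⟨d / Real.sin θ, d / Real.sin θ, by positivity, by positivity, ?_, ?_, ?_, by simpa using hcos, ?_, ?_⟩
        · exact hm (by rw [abs_of_pos q3]; exact q2.le) (by rw [q1, abs_of_pos hd])
        · intro s hs hK
          have := h.le2 hK
          rw [div_lt_iff₀ hsin] at hs
          simp only at this; linarith
        · rw [q1]; refine ⟨by linarith, by linarith, ?_, ?_⟩ <;> linarith
        · intro v hv hva
          have := act_le (y := (d / Real.sin θ * Real.cos θ, d / Real.sin θ * Real.sin θ)) hva
          simp only at this
          refine this.trans (le_of_eq ?_)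
          have := Real.sin_sq_add_cos_sq θ
          linear_combination (4 * (d / Real.sin θ) ^ 2) * this
        · rw [sub_zero, zero_add]
          have hs1 := Real.sin_le_one θ
          have : (d / Real.sin θ) ^ 3 * Real.cos θ / (2 * (d / Real.sin θ) ^ 2) =
            d / 2 * Real.cos θ / Real.sin θ := by field_simp
          rw [this, le_div_iff₀ hsin]
          have : 0 < d / 2 * Real.cos θ := by positivity
          nlinarith
      · rw [indicator_of_notMem m1, indicator_of_notMem m2] at hg
        simp at hg)
  have e1 := integral_add I1.1 I2.1
  simp only [Pi.add_apply] at key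
  rw [e1, I1.2, I2.2, Real.tan_neg, tt, Real.sin_pi_div_two] at key
  have hs : Real.sin θ0 < 1 := by
    rw [← Real.sin_pi_div_two]
    exact Real.sin_lt_sin_of_lt_of_le_pi_div_two (by linarith) le_rfl t1
  have : e / 2 * (d / e) - e / 2 * -(d / e) = d := by field_simp; ring
  nlinarith

lemma chordAngle (D a : ℝ) (hD : 0 < D) (P : Prop) (hP : P → D < a) :
    ∃ σ, 0 ≤ σ ∧ σ < Real.pi / 2 ∧ D * Real.tan σ = a * Real.sin σ ∧
      (∀ x, |x| < σ → P ∧ 0 < Real.cos x ∧ D < a * Real.cos x) ∧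
      (P → ∀ x, |x| ≤ Real.pi → D < a * Real.cos x → |x| < σ) := by
  have hpi := Real.pi_pos
  by_cases h : P
  · have hDa := hP h
    have ha : 0 < a := hD.trans hDa
    have hpos : 0 < D / a := by positivity
    have hlt : D / a < 1 := by rw [div_lt_one ha]; exact hDa
    have hcos : Real.cos (Real.arccos (D / a)) = D / a := Real.cos_arccos (by linarith) hlt.le
    have hσ : Real.arccos (D / a) < Real.pi / 2 := Real.arccos_lt_pi_div_two.2 hpos
    refine ⟨Real.arccos (D / a), Real.arccos_nonneg _, hσ, ?_, ?_, ?_⟩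
    · rw [Real.tan_eq_sin_div_cos, hcos]; field_simp
    · intro x hx
      have : Real.cos (Real.arccos (D / a)) < Real.cos |x| :=
        Real.cos_lt_cos_of_nonneg_of_le_pi (abs_nonneg x) (by linarith) hx
      rw [hcos, Real.cos_abs, div_lt_iff₀ ha] at this
      refine ⟨h, ?_, by linarith⟩
      by_contra hn
      nlinarith
    · intro _ x hx hD
      by_contra hn
      have : Real.cos |x| ≤ Real.cos (Real.arccos (D / a)) :=
        Real.cos_le_cos_of_nonneg_of_le_pi (Real.arccos_nonneg _) hx (not_lt.1 hn)
      rw [hcos, Real.cos_abs, le_div_iff₀ ha] at this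
      linarith
  · refine ⟨0, le_rfl, by linarith, by simp, ?_, fun hp => absurd hp h⟩
    intro x hx
    exact absurd hx (not_lt.2 (abs_nonneg x))

lemma polar_ex (w : ℝ × ℝ) (hw : w ≠ 0) : ∃ r θ, 0 < r ∧ -Real.pi < θ ∧ θ ≤ Real.pi ∧
    w = (r * Real.cos θ, r * Real.sin θ) := by
  set z : ℂ := ⟨w.1, w.2⟩ with hz
  have hz0 : z ≠ 0 := by
    intro h
    apply hw
    have h1 := congrArg Complex.re h
    have h2 := congrArg Complex.im h
    exact Prod.ext h1 h2
  refine ⟨‖z‖, z.arg, norm_pos_iff.2 hz0, Complex.neg_pi_lt_arg z, Complex.arg_le_pi z, ?_⟩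
  rw [Complex.norm_mul_cos_arg, Complex.norm_mul_sin_arg]

lemma unit_angle (u1 u2 : ℝ) (h : u1 ^ 2 + u2 ^ 2 = 1) : ∃ φ, Real.cos φ = u1 ∧ Real.sin φ = u2 := by
  obtain ⟨r, θ, hr, _, _, he⟩ := polar_ex (u1, u2) (by
    intro h0
    have h1 : u1 = 0 := congrArg Prod.fst h0
    have h2 : u2 = 0 := congrArg Prod.snd h0
    rw [h1, h2] at h; norm_num at h)
  have e1 : u1 = r * Real.cos θ := congrArg Prod.fst he
  have e2 : u2 = r * Real.sin θ := congrArg Prod.snd he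
  have : r = 1 := by
    have := Real.sin_sq_add_cos_sq θ
    rw [e1, e2] at h
    have : r ^ 2 = 1 := by nlinarith
    nlinarith
  refine ⟨θ, by rw [e1, this, one_mul], by rw [e2, this, one_mul]⟩

lemma bdMS {c : Cell} (h : NT c) {z : ℝ × ℝ} (h1 : |z.1| < c.e1) (h2 : |z.2| < c.d1) (hz : z ∉ c.K) :
    ∃ ρ, 0 < ρ ∧ ρ < 1 ∧ (ρ * z.1, ρ * z.2) ∈ MS c ∧ ∀ s, ρ < s → (s * z.1, s * z.2) ∉ c.K := by
  have hc := h.good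
  have hz0 : z ≠ 0 := fun h0 => hz (h0 ▸ hc.zero_mem)
  obtain ⟨ρ, hρ, hK, hout⟩ := hc.radial hz0
  have hρ1 : ρ < 1 := by
    by_contra hn
    apply hz
    have := hc.scale hK (t := 1 / ρ) (by positivity) (by rw [div_le_one hρ]; linarith)
    simp only at this
    rwa [← mul_assoc, ← mul_assoc, one_div, inv_mul_cancel₀ hρ.ne', one_mul, one_mul] at this
  have b1 : |ρ * z.1| < c.e1 := by rw [abs_mul, abs_of_pos hρ]; nlinarith [abs_nonneg z.1]
  have b2 : |ρ * z.2| < c.d1 := by rw [abs_mul, abs_of_pos hρ]; nlinarith [abs_nonneg z.2]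
  rw [abs_lt] at b1 b2
  have hK' := hc.sym _ hK
  have l1 := h.r _ hK'
  have l2 := h.t _ hK'
  simp only [Prod.fst_neg, Prod.snd_neg] at l1 l2
  refine ⟨ρ, hρ, hρ1, ⟨hK, ?_, ?_⟩, hout⟩
  · refine act_of_bd hK ⟨b1.1, h.r _ hK, b2.1, h.t _ hK⟩ fun s hs hh => ?_
    refine hout (s * ρ) (by nlinarith) ?_
    simpa only [mul_assoc] using hh
  · refine act_of_bd hK' ⟨?_, l1, ?_, l2⟩ fun s hs hh => ?_
    · simp only [Prod.fst_neg]; linarith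
    · simp only [Prod.snd_neg]; linarith
    refine hout (s * ρ) (by nlinarith) ?_
    have := hc.sym _ hh
    simpa [mul_assoc] using this

/-- no arc of a circle lies in the boundary of `K` -/
lemma no_arc {c : Cell} (hc : Good c) {a α β : ℝ} (ha : 0 < a) (hαβ : α < β) (h1 : -Real.pi ≤ α)
    (h2 : β ≤ Real.pi) (hK : ∀ θ ∈ Ioo α β, (a * Real.cos θ, a * Real.sin θ) ∈ c.K)
    (hA : ∀ θ ∈ Ioo α β, Act c (a * Real.cos θ, a * Real.sin θ)) : False := by
  have hmaps : MapsTo (fun θ => ((2 * a * Real.cos θ, 2 * a * Real.sin θ) : ℝ × ℝ)) (Ioo α β) (c.V : Set (ℝ × ℝ)) := by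
    intro θ hθ
    obtain ⟨v, hv, hva⟩ := hA θ hθ
    have hmax : IsLocalMax (fun x => 2 * (a * Real.cos x * v.1 + a * Real.sin x * v.2)) θ := by
      filter_upwards [Ioo_mem_nhds hθ.1 hθ.2] with x hx
      have := (hK x hx).2 v hv
      simp only at this hva
      linarith
    have hder : HasDerivAt (fun x => 2 * (a * Real.cos x * v.1 + a * Real.sin x * v.2))
        (2 * (a * (-Real.sin θ) * v.1 + a * Real.cos θ * v.2)) θ :=
      ((((Real.hasDerivAt_cos θ).const_mul a).mul_const v.1).add
        (((Real.hasDerivAt_sin θ).const_mul a).mul_const v.2)).const_mul 2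
    have h0 := hmax.hasDerivAt_eq_zero hder
    have h0' : Real.cos θ * v.2 = Real.sin θ * v.1 := by
      have : a * (Real.cos θ * v.2 - Real.sin θ * v.1) = 0 := by linarith
      have := (mul_eq_zero.1 this).resolve_left ha.ne'
      linarith
    have hsc := Real.sin_sq_add_cos_sq θ
    set p := Real.cos θ * v.1 + Real.sin θ * v.2 with hp
    have v1 : v.1 = p * Real.cos θ := by rw [hp]; linear_combination (-Real.sin θ) * h0' - v.1 * hsc
    have v2 : v.2 = p * Real.sin θ := by rw [hp]; linear_combination (Real.cos θ) * h0' - v.2 * hsc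
    have hpos := hc.pos hv
    simp only at hva
    have hN : v.1 ^ 2 + v.2 ^ 2 = p ^ 2 := by rw [v1, v2]; linear_combination p ^ 2 * hsc
    have hp2 : 2 * a * p = p ^ 2 := by rw [← hN, ← hva, hp]; ring
    have hp0 : p ≠ 0 := by intro h; rw [hN, h] at hpos; norm_num at hpos
    have hpa : p = 2 * a := by
      have : p * (p - 2 * a) = 0 := by linear_combination -hp2
      have := (mul_eq_zero.1 this).resolve_left hp0
      linarith
    have : v = (2 * a * Real.cos θ, 2 * a * Real.sin θ) := by
      ext
      · rw [v1, hpa]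
      · rw [v2, hpa]
    show (2 * a * Real.cos θ, 2 * a * Real.sin θ) ∈ (c.V : Set (ℝ × ℝ))
    rw [← this]; exact hv
  have hinj : InjOn (fun θ => ((2 * a * Real.cos θ, 2 * a * Real.sin θ) : ℝ × ℝ)) (Ioo α β) := by
    intro x hx y hy hxy
    have e1 : 2 * a * Real.cos x = 2 * a * Real.cos y := congrArg Prod.fst hxy
    have e2 : 2 * a * Real.sin x = 2 * a * Real.sin y := congrArg Prod.snd hxy
    have e1 := mul_left_cancel₀ (by positivity : (2 * a) ≠ 0) e1
    have e2 := mul_left_cancel₀ (by positivity : (2 * a) ≠ 0) e2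
    have : Real.cos (x - y) = 1 := by
      rw [Real.cos_sub, e1, e2]; nlinarith [Real.sin_sq_add_cos_sq y]
    rw [Real.cos_eq_one_iff_of_lt_of_lt (by linarith [hx.1, hy.2]) (by linarith [hx.2, hy.1])] at this
    linarith
  exact (Set.infinite_of_injOn_mapsTo hinj hmaps (Ioo_infinite hαβ)) c.V.finite_toSet

end Vor

namespace Vor

open Filter Topology

lemma sqlt {r a : ℝ} (hr : 0 < r) (h : r < a) : r ^ 2 < a ^ 2 :=
  pow_lt_pow_left₀ h hr.le two_ne_zero

lemma exists_z0 {c : Cell} (h : NT c) (hnc : (-c.e1, c.d1) ∉ c.K) :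
    ∃ t : ℝ, 0 < t ∧ t < 1 ∧ ((t * -c.e1, t * c.d1) : ℝ × ℝ) ∉ c.K := by
  have hc := h.good
  have hz0 : ((-c.e1, c.d1) : ℝ × ℝ) ≠ 0 := fun h0 => hnc (h0 ▸ hc.zero_mem)
  obtain ⟨ρ, hρ, hK, hout⟩ := hc.radial hz0
  have hρ1 : ρ < 1 := by
    by_contra hn
    rcases eq_or_lt_of_le (not_lt.1 hn) with h1 | h1
    · apply hnc; rw [← h1] at hK; simpa using hK
    · apply hnc
      have := hc.scale hK (t := 1 / ρ) (by positivity) (by rw [div_le_one hρ]; linarith)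
      simp only at this
      rwa [← mul_assoc, ← mul_assoc, one_div, inv_mul_cancel₀ hρ.ne', one_mul, one_mul] at this
  exact ⟨(ρ + 1) / 2, by linarith, by linarith, hout _ (by linarith)⟩

lemma strictPt {c : Cell} (h : NT c) (hnc : (-c.e1, c.d1) ∉ c.K) {a φ : ℝ} (ha : 0 < a)
    (hA : ∀ y ∈ MS c, a ^ 2 ≤ y.1 ^ 2 + y.2 ^ 2) :
    ∃ θ r, -Real.pi < θ ∧ θ < Real.pi ∧ a < r ∧ (r * Real.cos θ, r * Real.sin θ) ∈ c.K ∧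
      0 < Real.cos (θ - φ) := by
  have hc := h.good
  have he := hc.e1
  have hd := hc.d1
  have hpi := Real.pi_pos
  by_contra hcon
  push Not at hcon
  set N : Set (ℝ × ℝ) := {z | |z.1| < c.e1 ∧ |z.2| < c.d1 ∧ z ∉ c.K ∧ z.2 ≠ 0} with hN
  have hNo : IsOpen N := by
    have o1 : IsOpen {z : ℝ × ℝ | |z.1| < c.e1} := isOpen_lt (by fun_prop) (by fun_prop)
    have o2 : IsOpen {z : ℝ × ℝ | |z.2| < c.d1} := isOpen_lt (by fun_prop) (by fun_prop)
    have o3 : IsClosed {z : ℝ × ℝ | z.2 = 0} := isClosed_eq (by fun_prop) (by fun_prop)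
    exact o1.inter (o2.inter (c.isClosed_K.isOpen_compl.inter o3.isOpen_compl))
  set dt : ℝ × ℝ → ℝ := fun z => z.1 * Real.cos φ + z.2 * Real.sin φ with hdt
  have hdtc : Continuous dt := by fun_prop
  obtain ⟨z1, hz1N, hz1u⟩ : ∃ z ∈ N, 0 < dt z := by
    obtain ⟨t, t0, t1, htK⟩ := exists_z0 h hnc
    have hz0 : ((t * -c.e1, t * c.d1) : ℝ × ℝ) ∈ N := by
      refine ⟨?_, ?_, htK, ?_⟩
      · simp only [mul_neg, abs_neg]
        rw [abs_of_pos (by positivity)]; nlinarith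
      · simp only; rw [abs_of_pos (by positivity)]; nlinarith
      · simp only; positivity
    have hz0' : -((t * -c.e1, t * c.d1) : ℝ × ℝ) ∈ N := by
      obtain ⟨b1, b2, b3, b4⟩ := hz0
      refine ⟨by simpa using b1, by simpa using b2, fun hk => b3 ?_, by simpa using b4⟩
      simpa using hc.sym _ hk
    rcases lt_trichotomy (dt (t * -c.e1, t * c.d1)) 0 with h0 | h0 | h0
    · refine ⟨_, hz0', ?_⟩
      simp only [hdt, Prod.fst_neg, Prod.snd_neg] at h0 ⊢; linarith
    · have hcont : Continuous fun s : ℝ =>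
          ((t * -c.e1 + s * Real.cos φ, t * c.d1 + s * Real.sin φ) : ℝ × ℝ) := by fun_prop
      have h0' := hcont.tendsto 0
      simp only [zero_mul, add_zero] at h0'
      obtain ⟨s, hs, hsN⟩ := exists_gt_of_ev (h0'.eventually (hNo.mem_nhds hz0))
      refine ⟨_, hsN, ?_⟩
      simp only [hdt] at h0 ⊢
      have : 0 < s * (Real.sin φ ^ 2 + Real.cos φ ^ 2) := by rw [Real.sin_sq_add_cos_sq]; linarith
      nlinarith
    · exact ⟨_, hz0, h0⟩
  obtain ⟨r1, θ1, hr1, hθ1, hθ1', he1⟩ := polar_ex z1 (fun h0 => hz1N.2.2.1 (h0 ▸ hc.zero_mem))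
  have hθ1'' : θ1 < Real.pi := by
    refine lt_of_le_of_ne hθ1' fun h0 => hz1N.2.2.2 ?_
    rw [he1, h0]; simp
  have hcont : Continuous fun θ : ℝ => ((r1 * Real.cos θ, r1 * Real.sin θ) : ℝ × ℝ) := by fun_prop
  have hev : ∀ᶠ θ in 𝓝 θ1, (((r1 * Real.cos θ, r1 * Real.sin θ) : ℝ × ℝ) ∈ N ∧
      0 < dt (r1 * Real.cos θ, r1 * Real.sin θ)) ∧ θ ∈ Ioo (-Real.pi) Real.pi := by
    have e1 : ∀ᶠ z in 𝓝 z1, z ∈ N ∧ 0 < dt z :=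
      Filter.Eventually.and (hNo.mem_nhds hz1N) ((hdtc.tendsto z1).eventually_const_lt hz1u)
    rw [he1] at e1
    exact ((hcont.tendsto θ1).eventually e1).and (Ioo_mem_nhds hθ1 hθ1'')
  obtain ⟨ε, hε, hball⟩ := Metric.eventually_nhds_iff.1 hev
  have hball' : ∀ θ ∈ Ioo (θ1 - ε) (θ1 + ε), (((r1 * Real.cos θ, r1 * Real.sin θ) : ℝ × ℝ) ∈ N ∧
      0 < dt (r1 * Real.cos θ, r1 * Real.sin θ)) ∧ θ ∈ Ioo (-Real.pi) Real.pi := by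
    intro θ hθ
    apply hball
    rw [Real.dist_eq, abs_lt]; constructor <;> linarith [hθ.1, hθ.2]
  have hall : ∀ θ ∈ Ioo (θ1 - ε) (θ1 + ε), (a * Real.cos θ, a * Real.sin θ) ∈ c.K ∧
      Act c (a * Real.cos θ, a * Real.sin θ) := by
    intro θ hθ
    obtain ⟨⟨⟨b1, b2, b3, b4⟩, b5⟩, b6⟩ := hball' θ hθ
    obtain ⟨ρ, hρ, hρ1, hM, hout⟩ := bdMS h b1 b2 b3
    simp only [← mul_assoc] at hM
    have hle := hA _ hM
    have hsc := Real.sin_sq_add_cos_sq θ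
    have hge : a ≤ ρ * r1 := by
      have : (ρ * r1 * Real.cos θ) ^ 2 + (ρ * r1 * Real.sin θ) ^ 2 = (ρ * r1) ^ 2 := by
        linear_combination (ρ * r1) ^ 2 * hsc
      simp only at hle
      rw [this] at hle
      have : 0 < ρ * r1 := by positivity
      nlinarith
    have hcosφ : 0 < Real.cos (θ - φ) := by
      have : dt (r1 * Real.cos θ, r1 * Real.sin θ) = r1 * Real.cos (θ - φ) := by
        simp only [hdt, Real.cos_sub]; ring
      rw [this] at b5
      exact (pos_iff_pos_of_mul_pos b5).1 hr1
    have heq : a = ρ * r1 := by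
      rcases hge.lt_or_eq with h1 | h1
      · exact absurd hcosφ (not_lt.2 (hcon θ _ b6.1 b6.2 h1 hM.1))
      · exact h1
    rw [heq]
    exact ⟨hM.1, hM.2.1⟩
  have hθa := (hball' (θ1 - ε/2) ⟨by linarith, by linarith⟩).2
  have hθb := (hball' (θ1 + ε/2) ⟨by linarith, by linarith⟩).2
  exact no_arc hc ha (α := θ1 - ε/2) (β := θ1 + ε/2) (by linarith) hθa.1.le hθb.2.le
    (fun θ hθ => (hall θ ⟨by linarith [hθ.1], by linarith [hθ.2]⟩).1)
    (fun θ hθ => (hall θ ⟨by linarith [hθ.1], by linarith [hθ.2]⟩).2)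

/-- an arc on which the boundary is further away than `a` -/
lemma arcI {c : Cell} (h : NT c) (hnc : (-c.e1, c.d1) ∉ c.K) {a φ : ℝ} (ha : 0 < a)
    (hA : ∀ y ∈ MS c, a ^ 2 ≤ y.1 ^ 2 + y.2 ^ 2) :
    ∃ α β η κ, -Real.pi ≤ α ∧ α < β ∧ β ≤ Real.pi ∧ 0 < η ∧ 0 < κ ∧ ∀ θ ∈ Ioo α β,
      ((a + η) * Real.cos θ, (a + η) * Real.sin θ) ∈ c.K ∧ κ ≤ η / 2 * Real.cos (θ - φ) := by
  have hc := h.good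
  obtain ⟨θ1, r, h1, h2, har, hK, hcos⟩ := strictPt h hnc (φ := φ) ha hA
  set η := (r - a) / 2 with hη
  have hη0 : 0 < η := by rw [hη]; linarith
  have hr : 0 < r := ha.trans har
  have hn := hc.scale_nhds hK (t := (a + η) / r) (by positivity) (by rw [div_lt_one hr]; linarith)
  simp only [← mul_assoc, div_mul_cancel₀ _ hr.ne'] at hn
  have hcont : Continuous fun θ : ℝ => (((a + η) * Real.cos θ, (a + η) * Real.sin θ) : ℝ × ℝ) := by fun_prop
  have hcont2 : Continuous fun θ : ℝ => η / 2 * Real.cos (θ - φ) := by fun_prop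
  have hκ : 0 < η / 2 * Real.cos (θ1 - φ) := by positivity
  have hev := ((hcont.tendsto θ1).eventually hn).and (((hcont2.tendsto θ1).eventually_const_lt
    (half_lt_self hκ)).and (Ioo_mem_nhds h1 h2))
  obtain ⟨ε, hε, hball⟩ := Metric.eventually_nhds_iff.1 hev
  have hball' : ∀ θ, |θ - θ1| < ε → _ := fun θ hθ => hball (y := θ) hθ
  have p1 := (hball' (θ1 - ε/2) (by rw [abs_lt]; constructor <;> linarith)).2.2
  have p2 := (hball' (θ1 + ε/2) (by rw [abs_lt]; constructor <;> linarith)).2.2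
  refine ⟨θ1 - ε/2, θ1 + ε/2, η, _, p1.1.le, by linarith, p2.2.le, hη0, half_pos hκ, fun θ hθ => ?_⟩
  have := hball' θ (by rw [abs_lt]; constructor <;> linarith [hθ.1, hθ.2])
  exact ⟨this.1, this.2.1.le⟩

lemma exists_u {c : Cell} (h : NT c)
    (hcor : (∃ y ∈ c.K, y.1 = -c.e1) → (∃ y ∈ c.K, y.2 = -c.d1) → (-c.e1, -c.d1) ∈ c.K)
    {w : ℝ × ℝ} (hw : w ∈ MS c) {a : ℝ} (ha : 0 < a) (haw : w.1 ^ 2 + w.2 ^ 2 = a ^ 2) :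
    ∃ φ l, l ≠ 0 ∧ Real.cos φ = l * -w.2 ∧ Real.sin φ = l * w.1 ∧
      ∀ y ∈ c.K, (y.1 = -c.e1 ∨ y.2 = -c.d1) → y.1 * Real.cos φ + y.2 * Real.sin φ ≤ 0 := by
  have key : ∀ y ∈ c.K, ∀ y' ∈ c.K, (y.1 = -c.e1 ∨ y.2 = -c.d1) → (y'.1 = -c.e1 ∨ y'.2 = -c.d1) →
      0 < -w.2 * y.1 + w.1 * y.2 → -w.2 * y'.1 + w.1 * y'.2 < 0 → False := by
    intro y hy y' hy' h1 h2 hp hm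
    rcases h1 with h1 | h1 <;> rcases h2 with h2 | h2
    · exact signL h hw hy hy' h1 h2 hp hm
    · exact signM h (hcor ⟨y, hy, h1⟩ ⟨y', hy', h2⟩) hw hy hy' h1 h2 hp hm
    · refine signM h (hcor ⟨y', hy', h2⟩ ⟨y, hy, h1⟩) (MS_neg h.good hw) hy' hy h2 h1 ?_ ?_
      · simp only [Prod.fst_neg, Prod.snd_neg]; linarith
      · simp only [Prod.fst_neg, Prod.snd_neg]; linarith
    · exact signB h hw hy hy' h1 h2 hp hm
  by_cases hpos : ∃ y ∈ c.K, (y.1 = -c.e1 ∨ y.2 = -c.d1) ∧ 0 < -w.2 * y.1 + w.1 * y.2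
  · obtain ⟨y, hy, h1, hp⟩ := hpos
    obtain ⟨φ, hφ1, hφ2⟩ := unit_angle (-a⁻¹ * -w.2) (-a⁻¹ * w.1) (by field_simp; linarith)
    refine ⟨φ, -a⁻¹, by simpa using ha.ne', hφ1, hφ2, fun y' hy' h2 => ?_⟩
    rw [hφ1, hφ2]
    have : 0 ≤ -w.2 * y'.1 + w.1 * y'.2 := by
      by_contra hh
      exact key y hy y' hy' h1 h2 hp (not_le.1 hh)
    have := mul_nonneg (inv_pos.2 ha).le this
    linarith
  · push Not at hpos
    obtain ⟨φ, hφ1, hφ2⟩ := unit_angle (a⁻¹ * -w.2) (a⁻¹ * w.1) (by field_simp; linarith)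
    refine ⟨φ, a⁻¹, by simpa using ha.ne', hφ1, hφ2, fun y' hy' h2 => ?_⟩
    rw [hφ1, hφ2]
    have := mul_nonpos_of_nonneg_of_nonpos (inv_pos.2 ha).le (hpos y' hy' h2)
    linarith

set_option maxHeartbeats 1000000 in
theorem caseY {c : Cell} (h : NT c)
    (hcor : (∃ y ∈ c.K, y.1 = -c.e1) → (∃ y ∈ c.K, y.2 = -c.d1) → (-c.e1, -c.d1) ∈ c.K)
    (hnc : (-c.e1, c.d1) ∉ c.K) : False := by
  have hc := h.good
  have he := hc.e1
  have hd := hc.d1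
  have hpi := Real.pi_pos
  -- the minimal point
  obtain ⟨t, t0, t1, htK⟩ := exists_z0 h hnc
  obtain ⟨ρ, hρ, hρ1, hM0, -⟩ := bdMS h (z := (t * -c.e1, t * c.d1))
    (by simp only [mul_neg, abs_neg]; rw [abs_of_pos (by positivity)]; nlinarith)
    (by simp only; rw [abs_of_pos (by positivity)]; nlinarith) htK
  obtain ⟨w, hw, hmin⟩ := (MS_compact c).exists_isMinOn ⟨_, hM0⟩
    (f := fun y : ℝ × ℝ => y.1 ^ 2 + y.2 ^ 2) (by fun_prop)
  have hmin' : ∀ y ∈ MS c, w.1 ^ 2 + w.2 ^ 2 ≤ y.1 ^ 2 + y.2 ^ 2 := fun y hy => hmin hy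
  have hAed : w.1 ^ 2 + w.2 ^ 2 ≤ c.e1 ^ 2 + c.d1 ^ 2 := by
    refine (hmin' _ hM0).trans ?_
    have : (ρ * t) ^ 2 ≤ 1 := by
      have : ρ * t ≤ 1 := by nlinarith
      have : 0 ≤ ρ * t := by positivity
      nlinarith
    have e : (ρ * (t * -c.e1)) ^ 2 + (ρ * (t * c.d1)) ^ 2 = (ρ * t) ^ 2 * (c.e1 ^ 2 + c.d1 ^ 2) := by ring
    simp only
    rw [e]
    have : 0 ≤ c.e1 ^ 2 + c.d1 ^ 2 := by positivity
    nlinarith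
  obtain ⟨v0, hv0, hv0'⟩ := hw.2.1
  have hwpos : 0 < w.1 ^ 2 + w.2 ^ 2 := by
    have := act_le hv0'
    have := hc.pos hv0
    linarith
  set a := Real.sqrt (w.1 ^ 2 + w.2 ^ 2) with hadef
  have ha : 0 < a := Real.sqrt_pos.2 hwpos
  have ha2 : w.1 ^ 2 + w.2 ^ 2 = a ^ 2 := (Real.sq_sqrt hwpos.le).symm
  rw [ha2] at hAed
  have hA : ∀ y ∈ MS c, a ^ 2 ≤ y.1 ^ 2 + y.2 ^ 2 := fun y hy => ha2 ▸ hmin' y hy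
  obtain ⟨φ, l, hl, hφ1, hφ2, hC⟩ := exists_u h hcor hw ha ha2
  obtain ⟨α, β, η, κ, hα, hαβ, hβ, hη, hκ, hI⟩ := arcI h hnc (φ := φ) ha hA
  have hdot : ∀ r θ : ℝ, r * Real.cos θ * Real.cos φ + r * Real.sin θ * Real.sin φ = r * Real.cos (θ - φ) := by
    intro r θ; rw [Real.cos_sub]; ring
  have hnorm : ∀ r θ : ℝ, (r * Real.cos θ) ^ 2 + (r * Real.sin θ) ^ 2 = r ^ 2 := by
    intro r θ; linear_combination r ^ 2 * Real.sin_sq_add_cos_sq θ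
  -- points of the top and right chords are in the half plane
  have wle1 : w.1 ^ 2 ≤ c.e1 ^ 2 := sq_le_sq' hw.1.1.1 (h.le1 hw.1)
  have wle2 : w.2 ^ 2 ≤ c.d1 ^ 2 := sq_le_sq' hw.1.1.2.2.1 (h.le2 hw.1)
  have hperp : ∀ y : ℝ × ℝ, y.1 * Real.cos φ + y.2 * Real.sin φ = 0 → y.2 * w.1 = y.1 * w.2 := by
    intro y hy
    rw [hφ1, hφ2] at hy
    have : l * (y.2 * w.1 - y.1 * w.2) = 0 := by linarith
    have := (mul_eq_zero.1 this).resolve_left hl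
    linarith
  have uposT : ∀ x, (x, c.d1) ∈ c.K → x ^ 2 + c.d1 ^ 2 < a ^ 2 → 0 < x * Real.cos φ + c.d1 * Real.sin φ := by
    intro x hx hxa
    have h1 := hC _ (hc.sym _ hx) (Or.inr (by simp))
    simp only [Prod.fst_neg, Prod.snd_neg] at h1
    rcases (show 0 ≤ x * Real.cos φ + c.d1 * Real.sin φ by linarith).lt_or_eq with h2 | h2
    · exact h2
    · exfalso
      have h3 := hperp (x, c.d1) h2.symm
      simp only at h3
      have : w.2 ^ 2 * (x ^ 2 + c.d1 ^ 2) = c.d1 ^ 2 * a ^ 2 := by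
        rw [← ha2]; linear_combination (-(c.d1 * w.1 + x * w.2)) * h3
      nlinarith [mul_pos hd hd, sq_nonneg x]
  have uposR : ∀ x, (c.e1, x) ∈ c.K → c.e1 ^ 2 + x ^ 2 < a ^ 2 → 0 < c.e1 * Real.cos φ + x * Real.sin φ := by
    intro x hx hxa
    have h1 := hC _ (hc.sym _ hx) (Or.inl (by simp))
    simp only [Prod.fst_neg, Prod.snd_neg] at h1
    rcases (show 0 ≤ c.e1 * Real.cos φ + x * Real.sin φ by linarith).lt_or_eq with h2 | h2
    · exact h2
    · exfalso
      have h3 := hperp (c.e1, x) h2.symm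
      simp only at h3
      have : w.1 ^ 2 * (c.e1 ^ 2 + x ^ 2) = c.e1 ^ 2 * a ^ 2 := by
        rw [← ha2]; linear_combination (c.e1 * w.2 + x * w.1) * h3
      nlinarith [mul_pos he he, sq_nonneg x]
  obtain ⟨σT, sT0, sT1, sT2, sT3, sT4⟩ := chordAngle c.d1 a hd
    (∃ x0, (x0, c.d1) ∈ c.K ∧ x0 ^ 2 + c.d1 ^ 2 < a ^ 2) (by
      rintro ⟨x0, -, hx0⟩; nlinarith [sq_nonneg x0])
  obtain ⟨σR, sR0, sR1, sR2, sR3, sR4⟩ := chordAngle c.e1 a he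
    (∃ x0, (c.e1, x0) ∈ c.K ∧ c.e1 ^ 2 + x0 ^ 2 < a ^ 2) (by
      rintro ⟨x0, -, hx0⟩; nlinarith [sq_nonneg x0])
  have memT : ∀ θ ∈ Ioo (Real.pi / 2 - σT) (Real.pi / 2 + σT), 0 < Real.sin θ ∧
      ((c.d1 / Real.sin θ) * Real.cos θ) ^ 2 + c.d1 ^ 2 < a ^ 2 ∧
      (∀ x, x ^ 2 + c.d1 ^ 2 < a ^ 2 → (x, c.d1) ∈ c.K) ∧ 0 < Real.cos (θ - φ) ∧ c.d1 / Real.sin θ < a := by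
    intro θ hθ
    obtain ⟨⟨x0, hx0, hx0'⟩, p2, p3⟩ := sT3 (θ - Real.pi / 2) (by rw [abs_lt]; constructor <;> linarith [hθ.1, hθ.2])
    rw [Real.cos_sub_pi_div_two] at p2 p3
    have q1 : c.d1 / Real.sin θ < a := by rw [div_lt_iff₀ p2]; exact p3
    have q0 : 0 < c.d1 / Real.sin θ := by positivity
    have q2 : c.d1 / Real.sin θ * Real.sin θ = c.d1 := by field_simp
    have q3 : ((c.d1 / Real.sin θ) * Real.cos θ) ^ 2 + c.d1 ^ 2 < a ^ 2 := by
      have := hnorm (c.d1 / Real.sin θ) θ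
      rw [q2] at this
      rw [this]; exact sqlt q0 q1
    have q4 : ∀ x, x ^ 2 + c.d1 ^ 2 < a ^ 2 → (x, c.d1) ∈ c.K := fun x hx => chordT h hnc hA hAed hx0 hx0' hx
    refine ⟨p2, q3, q4, ?_, q1⟩
    have := uposT _ (q4 _ q3) q3
    have e := hdot (c.d1 / Real.sin θ) θ
    rw [q2] at e
    rw [e] at this
    exact (pos_iff_pos_of_mul_pos this).1 q0
  have memR : ∀ θ ∈ Ioo (0 - σR) (0 + σR), 0 < Real.cos θ ∧
      c.e1 ^ 2 + ((c.e1 / Real.cos θ) * Real.sin θ) ^ 2 < a ^ 2 ∧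
      (∀ x, c.e1 ^ 2 + x ^ 2 < a ^ 2 → (c.e1, x) ∈ c.K) ∧ 0 < Real.cos (θ - φ) ∧ c.e1 / Real.cos θ < a := by
    intro θ hθ
    obtain ⟨⟨x0, hx0, hx0'⟩, p2, p3⟩ := sR3 θ (by rw [abs_lt]; constructor <;> linarith [hθ.1, hθ.2])
    have q1 : c.e1 / Real.cos θ < a := by rw [div_lt_iff₀ p2]; exact p3
    have q0 : 0 < c.e1 / Real.cos θ := by positivity
    have q2 : c.e1 / Real.cos θ * Real.cos θ = c.e1 := by field_simp
    have q3 : c.e1 ^ 2 + ((c.e1 / Real.cos θ) * Real.sin θ) ^ 2 < a ^ 2 := by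
      have := hnorm (c.e1 / Real.cos θ) θ
      rw [q2] at this
      rw [this]; exact sqlt q0 q1
    have q4 : ∀ x, c.e1 ^ 2 + x ^ 2 < a ^ 2 → (c.e1, x) ∈ c.K := fun x hx => chordR h hnc hA hAed hx0 hx0' hx
    refine ⟨p2, q3, q4, ?_, q1⟩
    have := uposR _ (q4 _ q3) q3
    have e := hdot (c.e1 / Real.cos θ) θ
    rw [q2] at e
    rw [e] at this
    exact (pos_iff_pos_of_mul_pos this).1 q0
  have J0 := cosplus_int φ a
  have J1 := chord_int (Real.pi / 2) σT φ c.d1 a sT0 sT1 (by linarith) (by linarith) sT2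
  have J2 := chord_int 0 σR φ c.e1 a sR0 sR1 (by linarith) (by linarith) sR2
  have J3 := const_int hαβ.le hα hβ κ
  have key := FO c hc φ a w v0 ha ha2 (by rw [hφ1, hφ2]; ring) hv0 hv0' _
    (((J0.1.add J1.1).add J2.1).add J3.1) (by
    intro θ hθ hg
    simp only [Pi.add_apply] at hg ⊢
    have hcos : 0 < Real.cos (θ - φ) := by
      by_contra hn
      have n1 : θ ∉ Ioo (Real.pi / 2 - σT) (Real.pi / 2 + σT) := fun hh => hn (memT θ hh).2.2.2.1
      have n2 : θ ∉ Ioo (0 - σR) (0 + σR) := fun hh => hn (memR θ hh).2.2.2.1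
      have n3 : θ ∉ Ioo α β := fun hh => by
        have := (hI θ hh).2
        have := mul_nonpos_of_nonneg_of_nonpos (half_pos hη).le (not_lt.1 hn)
        linarith
      rw [indicator_of_notMem n1, indicator_of_notMem n2, indicator_of_notMem n3,
        max_eq_right (not_lt.1 hn)] at hg
      simp at hg
    rw [max_eq_left hcos.le]
    obtain ⟨r, hr, hrK, hout⟩ := hc.radial (w := (Real.cos θ, Real.sin θ)) (by
      intro h0
      have h1 : Real.cos θ = 0 := congrArg Prod.fst h0
      have h2 : Real.sin θ = 0 := congrArg Prod.snd h0
      have := Real.sin_sq_add_cos_sq θ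
      rw [h1, h2] at this; norm_num at this)
    simp only at hrK hout
    have hyu : 0 < r * Real.cos θ * Real.cos φ + r * Real.sin θ * Real.sin φ := by
      rw [hdot]; positivity
    have hsb : -c.e1 < r * Real.cos θ ∧ r * Real.cos θ < c.e2 ∧ -c.d1 < r * Real.sin θ ∧
        r * Real.sin θ < c.d2 := by
      refine ⟨?_, h.r _ hrK, ?_, h.t _ hrK⟩
      · refine lt_of_le_of_ne hrK.1.1 fun h0 => ?_
        have := hC _ hrK (Or.inl h0.symm)
        simp only at this; linarith
      · refine lt_of_le_of_ne hrK.1.2.2.1 fun h0 => ?_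
        have := hC _ hrK (Or.inr h0.symm)
        simp only at this; linarith
    have inT : θ ∈ Ioo (Real.pi / 2 - σT) (Real.pi / 2 + σT) → r * Real.sin θ = c.d1 ∧ r < a := by
      intro hh
      obtain ⟨p1, p2, p3, -, p5⟩ := memT θ hh
      have q2 : c.d1 / Real.sin θ * Real.sin θ = c.d1 := by field_simp
      have hle : c.d1 / Real.sin θ ≤ r := by
        by_contra hn
        apply hout _ (not_le.1 hn)
        rw [q2]; exact p3 _ p2
      have := h.le2 hrK
      simp only at this
      have hge : r ≤ c.d1 / Real.sin θ := by rw [le_div_iff₀ p1]; exact this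
      rw [le_antisymm hge hle]
      exact ⟨q2, p5⟩
    have inR : θ ∈ Ioo (0 - σR) (0 + σR) → r * Real.cos θ = c.e1 ∧ r < a := by
      intro hh
      obtain ⟨p1, p2, p3, -, p5⟩ := memR θ hh
      have q2 : c.e1 / Real.cos θ * Real.cos θ = c.e1 := by field_simp
      have hle : c.e1 / Real.cos θ ≤ r := by
        by_contra hn
        apply hout _ (not_le.1 hn)
        rw [q2]; exact p3 _ p2
      have := h.le1 hrK
      simp only at this
      have hge : r ≤ c.e1 / Real.cos θ := by rw [le_div_iff₀ p1]; exact this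
      rw [le_antisymm hge hle]
      exact ⟨q2, p5⟩
    have inI : θ ∈ Ioo α β → a + η ≤ r := by
      intro hh
      by_contra hn
      exact hout _ (not_le.1 hn) (hI θ hh).1
    by_cases m1 : θ ∈ Ioo (Real.pi / 2 - σT) (Real.pi / 2 + σT)
    · obtain ⟨g1, g2⟩ := inT m1
      obtain ⟨p1, p2, p3, -, p5⟩ := memT θ m1
      have n2 : θ ∉ Ioo (0 - σR) (0 + σR) := fun hh => by
        have := (inR hh).1
        have e := hnorm r θ
        rw [g1, this] at e
        linarith [sqlt hr g2]
      have n3 : θ ∉ Ioo α β := fun hh => by linarith [inI hh]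
      rw [indicator_of_mem m1, indicator_of_notMem n2, indicator_of_notMem n3]
      refine ⟨r, c.d1, hr, hd, hrK, hout, hsb, hcos, ?_, ?_⟩
      · intro v hv hva
        rw [g1] at hva
        have hx : (r * Real.cos θ) ^ 2 + c.d1 ^ 2 < a ^ 2 := by
          rw [← g1, hnorm]; exact sqlt hr g2
        have hcont : Continuous fun s : ℝ => s ^ 2 + c.d1 ^ 2 := by fun_prop
        have hev := (hcont.tendsto (r * Real.cos θ)).eventually_lt_const hx
        obtain ⟨ε, hε, hb⟩ := Metric.eventually_nhds_iff.1 hev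
        have b1 := p3 _ (hb (y := r * Real.cos θ - ε / 2) (by rw [Real.dist_eq, abs_lt]; constructor <;> linarith))
        have b2 := p3 _ (hb (y := r * Real.cos θ + ε / 2) (by rw [Real.dist_eq, abs_lt]; constructor <;> linarith))
        exact actT hc b1 b2 (by linarith) (by linarith) hv hva
      · rw [Real.cos_sub_pi_div_two]
        apply le_of_eq
        rw [← g1]
        field_simp
        ring
    by_cases m2 : θ ∈ Ioo (0 - σR) (0 + σR)
    · obtain ⟨g1, g2⟩ := inR m2
      obtain ⟨p1, p2, p3, -, p5⟩ := memR θ m2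
      have n3 : θ ∉ Ioo α β := fun hh => by linarith [inI hh]
      rw [indicator_of_notMem m1, indicator_of_mem m2, indicator_of_notMem n3]
      refine ⟨r, c.e1, hr, he, hrK, hout, hsb, hcos, ?_, ?_⟩
      · intro v hv hva
        rw [g1] at hva
        have hx : c.e1 ^ 2 + (r * Real.sin θ) ^ 2 < a ^ 2 := by
          rw [← g1, hnorm]; exact sqlt hr g2
        have hcont : Continuous fun s : ℝ => c.e1 ^ 2 + s ^ 2 := by fun_prop
        have hev := (hcont.tendsto (r * Real.sin θ)).eventually_lt_const hx
        obtain ⟨ε, hε, hb⟩ := Metric.eventually_nhds_iff.1 hev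
        have b1 := p3 _ (hb (y := r * Real.sin θ - ε / 2) (by rw [Real.dist_eq, abs_lt]; constructor <;> linarith))
        have b2 := p3 _ (hb (y := r * Real.sin θ + ε / 2) (by rw [Real.dist_eq, abs_lt]; constructor <;> linarith))
        exact actR hc b1 b2 (by linarith) (by linarith) hv hva
      · rw [sub_zero]
        apply le_of_eq
        rw [← g1]
        field_simp
        ring
    -- remaining directions: the boundary is at distance at least `a`
    have har : a ≤ r := by
      by_contra hn
      have hra : r < a := not_le.1 hn
      have hbd : ∀ s, 1 < s → (s * (r * Real.cos θ), s * (r * Real.sin θ)) ∉ c.K := by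
        intro s hs
        rw [← mul_assoc, ← mul_assoc]
        exact hout _ ((lt_mul_iff_one_lt_left hr).2 hs)
      have hact := act_of_bd hrK hsb hbd
      have hnM : (r * Real.cos θ, r * Real.sin θ) ∉ MS c := fun hm => by
        have := hA _ hm
        simp only at this
        rw [hnorm] at this
        exact absurd this (not_le.2 (sqlt hr hra))
      have hnact : ¬ Act c (-(r * Real.cos θ, r * Real.sin θ)) := fun hh => hnM ⟨hrK, hact, hh⟩
      have hK' := hc.sym _ hrK
      have hside : r * Real.cos θ = c.e1 ∨ r * Real.sin θ = c.d1 := by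
        by_contra hno
        push Not at hno
        apply hnact
        refine act_of_bd hK' ⟨?_, h.r _ hK', ?_, h.t _ hK'⟩ ?_
        · have := h.le1 hrK
          simp only [Prod.fst_neg] at this ⊢
          have := lt_of_le_of_ne this hno.1
          linarith
        · have := h.le2 hrK
          simp only [Prod.snd_neg] at this ⊢
          have := lt_of_le_of_ne this hno.2
          linarith
        · intro s hs hh
          apply hbd s hs
          have := hc.sym _ hh
          simpa using this
      have e := hnorm r θ
      rcases hside with h1 | h1
      · apply m2
        rw [h1] at hrK e
        have := sR4 ⟨_, hrK, by rw [e]; exact sqlt hr hra⟩ θ (abs_le.2 ⟨hθ.1.le, hθ.2.le⟩) (by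
          have : 0 < Real.cos θ := by
            rw [← h1] at he; exact (pos_iff_pos_of_mul_pos he).1 hr
          rw [← h1]; exact mul_lt_mul_of_pos_right hra this)
        rw [abs_lt] at this
        constructor <;> linarith [this.1, this.2]
      · apply m1
        rw [h1] at hrK e
        have hs : 0 < Real.sin θ := by
          rw [← h1] at hd; exact (pos_iff_pos_of_mul_pos hd).1 hr
        have hθ0 : 0 < θ := by
          by_contra hn
          have := Real.sin_nonpos_of_nonpos_of_neg_pi_le (not_lt.1 hn) hθ.1.le
          linarith
        have := sT4 ⟨_, hrK, by rw [e]; exact sqlt hr hra⟩ (θ - Real.pi / 2) (abs_le.2 ⟨by linarith, by linarith [hθ.2]⟩) (by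
          rw [Real.cos_sub_pi_div_two, ← h1]; exact mul_lt_mul_of_pos_right hra hs)
        rw [abs_lt] at this
        constructor <;> linarith [this.1, this.2]
    refine ⟨r, r, hr, hr, hrK, hout, hsb, hcos, ?_, ?_⟩
    · intro v hv hva
      have := act_le (y := (r * Real.cos θ, r * Real.sin θ)) hva
      simp only at this
      rwa [hnorm] at this
    · rw [indicator_of_notMem m1, indicator_of_notMem m2]
      have e : r ^ 3 * Real.cos (θ - φ) / (2 * r ^ 2) = r / 2 * Real.cos (θ - φ) := by field_simp
      rw [e]
      by_cases m3 : θ ∈ Ioo α β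
      · rw [indicator_of_mem m3]
        have i1 := inI m3
        have i2 := (hI θ m3).2
        have i3 := mul_nonneg (show 0 ≤ r - (a + η) by linarith) hcos.le
        linarith
      · rw [indicator_of_notMem m3]
        have i3 := mul_nonneg (show 0 ≤ r - a by linarith) hcos.le
        linarith)
  have e3 := integral_add ((J0.1.add J1.1).add J2.1) J3.1
  have e2 := integral_add (J0.1.add J1.1) J2.1
  have e1 := integral_add J0.1 J1.1
  simp only [Pi.add_apply] at key e1 e2 e3
  rw [e3, e2, e1, J0.2, J1.2, J2.2, J3.2] at key
  have := mul_pos hκ (sub_pos.2 hαβ)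
  linarith

theorem mainLocal {c : Cell} (h : NT c)
    (hcor : (∃ y ∈ c.K, y.1 = -c.e1) → (∃ y ∈ c.K, y.2 = -c.d1) → (-c.e1, -c.d1) ∈ c.K) : False := by
  by_cases hnc : (-c.e1, c.d1) ∈ c.K
  · refine caseX h hnc (hcor ⟨_, hnc, rfl⟩ ⟨_, h.good.sym _ hnc, by simp⟩)
  · exact caseY h hcor hnc

end Vor

namespace Vor

open Filter Topology

lemma half_eq (K : Set (ℝ × ℝ)) (hfin : volume K ≠ ⊤)
    (hhalf : ∀ u : ℝ × ℝ, volume (K ∩ {y | 0 < y.1 * u.1 + y.2 * u.2}) ≤ volume K / 2)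
    (u : ℝ × ℝ) (hu : u.1 ^ 2 + u.2 ^ 2 ≠ 0) :
    volume.real K / 2 ≤ volume.real (K ∩ {y | 0 < y.1 * u.1 + y.2 * u.2}) := by
  have h1 : K ⊆ (K ∩ {y | 0 < y.1 * u.1 + y.2 * u.2}) ∪
      ((K ∩ {y | 0 < y.1 * (-u).1 + y.2 * (-u).2}) ∪ {y | u.1 * y.1 + u.2 * y.2 = 0}) := by
    intro y hy
    rcases lt_trichotomy (y.1 * u.1 + y.2 * u.2) 0 with h | h | h
    · exact Or.inr (Or.inl ⟨hy, by simp only [Prod.fst_neg, Prod.snd_neg, mem_ofPred_eq]; linarith⟩)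
    · exact Or.inr (Or.inr (by rw [mem_ofPred_eq, ← h]; ring))
    · exact Or.inl ⟨hy, h⟩
  have h2 : volume K ≤ volume (K ∩ {y | 0 < y.1 * u.1 + y.2 * u.2}) + (volume K / 2 + 0) := by
    refine (measure_mono h1).trans ((measure_union_le _ _).trans ?_)
    gcongr
    refine (measure_union_le _ _).trans ?_
    rw [line_null _ _ _ hu]
    gcongr
    exact hhalf (-u)
  rw [add_zero] at h2
  have hf : volume (K ∩ {y | 0 < y.1 * u.1 + y.2 * u.2}) ≠ ⊤ := measure_ne_top_of_subset inter_subset_left hfin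
  have h3 := ENNReal.toReal_mono (ENNReal.add_ne_top.2 ⟨hf, (ENNReal.div_lt_top hfin (by norm_num)).ne⟩) h2
  rw [ENNReal.toReal_add hf (ENNReal.div_lt_top hfin (by norm_num)).ne, ENNReal.toReal_div] at h3
  simp only [ENNReal.toReal_ofNat] at h3
  simp only [Measure.real]
  linarith

theorem symm_of_half (K : Set (ℝ × ℝ)) (hcl : IsClosed K) (hfin : volume K ≠ ⊤)
    (hsc : ∀ y ∈ K, ∀ t : ℝ, 0 ≤ t → t ≤ 1 → (t * y.1, t * y.2) ∈ K)
    (hscn : ∀ y ∈ K, ∀ t : ℝ, 0 ≤ t → t < 1 → K ∈ 𝓝 ((t * y.1, t * y.2) : ℝ × ℝ))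
    (hhalf : ∀ u : ℝ × ℝ, volume (K ∩ {y | 0 < y.1 * u.1 + y.2 * u.2}) ≤ volume K / 2) :
    ∀ y ∈ K, -y ∈ K := by
  intro x hx
  by_contra hnx
  -- choose the point p
  obtain ⟨p, hp, hpn⟩ : ∃ p : ℝ × ℝ, K ∈ 𝓝 p ∧ Kᶜ ∈ 𝓝 (-p) := by
    have hcont : Continuous fun t : ℝ => (-(t * x.1, t * x.2) : ℝ × ℝ) := by fun_prop
    have h1 := hcont.tendsto 1
    simp only [one_mul] at h1
    have h2 : ∀ᶠ z in 𝓝 (-(x.1, x.2) : ℝ × ℝ), Kᶜ ∈ 𝓝 z :=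
      eventually_mem_nhds_iff.2 (hcl.isOpen_compl.mem_nhds hnx)
    have h3 := (h1.eventually h2).filter_mono (nhdsWithin_le_nhds (s := Iio 1))
    have h4 : ∀ᶠ t in 𝓝[<] (1:ℝ), 0 < t ∧ t < 1 := Ioo_mem_nhdsLT (by norm_num)
    obtain ⟨t, ht, h0, h1⟩ := (h3.and h4).exists
    exact ⟨_, hscn x hx t h0.le h1, ht⟩
  have hz : (0 : ℝ × ℝ) ∈ K := by simpa [Prod.mk_zero_zero] using hsc x hx 0 le_rfl zero_le_one
  have hp0 : p.1 ^ 2 + p.2 ^ 2 ≠ 0 := by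
    intro h0
    have h1 : p.1 = 0 := by nlinarith [sq_nonneg p.1, sq_nonneg p.2]
    have h2 : p.2 = 0 := by nlinarith [sq_nonneg p.1, sq_nonneg p.2]
    have : -p = 0 := by ext <;> simp [h1, h2]
    rw [this] at hpn
    exact mem_of_mem_nhds hpn hz
  set N := p.1 ^ 2 + p.2 ^ 2 with hN
  have hNpos : 0 < N := lt_of_le_of_ne (by positivity) hp0.symm
  obtain ⟨δ1, hδ1, hb1⟩ := Metric.mem_nhds_iff.1 hp
  obtain ⟨δ2, hδ2, hb2⟩ := Metric.mem_nhds_iff.1 hpn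
  obtain ⟨η, hη, hη1, hη2⟩ : ∃ η : ℝ, 0 < η ∧ η * (|p.1| + |p.2|) < δ1 ∧ η * (|p.1| + |p.2|) < δ2 := by
    have hcont : Continuous fun t : ℝ => t * (|p.1| + |p.2|) := by fun_prop
    have h1 := hcont.tendsto 0
    simp only [zero_mul] at h1
    exact exists_gt_of_ev ((h1.eventually_lt_const hδ1).and (h1.eventually_lt_const hδ2))
  set al : ℝ × ℝ → ℝ := fun y => (p.1 * y.1 + p.2 * y.2) / N with hal
  set be : ℝ × ℝ → ℝ := fun y => (-p.2 * y.1 + p.1 * y.2) / N with hbe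
  have halc : Continuous al := by fun_prop
  have hbec : Continuous be := by fun_prop
  have hdec : ∀ y, y.1 = al y * p.1 - be y * p.2 ∧ y.2 = al y * p.2 + be y * p.1 := by
    intro y
    simp only [hal, hbe]
    constructor <;> · field_simp; rw [hN]; ring
  -- points of the wedge
  have hw1 : ∀ y, 0 < al y → |be y| ≤ η * al y →
      ((1 / al y) * y.1, (1 / al y) * y.2) ∈ K ∧ -((1 / al y) * y.1, (1 / al y) * y.2) ∉ K := by
    intro y ha hb
    have hs : |be y / al y| ≤ η := by
      rw [abs_div, abs_of_pos ha, div_le_iff₀ ha]; exact hb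
    obtain ⟨e1, e2⟩ := hdec y
    have f1 : (1 / al y) * y.1 = p.1 - (be y / al y) * p.2 := by
      rw [e1]; field_simp
    have f2 : (1 / al y) * y.2 = p.2 + (be y / al y) * p.1 := by
      rw [e2]; field_simp
    rw [f1, f2]
    have g1 : |be y / al y| * |p.1| ≤ η * |p.1| := mul_le_mul_of_nonneg_right hs (abs_nonneg _)
    have g2 : |be y / al y| * |p.2| ≤ η * |p.2| := mul_le_mul_of_nonneg_right hs (abs_nonneg _)
    have g3 : 0 ≤ η * |p.1| := by positivity
    have g4 : 0 ≤ η * |p.2| := by positivity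
    constructor
    · apply hb1
      rw [mem_ball, Prod.dist_eq, max_lt_iff, Real.dist_eq, Real.dist_eq]
      constructor
      · rw [show p.1 - be y / al y * p.2 - p.1 = -(be y / al y * p.2) by ring, abs_neg, abs_mul]; linarith
      · rw [show p.2 + be y / al y * p.1 - p.2 = (be y / al y * p.1) by ring, abs_mul]; linarith
    · apply hb2
      rw [mem_ball, Prod.dist_eq, max_lt_iff, Real.dist_eq, Real.dist_eq]
      simp only [Prod.fst_neg, Prod.snd_neg]
      constructor
      · rw [show -(p.1 - be y / al y * p.2) - -p.1 = (be y / al y * p.2) by ring, abs_mul]; linarith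
      · rw [show -(p.2 + be y / al y * p.1) - -p.2 = -(be y / al y * p.1) by ring, abs_neg, abs_mul]; linarith
  -- the two half planes
  set n1 : ℝ × ℝ := -(-p.2 + η * p.1, p.1 + η * p.2) with hn1
  set n2 : ℝ × ℝ := (-p.2 - η * p.1, p.1 - η * p.2) with hn2
  have hn1' : n1.1 ^ 2 + n1.2 ^ 2 ≠ 0 := by
    have : n1.1 ^ 2 + n1.2 ^ 2 = N * (1 + η ^ 2) := by simp only [hn1, hN, Prod.fst_neg, Prod.snd_neg]; ring
    rw [this]; positivity
  have hn2' : n2.1 ^ 2 + n2.2 ^ 2 ≠ 0 := by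
    have : n2.1 ^ 2 + n2.2 ^ 2 = N * (1 + η ^ 2) := by simp only [hn2, hN]; ring
    rw [this]; positivity
  have v1 : ∀ y : ℝ × ℝ, y.1 * n1.1 + y.2 * n1.2 = -(N * (be y + η * al y)) := by
    intro y; simp only [hn1, hal, hbe, Prod.fst_neg, Prod.snd_neg]; field_simp; ring
  have v2 : ∀ y : ℝ × ℝ, y.1 * n2.1 + y.2 * n2.2 = N * (be y - η * al y) := by
    intro y; simp only [hn2, hal, hbe]; field_simp; ring
  set A := K ∩ {y | 0 < y.1 * n1.1 + y.2 * n1.2} with hA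
  set B := K ∩ {y | 0 < y.1 * n2.1 + y.2 * n2.2} with hB
  have hKm := hcl.measurableSet
  have mA : MeasurableSet A := hKm.inter (measurableSet_lt (by fun_prop) (by fun_prop))
  have mB : MeasurableSet B := hKm.inter (measurableSet_lt (by fun_prop) (by fun_prop))
  have pA := half_eq K hfin hhalf n1 hn1'
  have pB := half_eq K hfin hhalf n2 hn2'
  have fA : volume A ≠ ⊤ := measure_ne_top_of_subset inter_subset_left hfin
  have fB : volume B ≠ ⊤ := measure_ne_top_of_subset inter_subset_left hfin
  have q1 := measureReal_union_add_inter (μ := volume) (s := A) (t := B) mB fA fB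
  have q2 := measureReal_diff_add_inter (μ := volume) (s := K) (t := A ∪ B) (mA.union mB) hfin
  rw [inter_eq_self_of_subset_right (union_subset inter_subset_left inter_subset_left)] at q2
  -- U
  set U : Set (ℝ × ℝ) := {y | y ∈ interior K ∧ 1 < al y ∧ |be y| < η * al y} with hU
  have hUo : IsOpen U := by
    have o1 : IsOpen {y | 1 < al y} := isOpen_lt (by fun_prop) (by fun_prop)
    have o2 : IsOpen {y | |be y| < η * al y} := isOpen_lt (by fun_prop) (by fun_prop)
    exact isOpen_interior.inter (o1.inter o2)
  have hUne : U.Nonempty := by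
    have hcont : Continuous fun t : ℝ => ((t * p.1, t * p.2) : ℝ × ℝ) := by fun_prop
    have h1 := hcont.tendsto 1
    simp only [one_mul] at h1
    obtain ⟨s, hs, hsK⟩ := exists_gt_of_ev (h1.eventually (interior_mem_nhds.2 hp))
    have a1 : al (s * p.1, s * p.2) = s := by simp only [hal]; field_simp; rw [hN]
    have b1 : be (s * p.1, s * p.2) = 0 := by simp only [hbe]; field_simp; ring
    refine ⟨_, hsK, by rw [a1]; exact hs, ?_⟩
    rw [a1, b1, abs_zero]; exact mul_pos hη (by linarith)
  have hUpos : 0 < volume.real U := by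
    refine ENNReal.toReal_pos (hUo.measure_pos _ hUne).ne' (measure_ne_top_of_subset ?_ hfin)
    exact fun y hy => interior_subset hy.1
  -- −S2 and U inside S1
  set S2 := A ∩ B with hS2
  have hneg : volume.real (Neg.neg ⁻¹' S2) = volume.real S2 := by
    simp only [Measure.real]
    rw [Measure.measure_preimage_neg]
  have hwd : ∀ y, -y ∈ S2 → 0 < al y ∧ |be y| < η * al y := by
    intro y hy
    have h1 := hy.1.2
    have h2 := hy.2.2
    rw [mem_ofPred_eq, v1] at h1
    rw [mem_ofPred_eq, v2] at h2
    have e1 : al (-y) = - al y := by simp only [hal, Prod.fst_neg, Prod.snd_neg]; ring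
    have e2 : be (-y) = - be y := by simp only [hbe, Prod.fst_neg, Prod.snd_neg]; ring
    rw [e1, e2] at h1 h2
    have h2' := (pos_iff_pos_of_mul_pos h2).1 hNpos
    have h1' : 0 < be y + η * al y := by
      have : 0 < N * (be y + η * al y) := by linarith
      exact (pos_iff_pos_of_mul_pos this).1 hNpos
    have h3 : 0 < η * al y := by linarith
    exact ⟨(pos_iff_pos_of_mul_pos h3).1 hη, abs_lt.2 ⟨by linarith, by linarith⟩⟩
  have hal1 : ∀ y, -y ∈ S2 → al y < 1 ∧ y ∈ K := by
    intro y hy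
    obtain ⟨h1, h2⟩ := hwd y hy
    obtain ⟨h3, h4⟩ := hw1 y h1 h2.le
    have hlt : al y < 1 := by
      by_contra hn
      apply h4
      have := hsc _ hy.1.1 (1 / al y) (by positivity) (by rw [div_le_one h1]; linarith)
      convert this using 1
      ext <;> simp
    refine ⟨hlt, ?_⟩
    have := hsc _ h3 (al y) h1.le hlt.le
    simp only at this
    rwa [← mul_assoc, ← mul_assoc, mul_one_div_cancel h1.ne', one_mul, one_mul] at this
  have hout : ∀ y, 0 < al y → |be y| < η * al y → y ∉ A ∪ B := by
    rintro y h1 h2 (h3 | h3)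
    · have := h3.2
      rw [mem_ofPred_eq, v1] at this
      have := mul_nonneg hNpos.le (show 0 ≤ be y + η * al y by linarith [(abs_lt.1 h2).1])
      linarith
    · have := h3.2
      rw [mem_ofPred_eq, v2] at this
      have := mul_nonneg hNpos.le (show 0 ≤ -(be y - η * al y) by linarith [(abs_lt.1 h2).2])
      linarith
  have hsub : Neg.neg ⁻¹' S2 ∪ U ⊆ K \ (A ∪ B) := by
    rintro y (hy | hy)
    · exact ⟨(hal1 y hy).2, hout y (hwd y hy).1 (hwd y hy).2⟩
    · exact ⟨interior_subset hy.1, hout y (by linarith [hy.2.1]) hy.2.2⟩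
  have hdisj : Disjoint (Neg.neg ⁻¹' S2) U := by
    rw [Set.disjoint_left]
    intro y hy hyU
    linarith [(hal1 y hy).1, hyU.2.1]
  have hfd : volume (K \ (A ∪ B)) ≠ ⊤ := measure_ne_top_of_subset diff_subset hfin
  have q3 := measureReal_mono (μ := volume) hsub hfd
  rw [measureReal_union hdisj hUo.measurableSet
    (measure_ne_top_of_subset (subset_union_left.trans hsub) hfd)
    (measure_ne_top_of_subset (subset_union_right.trans hsub) hfd), hneg] at q3
  linarith

end Vor

namespace Vor

open Filter Topology

/-- squared distance -/
def D2 (x p : ℝ × ℝ) : ℝ := (x.1 - p.1) ^ 2 + (x.2 - p.2) ^ 2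

/-- the board -/
def Bd (X Y : ℝ) : Set (ℝ × ℝ) := {x | 0 ≤ x.1 ∧ x.1 ≤ X ∧ 0 ≤ x.2 ∧ x.2 ≤ Y}

/-- claimed area -/
def Clm (X Y : ℝ) (W B : Finset (ℝ × ℝ)) : Set (ℝ × ℝ) :=
  {x | x ∈ Bd X Y ∧ ∃ b ∈ B, ∀ p ∈ W, D2 x b < D2 x p}

/-- the no-win hypothesis -/
structure Hyp (X Y : ℝ) (W : Finset (ℝ × ℝ)) : Prop where
  X0 : 0 < X
  Y0 : 0 < Y
  sub : ∀ p ∈ W, p ∈ Bd X Y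
  win : ∀ B : Finset (ℝ × ℝ), (∀ b ∈ B, b ∈ Bd X Y) → B.card ≤ W.card →
    volume (Clm X Y W B) ≤ ENNReal.ofReal (X * Y / 2)

lemma Bd_eq (X Y : ℝ) : Bd X Y = Icc 0 X ×ˢ Icc 0 Y := by
  ext x; simp only [Bd, mem_ofPred_eq, mem_prod, mem_Icc]; tauto

lemma Bd_meas (X Y : ℝ) : MeasurableSet (Bd X Y) := by
  rw [Bd_eq]; exact measurableSet_Icc.prod measurableSet_Icc

lemma Bd_vol {X Y : ℝ} (hX : 0 ≤ X) : volume (Bd X Y) = ENNReal.ofReal (X * Y) := by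
  rw [Bd_eq, Measure.volume_eq_prod, Measure.prod_prod, Real.volume_Icc, Real.volume_Icc,
    sub_zero, sub_zero, ENNReal.ofReal_mul hX]

lemma Bd_fin {X Y : ℝ} (hX : 0 ≤ X) : volume (Bd X Y) ≠ ⊤ := by
  rw [Bd_vol hX]; exact ENNReal.ofReal_ne_top

lemma Bd_conv {X Y : ℝ} {p b : ℝ × ℝ} (hp : p ∈ Bd X Y) (hb : b ∈ Bd X Y) {t : ℝ} (h0 : 0 ≤ t) (h1 : t ≤ 1) :
    (p.1 + t * (b.1 - p.1), p.2 + t * (b.2 - p.2)) ∈ Bd X Y := by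
  obtain ⟨a1, a2, a3, a4⟩ := hp
  obtain ⟨b1, b2, b3, b4⟩ := hb
  have h1' : 0 ≤ 1 - t := by linarith
  refine ⟨?_, ?_, ?_, ?_⟩
  · show 0 ≤ p.1 + t * (b.1 - p.1); nlinarith
  · show p.1 + t * (b.1 - p.1) ≤ X; nlinarith
  · show 0 ≤ p.2 + t * (b.2 - p.2); nlinarith
  · show p.2 + t * (b.2 - p.2) ≤ Y; nlinarith

lemma D2_cont (p : ℝ × ℝ) : Continuous fun x => D2 x p := by unfold D2; fun_prop

lemma D2_pos {x p : ℝ × ℝ} (h : x ≠ p) : 0 < D2 x p := by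
  unfold D2
  by_contra hn
  apply h
  ext
  · nlinarith [sq_nonneg (x.1 - p.1), sq_nonneg (x.2 - p.2)]
  · nlinarith [sq_nonneg (x.1 - p.1), sq_nonneg (x.2 - p.2)]

lemma Clm_meas (X Y : ℝ) (W B : Finset (ℝ × ℝ)) : MeasurableSet (Clm X Y W B) := by
  have : Clm X Y W B = Bd X Y ∩ ⋃ b ∈ B, ⋂ p ∈ W, {x | D2 x b < D2 x p} := by
    ext x; simp [Clm]
  rw [this]
  refine (Bd_meas X Y).inter (Finset.measurableSet_biUnion _ fun b _ =>
    Finset.measurableSet_biInter _ fun p _ => ?_)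
  exact (isOpen_lt (D2_cont b) (D2_cont p)).measurableSet

/-- open cell -/
def Vo (X Y : ℝ) (W : Finset (ℝ × ℝ)) (q : ℝ × ℝ) : Set (ℝ × ℝ) :=
  {x | x ∈ Bd X Y ∧ ∀ p ∈ W, p ≠ q → D2 x q < D2 x p}

/-- half of the open cell -/
def Hh (X Y : ℝ) (W : Finset (ℝ × ℝ)) (q b : ℝ × ℝ) : Set (ℝ × ℝ) :=
  Vo X Y W q ∩ {x | 0 < (x.1 - q.1) * (b.1 - q.1) + (x.2 - q.2) * (b.2 - q.2)}

variable {X Y : ℝ} {W : Finset (ℝ × ℝ)}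

lemma Vo_meas (X Y : ℝ) (W : Finset (ℝ × ℝ)) (q : ℝ × ℝ) : MeasurableSet (Vo X Y W q) := by
  have : Vo X Y W q = Bd X Y ∩ ⋂ p ∈ W.erase q, {x | D2 x q < D2 x p} := by
    ext x; simp [Vo]; tauto
  rw [this]
  refine (Bd_meas X Y).inter (Finset.measurableSet_biInter _ fun p _ => ?_)
  exact (isOpen_lt (D2_cont q) (D2_cont p)).measurableSet

lemma Hh_meas (X Y : ℝ) (W : Finset (ℝ × ℝ)) (q b : ℝ × ℝ) : MeasurableSet (Hh X Y W q b) :=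
  (Vo_meas X Y W q).inter (measurableSet_lt (by fun_prop) (by fun_prop))

lemma Vo_fin (hX : 0 ≤ X) (q : ℝ × ℝ) : volume (Vo X Y W q) ≠ ⊤ :=
  measure_ne_top_of_subset (fun _ h => h.1) (Bd_fin (Y := Y) hX)

lemma Hh_fin (hX : 0 ≤ X) (q b : ℝ × ℝ) : volume (Hh X Y W q b) ≠ ⊤ :=
  measure_ne_top_of_subset inter_subset_left (Vo_fin hX q)

lemma Vo_disj {q q' : ℝ × ℝ} (hq : q ∈ W) (hq' : q' ∈ W) (h : q ≠ q') :
    Disjoint (Vo X Y W q) (Vo X Y W q') := by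
  rw [Set.disjoint_left]
  intro x h1 h2
  have := h1.2 q' hq' h.symm
  have := h2.2 q hq h
  linarith

lemma bis_null {p q : ℝ × ℝ} (h : p ≠ q) : volume {x : ℝ × ℝ | D2 x q = D2 x p} = 0 := by
  have h0 := D2_pos h
  have := line_null (2 * (p.1 - q.1)) (2 * (p.2 - q.2)) (p.1 ^ 2 + p.2 ^ 2 - q.1 ^ 2 - q.2 ^ 2)
    (by unfold D2 at h0; nlinarith)
  rw [← this]
  congr 1
  ext x
  simp only [mem_ofPred_eq, D2]
  constructor <;> intro h <;> linarith

lemma sumVo (H : Hyp X Y W) {q : ℝ × ℝ} (hq : q ∈ W) : X * Y ≤ ∑ q ∈ W, volume.real (Vo X Y W q) := by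
  have hX := H.X0.le
  have hcov : Bd X Y ⊆ (⋃ q ∈ W, Vo X Y W q) ∪ ⋃ q ∈ W, ⋃ p ∈ W.erase q, {x : ℝ × ℝ | D2 x q = D2 x p} := by
    intro x hx
    obtain ⟨q0, h0, hm⟩ := W.exists_min_image (fun p => D2 x p) ⟨q, hq⟩
    by_cases hh : ∃ p ∈ W.erase q0, D2 x q0 = D2 x p
    · obtain ⟨p, hp, he⟩ := hh
      right
      simp only [mem_iUnion]
      exact ⟨q0, h0, p, hp, he⟩
    · left
      push Not at hh
      simp only [mem_iUnion]
      exact ⟨q0, h0, hx, fun p hp hpq => lt_of_le_of_ne (hm p hp) (hh p (Finset.mem_erase.2 ⟨hpq, hp⟩))⟩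
  have hnull : volume (⋃ q ∈ W, ⋃ p ∈ W.erase q, {x : ℝ × ℝ | D2 x q = D2 x p}) = 0 := by
    refine (measure_biUnion_null_iff W.countable_toSet).2 fun q _ => ?_
    refine (measure_biUnion_null_iff (W.erase q).countable_toSet).2 fun p hp => ?_
    exact bis_null (Finset.ne_of_mem_erase hp)
  have h1 : volume (Bd X Y) ≤ ∑ q ∈ W, volume (Vo X Y W q) := by
    refine (measure_mono hcov).trans ((measure_union_le _ _).trans ?_)
    rw [hnull, add_zero]
    exact measure_biUnion_finset_le _ _
  rw [Bd_vol hX] at h1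
  have h2 := ENNReal.toReal_mono (ENNReal.sum_ne_top.2 fun q _ => Vo_fin hX q) h1
  rw [ENNReal.toReal_ofReal (mul_nonneg hX H.Y0.le), ENNReal.toReal_sum fun q _ => Vo_fin hX q] at h2
  exact h2

lemma limG (H : Hyp X Y W) (S : Finset (ℝ × ℝ)) (hS : S ⊆ W) (f : ℝ × ℝ → ℝ × ℝ)
    (hf : ∀ q ∈ S, f q ∈ Bd X Y) (E : Finset (ℝ × ℝ)) (hE : ∀ b ∈ E, b ∈ Bd X Y)
    (hcard : E.card + S.card ≤ W.card) :
    volume (Clm X Y W E ∪ ⋃ q ∈ S, Hh X Y W q (f q)) ≤ ENNReal.ofReal (X * Y / 2) := by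
  classical
  set A : ℕ → Set (ℝ × ℝ) := fun k => Clm X Y W E ∪ ⋃ q ∈ S, (Vo X Y W q ∩
    {x | D2 (f q) q / (2 * ((k:ℝ) + 1)) < (x.1 - q.1) * ((f q).1 - q.1) + (x.2 - q.2) * ((f q).2 - q.2)}) with hA
  have hmono : Monotone A := by
    intro k l hkl
    refine union_subset_union_right _ (iUnion₂_mono fun q _ => inter_subset_inter_right _ ?_)
    intro x hx
    rw [mem_ofPred_eq] at hx ⊢
    refine lt_of_le_of_lt ?_ hx
    have : (k:ℝ) ≤ l := by exact_mod_cast hkl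
    have : 0 ≤ D2 (f q) q := by unfold D2; positivity
    gcongr
  have hsub : Clm X Y W E ∪ ⋃ q ∈ S, Hh X Y W q (f q) ⊆ ⋃ k, A k := by
    rintro x (hx | hx)
    · exact mem_iUnion.2 ⟨0, Or.inl hx⟩
    · simp only [mem_iUnion] at hx
      obtain ⟨q, hq, hx, hpos⟩ := hx
      rw [mem_ofPred_eq] at hpos
      set m := (x.1 - q.1) * ((f q).1 - q.1) + (x.2 - q.2) * ((f q).2 - q.2)
      obtain ⟨k, hk⟩ := exists_nat_gt (D2 (f q) q / (2 * m))
      refine mem_iUnion.2 ⟨k, Or.inr ?_⟩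
      simp only [mem_iUnion]
      refine ⟨q, hq, hx, ?_⟩
      rw [mem_ofPred_eq, div_lt_iff₀ (by positivity)]
      rw [div_lt_iff₀ (by positivity)] at hk
      nlinarith
  refine (measure_mono hsub).trans ?_
  rw [hmono.measure_iUnion]
  refine iSup_le fun k => ?_
  set t : ℝ := 1 / ((k:ℝ) + 1) with ht
  have ht0 : 0 < t := by positivity
  have ht1 : t ≤ 1 := by
    rw [ht, div_le_one (by positivity)]; linarith [(Nat.cast_nonneg k : (0:ℝ) ≤ k)]
  set g : ℝ × ℝ → ℝ × ℝ := fun q => (q.1 + t * ((f q).1 - q.1), q.2 + t * ((f q).2 - q.2)) with hg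
  refine (measure_mono ?_).trans (H.win (E ∪ S.image g) ?_ ?_)
  · rintro x (hx | hx)
    · obtain ⟨h1, b, hb, h2⟩ := hx
      exact ⟨h1, b, Finset.mem_union_left _ hb, h2⟩
    · simp only [mem_iUnion] at hx
      obtain ⟨q, hq, hx, hpos⟩ := hx
      refine ⟨hx.1, g q, Finset.mem_union_right _ (Finset.mem_image_of_mem _ hq), ?_⟩
      have hlt : D2 x (g q) < D2 x q := by
        rw [mem_ofPred_eq] at hpos
        have e : D2 (f q) q / (2 * ((k:ℝ) + 1)) = t * D2 (f q) q / 2 := by rw [ht]; field_simp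
        rw [e] at hpos
        have := mul_lt_mul_of_pos_left hpos ht0
        simp only [D2, hg] at this ⊢
        linarith
      intro p hp
      by_cases hpq : p = q
      · rw [hpq]; exact hlt
      · exact hlt.trans (hx.2 p hp hpq)
  · intro b hb
    rcases Finset.mem_union.1 hb with hb | hb
    · exact hE b hb
    · obtain ⟨q, hq, rfl⟩ := Finset.mem_image.1 hb
      exact Bd_conv (H.sub q (hS hq)) (hf q hq) ht0.le ht1
  · exact (Finset.card_union_le _ _).trans ((Nat.add_le_add_left Finset.card_image_le _).trans hcard)

lemma limG' (H : Hyp X Y W) (S : Finset (ℝ × ℝ)) (hS : S ⊆ W) (f : ℝ × ℝ → ℝ × ℝ)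
    (hf : ∀ q ∈ S, f q ∈ Bd X Y) (E : Finset (ℝ × ℝ)) (hE : ∀ b ∈ E, b ∈ Bd X Y)
    (hcard : E.card + S.card ≤ W.card)
    (hd : ∀ q ∈ S, Disjoint (Clm X Y W E) (Hh X Y W q (f q))) :
    volume.real (Clm X Y W E) + ∑ q ∈ S, volume.real (Hh X Y W q (f q)) ≤ X * Y / 2 := by
  have h := limG H S hS f hf E hE hcard
  have hX := H.X0.le
  have hY := H.Y0.le
  have h' := ENNReal.toReal_mono ENNReal.ofReal_ne_top h
  rw [ENNReal.toReal_ofReal (by positivity)] at h'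
  have hm : MeasurableSet (⋃ q ∈ S, Hh X Y W q (f q)) :=
    Finset.measurableSet_biUnion _ fun q _ => Hh_meas X Y W q (f q)
  have hfin : volume (⋃ q ∈ S, Hh X Y W q (f q)) ≠ ⊤ := by
    refine measure_ne_top_of_subset ?_ (Bd_fin (X := X) (Y := Y) hX)
    exact iUnion₂_subset fun q _ x hx => hx.1.1
  rw [← measureReal_biUnion_finset (fun q hq q' hq' hne => ?_) (fun q _ => Hh_meas X Y W q (f q))
    (fun q _ => Hh_fin hX q _),
    ← measureReal_union (Set.disjoint_iUnion₂_right.2 hd) hm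
      (measure_ne_top_of_subset (fun _ h => h.1) (Bd_fin (X := X) (Y := Y) hX)) hfin]
  · exact h'
  · exact (Vo_disj (hS hq) (hS hq') hne).mono inter_subset_left inter_subset_left

lemma Vo_split (hX : 0 ≤ X) {q b b' : ℝ × ℝ} {a1 a2 : ℝ} (ha : a1 ^ 2 + a2 ^ 2 ≠ 0)
    (h1 : ∀ x ∈ Bd X Y, 0 < a1 * (x.1 - q.1) + a2 * (x.2 - q.2) →
      0 < (x.1 - q.1) * (b.1 - q.1) + (x.2 - q.2) * (b.2 - q.2))
    (h2 : ∀ x ∈ Bd X Y, a1 * (x.1 - q.1) + a2 * (x.2 - q.2) < 0 →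
      0 < (x.1 - q.1) * (b'.1 - q.1) + (x.2 - q.2) * (b'.2 - q.2)) :
    volume.real (Vo X Y W q) ≤ volume.real (Hh X Y W q b) + volume.real (Hh X Y W q b') := by
  have hs : Vo X Y W q ⊆ (Hh X Y W q b ∪ Hh X Y W q b') ∪ {x | a1 * x.1 + a2 * x.2 = a1 * q.1 + a2 * q.2} := by
    intro x hx
    rcases lt_trichotomy (a1 * (x.1 - q.1) + a2 * (x.2 - q.2)) 0 with h | h | h
    · exact Or.inl (Or.inr ⟨hx, h2 x hx.1 h⟩)
    · right; rw [mem_ofPred_eq]; linarith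
    · exact Or.inl (Or.inl ⟨hx, h1 x hx.1 h⟩)
  have h3 : volume (Vo X Y W q) ≤ volume (Hh X Y W q b) + volume (Hh X Y W q b') := by
    refine (measure_mono hs).trans ((measure_union_le _ _).trans ?_)
    rw [line_null _ _ _ ha, add_zero]
    exact measure_union_le _ _
  have h4 := ENNReal.toReal_mono (ENNReal.add_ne_top.2 ⟨Hh_fin hX q b, Hh_fin hX q b'⟩) h3
  rwa [ENNReal.toReal_add (Hh_fin hX q b) (Hh_fin hX q b')] at h4

lemma exists_half (H : Hyp X Y W) {q : ℝ × ℝ} (hq : q ∈ W) :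
    ∃ b ∈ Bd X Y, volume.real (Vo X Y W q) / 2 ≤ volume.real (Hh X Y W q b) := by
  obtain ⟨a1, a2, a3, a4⟩ := H.sub q hq
  have hs := Vo_split (W := W) (X := X) (Y := Y) H.X0.le (q := q) (b := (X, q.2)) (b' := (0, q.2)) (a1 := 1) (a2 := 0)
    (by norm_num) (by
      intro x hx h
      have := hx.2.1
      simp only [sub_self, mul_zero, add_zero, one_mul, zero_mul] at h ⊢
      exact mul_pos h (by linarith)) (by
      intro x hx h
      have := hx.1
      simp only [sub_self, mul_zero, add_zero, one_mul, zero_mul] at h ⊢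
      exact mul_pos_of_neg_of_neg h (by linarith))
  by_cases h : volume.real (Vo X Y W q) / 2 ≤ volume.real (Hh X Y W q (X, q.2))
  · exact ⟨(X, q.2), ⟨H.X0.le, le_rfl, a3, a4⟩, h⟩
  · exact ⟨(0, q.2), ⟨le_rfl, H.X0.le, a3, a4⟩, by linarith⟩

lemma half_le (H : Hyp X Y W) {q b : ℝ × ℝ} (hq : q ∈ W) (hb : b ∈ Bd X Y) :
    volume.real (Hh X Y W q b) ≤ volume.real (Vo X Y W q) / 2 := by
  classical
  choose! g hg1 hg2 using fun q (hq : q ∈ W) => exists_half H hq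
  set f : ℝ × ℝ → ℝ × ℝ := fun p => if p = q then b else g p with hf
  have h1 := limG' H W subset_rfl f (by
    intro p hp
    simp only [hf]
    split_ifs
    · exact hb
    · exact hg1 p hp) ∅ (by simp) (by simp) (by simp [Clm])
  have h0 : volume.real (Clm X Y W ∅) = 0 := by simp [Clm]
  rw [h0, zero_add, ← Finset.add_sum_erase _ _ hq] at h1
  have h2 := sumVo H hq
  rw [← Finset.add_sum_erase _ _ hq] at h2
  have h3 : (∑ p ∈ W.erase q, volume.real (Vo X Y W p)) / 2 ≤ ∑ p ∈ W.erase q, volume.real (Hh X Y W p (f p)) := by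
    rw [Finset.sum_div]
    refine Finset.sum_le_sum fun p hp => ?_
    simp only [hf]
    rw [if_neg (Finset.ne_of_mem_erase hp)]
    exact hg2 p (Finset.mem_of_mem_erase hp)
  have e : f q = b := by simp [hf]
  rw [e] at h1
  linarith

lemma Vo_pos (H : Hyp X Y W) {q : ℝ × ℝ} (hq : q ∈ W) : 0 < volume.real (Vo X Y W q) := by
  have hX := H.X0
  have hY := H.Y0
  obtain ⟨a1, a2, a3, a4⟩ := H.sub q hq
  set U : Set (ℝ × ℝ) := (Ioo 0 X ×ˢ Ioo 0 Y) ∩ ⋂ p ∈ W.erase q, {x | D2 x q < D2 x p} with hU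
  have hUo : IsOpen (⋂ p ∈ W.erase q, {x | D2 x q < D2 x p}) :=
    isOpen_biInter_finset fun p _ => isOpen_lt (D2_cont q) (D2_cont p)
  have hqU : q ∈ ⋂ p ∈ W.erase q, {x | D2 x q < D2 x p} := by
    simp only [mem_iInter]
    intro p hp
    rw [mem_ofPred_eq]
    have : D2 q q = 0 := by simp [D2]
    rw [this]
    exact D2_pos (Finset.ne_of_mem_erase hp).symm
  have hsub : U ⊆ Vo X Y W q := by
    rintro x ⟨⟨h1, h2⟩, h3⟩
    simp only [mem_iInter] at h3
    exact ⟨⟨h1.1.le, h1.2.le, h2.1.le, h2.2.le⟩, fun p hp hpq => h3 p (Finset.mem_erase.2 ⟨hpq, hp⟩)⟩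
  have hne : U.Nonempty := by
    have hcl : q ∈ closure (Ioo 0 X ×ˢ Ioo 0 Y) := by
      rw [closure_prod_eq, closure_Ioo hX.ne, closure_Ioo hY.ne]
      exact ⟨⟨a1, a2⟩, ⟨a3, a4⟩⟩
    obtain ⟨z, hz1, hz2⟩ := mem_closure_iff.1 hcl _ hUo hqU
    exact ⟨z, hz2, hz1⟩
  have hUo' : IsOpen U := (isOpen_Ioo.prod isOpen_Ioo).inter hUo
  refine ENNReal.toReal_pos ?_ (Vo_fin hX.le q)
  exact ((hUo'.measure_pos volume hne).trans_le (measure_mono hsub)).ne'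

lemma interior (H : Hyp X Y W) {q : ℝ × ℝ} (hq : q ∈ W) : 0 < q.1 ∧ q.1 < X ∧ 0 < q.2 ∧ q.2 < Y := by
  have hX := H.X0
  have hY := H.Y0
  obtain ⟨a1, a2, a3, a4⟩ := H.sub q hq
  have hpos := Vo_pos H hq
  -- if some point of the board sees the whole board on its side, contradiction
  have key : ∀ b ∈ Bd X Y, ∀ c1 c2 : ℝ, c1 ^ 2 + c2 ^ 2 ≠ 0 →
      (∀ x ∈ Bd X Y, 0 < c1 * (x.1 - q.1) + c2 * (x.2 - q.2) →
      0 < (x.1 - q.1) * (b.1 - q.1) + (x.2 - q.2) * (b.2 - q.2)) →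
      (∀ x ∈ Bd X Y, 0 ≤ c1 * (x.1 - q.1) + c2 * (x.2 - q.2)) → False := by
    intro b hb c1 c2 hc h1 h2
    have hs := Vo_split (W := W) (X := X) (Y := Y) H.X0.le (q := q) (b := b) (b' := q) hc h1
      (fun x hx h => absurd h (not_lt.2 (h2 x hx)))
    have e : Hh X Y W q q = ∅ := by
      ext x; simp [Hh]
    rw [e, measureReal_empty, add_zero] at hs
    linarith [half_le H hq hb]
  refine ⟨lt_of_le_of_ne a1 fun h => ?_, lt_of_le_of_ne a2 fun h => ?_, lt_of_le_of_ne a3 fun h => ?_,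
    lt_of_le_of_ne a4 fun h => ?_⟩
  · refine key (X, q.2) ⟨hX.le, le_rfl, a3, a4⟩ 1 0 (by norm_num) (fun x hx h => ?_) (fun x hx => ?_)
    · have : 0 < x.1 - q.1 := by linarith
      have : 0 < X - q.1 := by linarith
      simp only [sub_self, mul_zero, add_zero]; positivity
    · linarith [hx.1]
  · refine key (0, q.2) ⟨le_rfl, hX.le, a3, a4⟩ (-1) 0 (by norm_num) (fun x hx h => ?_) (fun x hx => ?_)
    · simp only [sub_self, mul_zero, add_zero]
      exact mul_pos_of_neg_of_neg (by linarith) (by linarith)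
    · linarith [hx.2.1]
  · refine key (q.1, Y) ⟨a1, a2, hY.le, le_rfl⟩ 0 1 (by norm_num) (fun x hx h => ?_) (fun x hx => ?_)
    · have : 0 < x.2 - q.2 := by linarith
      have : 0 < Y - q.2 := by linarith
      simp only [sub_self, mul_zero, zero_add]; positivity
    · linarith [hx.2.2.1]
  · refine key (q.1, 0) ⟨a1, a2, le_rfl, hY.le⟩ 0 (-1) (by norm_num) (fun x hx h => ?_) (fun x hx => ?_)
    · simp only [sub_self, mul_zero, zero_add]
      exact mul_pos_of_neg_of_neg (by linarith) (by linarith)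
    · linarith [hx.2.2.2]

lemma small_dir (H : Hyp X Y W) {q : ℝ × ℝ} (hq : q ∈ W) (u : ℝ × ℝ) :
    ∃ s : ℝ, 0 < s ∧ (q.1 + s * u.1, q.2 + s * u.2) ∈ Bd X Y := by
  obtain ⟨h1, h2, h3, h4⟩ := interior H hq
  have hcont : Continuous fun s : ℝ => ((q.1 + s * u.1, q.2 + s * u.2) : ℝ × ℝ) := by fun_prop
  have h0 := hcont.tendsto 0
  simp only [zero_mul, add_zero] at h0
  have hn : Bd X Y ∈ 𝓝 ((q.1, q.2) : ℝ × ℝ) := by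
    rw [Bd_eq]; exact prod_mem_nhds (Icc_mem_nhds h1 h2) (Icc_mem_nhds h3 h4)
  exact exists_gt_of_ev (h0.eventually hn)

lemma half_dir (H : Hyp X Y W) {q : ℝ × ℝ} (hq : q ∈ W) (u : ℝ × ℝ) :
    volume.real (Vo X Y W q ∩ {x | 0 < (x.1 - q.1) * u.1 + (x.2 - q.2) * u.2}) ≤
      volume.real (Vo X Y W q) / 2 := by
  obtain ⟨s, hs, hb⟩ := small_dir H hq u
  have := half_le H hq hb
  refine le_trans (measureReal_mono ?_ (Hh_fin H.X0.le _ _)) this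
  rintro x ⟨h1, h2⟩
  refine ⟨h1, ?_⟩
  rw [mem_ofPred_eq] at h2 ⊢
  have := mul_pos hs h2
  simp only
  linarith

lemma claim_le (H : Hyp X Y W) {q b : ℝ × ℝ} (hq : q ∈ W) (hb : b ∈ Bd X Y) :
    volume.real (Clm X Y W {b}) ≤ volume.real (Vo X Y W q) / 2 := by
  classical
  by_cases hbW : b ∈ W
  · have : Clm X Y W {b} = ∅ := by
      ext x
      simp only [Clm, Finset.mem_singleton, exists_eq_left, mem_ofPred_eq, mem_empty_iff_false, iff_false,
        not_and, not_forall]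
      exact fun _ => ⟨b, hbW, lt_irrefl _⟩
    rw [this, measureReal_empty]; positivity
  choose! s hs hsB using fun p (hp : p ∈ W) => small_dir H hp (p - b)
  set f : ℝ × ℝ → ℝ × ℝ := fun p => (p.1 + s p * (p - b).1, p.2 + s p * (p - b).2) with hf
  have hW0 : 0 < W.card := Finset.card_pos.2 ⟨q, hq⟩
  have h1 := limG' H (W.erase q) (Finset.erase_subset _ _) f
    (fun p hp => hsB p (Finset.mem_of_mem_erase hp)) {b} (by simpa using hb)
    (by rw [Finset.card_singleton, Finset.card_erase_of_mem hq]; omega) (by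
      intro p hp
      have hpW := Finset.mem_of_mem_erase hp
      rw [Set.disjoint_left]
      rintro x ⟨-, b', hb', hx⟩ ⟨-, hx2⟩
      rw [Finset.mem_singleton] at hb'
      have hx1 := hx p hpW
      rw [hb'] at hx1
      rw [mem_ofPred_eq] at hx2
      simp only [hf, Prod.fst_sub, Prod.snd_sub] at hx2
      have : 0 < s p * ((x.1 - p.1) * (p.1 - b.1) + (x.2 - p.2) * (p.2 - b.2)) := by linarith
      have := (pos_iff_pos_of_mul_pos this).1 (hs p hpW)
      unfold D2 at hx1
      nlinarith [sq_nonneg (p.1 - b.1), sq_nonneg (p.2 - b.2)])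
  have h2 := sumVo H hq
  rw [← Finset.add_sum_erase _ _ hq] at h2
  have h3 : (∑ p ∈ W.erase q, volume.real (Vo X Y W p)) / 2 ≤ ∑ p ∈ W.erase q, volume.real (Hh X Y W p (f p)) := by
    rw [Finset.sum_div]
    refine Finset.sum_le_sum fun p hp => ?_
    have hpW := Finset.mem_of_mem_erase hp
    have hpb : p ≠ b := fun h => hbW (h ▸ hpW)
    have h0 := D2_pos hpb
    have hsp := hs p hpW
    have := Vo_split (W := W) (X := X) (Y := Y) H.X0.le (q := p) (b := f p) (b' := b)
      (a1 := p.1 - b.1) (a2 := p.2 - b.2) (by unfold D2 at h0; exact h0.ne') (by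
        intro x hx h
        simp only [hf, Prod.fst_sub, Prod.snd_sub]
        have := mul_pos hsp h
        linarith) (by
        intro x hx h
        linarith)
    linarith [half_le H hpW hb]
  linarith

end Vor

namespace Vor

open Filter Topology

section
variable {X Y : ℝ} {W : Finset (ℝ × ℝ)}

/-- the cell of `q` in centred coordinates -/
noncomputable def cellAt (X Y : ℝ) (W : Finset (ℝ × ℝ)) (q : ℝ × ℝ) : Cell :=
  ⟨q.1, X - q.1, q.2, Y - q.2, (W.erase q).image fun p => p - q⟩

/-- closed Voronoi cell -/
def Vc (X Y : ℝ) (W : Finset (ℝ × ℝ)) (q : ℝ × ℝ) : Set (ℝ × ℝ) :=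
  {x | x ∈ Bd X Y ∧ ∀ p ∈ W, D2 x q ≤ D2 x p}

lemma cell_Box (q y : ℝ × ℝ) : y ∈ (cellAt X Y W q).Box ↔ y + q ∈ Bd X Y := by
  simp only [Cell.Box, cellAt, Bd, mem_ofPred_eq, Prod.fst_add, Prod.snd_add]
  constructor
  · rintro ⟨h1, h2, h3, h4⟩; refine ⟨?_, ?_, ?_, ?_⟩ <;> linarith
  · rintro ⟨h1, h2, h3, h4⟩; refine ⟨?_, ?_, ?_, ?_⟩ <;> linarith

lemma cell_K (q y : ℝ × ℝ) : y ∈ (cellAt X Y W q).K ↔ y + q ∈ Vc X Y W q := by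
  unfold Cell.K Vc
  simp only [mem_ofPred_eq, cell_Box]
  refine and_congr_right fun _ => ?_
  simp only [cellAt, Finset.forall_mem_image, Finset.mem_erase, D2, Prod.fst_add, Prod.snd_add,
    Prod.fst_sub, Prod.snd_sub]
  constructor
  · intro h p hp
    by_cases hpq : p = q
    · rw [hpq]
    · have := h ⟨hpq, hp⟩; nlinarith
  · rintro h p ⟨-, hp⟩
    have := h p hp; nlinarith

lemma cell_R {q : ℝ × ℝ} (hq : q ∈ W) (b y : ℝ × ℝ) :
    y ∈ (cellAt X Y W q).R b ↔ y + q ∈ Clm X Y W {b + q} := by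
  unfold Cell.R Clm
  simp only [mem_ofPred_eq, cell_Box, Finset.mem_singleton, exists_eq_left]
  refine and_congr_right fun _ => ?_
  simp only [cellAt, Finset.forall_mem_image, Finset.mem_erase, D2, Prod.fst_add, Prod.snd_add,
    Prod.fst_sub, Prod.snd_sub]
  constructor
  · rintro ⟨h0, h⟩ p hp
    by_cases hpq : p = q
    · rw [hpq]; nlinarith
    · have := h ⟨hpq, hp⟩; nlinarith
  · intro h
    refine ⟨?_, ?_⟩
    · have := h q hq; nlinarith
    · rintro p ⟨-, hp⟩
      have := h p hp; nlinarith

lemma vol_tr (q : ℝ × ℝ) (S T : Set (ℝ × ℝ)) (h : ∀ y, y ∈ S ↔ y + q ∈ T) : volume S = volume T := by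
  have : S = (fun y => y + q) ⁻¹' T := by ext y; exact h y
  rw [this, measure_preimage_add_right]

lemma Vc_le {q : ℝ × ℝ} (S : Set (ℝ × ℝ)) : volume (Vc X Y W q ∩ S) ≤ volume (Vo X Y W q ∩ S) := by
  have h : Vc X Y W q ∩ S ⊆ (Vo X Y W q ∩ S) ∪ ⋃ p ∈ W.erase q, {x : ℝ × ℝ | D2 x q = D2 x p} := by
    rintro x ⟨hx, hS⟩
    by_cases hh : ∃ p ∈ W.erase q, D2 x q = D2 x p
    · obtain ⟨p, hp, he⟩ := hh
      right
      simp only [mem_iUnion]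
      exact ⟨p, hp, he⟩
    · left
      push Not at hh
      exact ⟨⟨hx.1, fun p hp hpq => lt_of_le_of_ne (hx.2 p hp) (hh p (Finset.mem_erase.2 ⟨hpq, hp⟩))⟩, hS⟩
  have hnull : volume (⋃ p ∈ W.erase q, {x : ℝ × ℝ | D2 x q = D2 x p}) = 0 :=
    (measure_biUnion_null_iff (W.erase q).countable_toSet).2 fun p hp => bis_null (Finset.ne_of_mem_erase hp)
  refine (measure_mono h).trans ((measure_union_le _ _).trans ?_)
  rw [hnull, add_zero]

lemma Vo_sub_Vc (q : ℝ × ℝ) : Vo X Y W q ⊆ Vc X Y W q := by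
  intro x hx
  refine ⟨hx.1, fun p hp => ?_⟩
  by_cases hpq : p = q
  · rw [hpq]
  · exact (hx.2 p hp hpq).le

lemma to_half {a b : ℝ≥0∞} (ha : a ≠ ⊤) (hb : b ≠ ⊤) (h : a.toReal ≤ b.toReal / 2) : a ≤ b / 2 := by
  rw [← ENNReal.toReal_le_toReal ha (ENNReal.div_lt_top hb (by norm_num)).ne, ENNReal.toReal_div]
  simpa using h

theorem goodAt (H : Hyp X Y W) {q : ℝ × ℝ} (hq : q ∈ W) : Good (cellAt X Y W q) := by
  obtain ⟨h1, h2, h3, h4⟩ := interior H hq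
  set c := cellAt X Y W q with hc
  have hX := H.X0.le
  have he1 : 0 < c.e1 := h1
  have he2 : 0 < c.e2 := sub_pos.2 h2
  have hd1 : 0 < c.d1 := h3
  have hd2 : 0 < c.d2 := sub_pos.2 h4
  have hVo : volume (Vo X Y W q) ≠ ⊤ := Vo_fin hX q
  have hvK : volume c.K = volume (Vo X Y W q) := by
    rw [vol_tr q c.K (Vc X Y W q) (cell_K q)]
    refine le_antisymm ?_ (measure_mono (Vo_sub_Vc q))
    simpa using Vc_le (X := X) (Y := Y) (W := W) (q := q) univ
  have hne : ∀ v ∈ c.V, v ≠ 0 := by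
    intro v hv
    obtain ⟨p, hp, rfl⟩ := Finset.mem_image.1 hv
    exact sub_ne_zero.2 (Finset.ne_of_mem_erase hp)
  have hpos : ∀ v ∈ c.V, 0 < v.1 ^ 2 + v.2 ^ 2 := by
    intro v hv
    have := D2_pos (hne v hv)
    simpa [D2] using this
  have hclaim : ∀ b ∈ c.Box, volume (c.R b) ≤ volume c.K / 2 := by
    intro b hb
    rw [hvK, vol_tr q (c.R b) _ (cell_R hq b)]
    refine to_half (measure_ne_top_of_subset (fun _ h => h.1) (Bd_fin (X := X) (Y := Y) hX)) hVo ?_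
    exact claim_le H hq ((cell_Box q b).1 hb)
  have hzero : (0 : ℝ × ℝ) ∈ c.K := by
    rw [hc, cell_K, zero_add]
    refine ⟨H.sub q hq, fun p _ => ?_⟩
    have : D2 q q = 0 := by simp [D2]
    rw [this]; unfold D2; positivity
  refine ⟨he1, he2, hd1, hd2, hne, ?_, ?_, hclaim⟩
  · intro v hv
    obtain ⟨p, hp, rfl⟩ := Finset.mem_image.1 hv
    rw [hc, cell_Box, sub_add_cancel]
    exact H.sub p (Finset.mem_of_mem_erase hp)
  · refine symm_of_half c.K c.isClosed_K (by rw [hvK]; exact hVo) ?_ ?_ ?_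
    · intro y hy t h0 h1
      have := seg hzero hy h0 h1
      simpa using this
    · rintro y ⟨⟨a1, a2, a3, a4⟩, a5⟩ t h0 h1
      apply nhds_of_strict
      · refine ⟨?_, ?_, ?_, ?_⟩
        · show -c.e1 < t * y.1; nlinarith
        · show t * y.1 < _; nlinarith
        · show _ < t * y.2; nlinarith
        · show t * y.2 < _; nlinarith
      · intro v hv
        show 2 * (t * y.1 * v.1 + t * y.2 * v.2) < _
        have := mul_le_mul_of_nonneg_left (a5 v hv) h0
        have := hpos v hv
        nlinarith
    · intro u
      rw [hvK, vol_tr q (c.K ∩ {y | 0 < y.1 * u.1 + y.2 * u.2})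
        (Vc X Y W q ∩ {x | 0 < (x.1 - q.1) * u.1 + (x.2 - q.2) * u.2}) (by
          intro y
          simp only [mem_inter_iff, mem_ofPred_eq, hc, cell_K, Prod.fst_add, Prod.snd_add, add_sub_cancel_right])]
      refine (Vc_le _).trans (to_half ?_ hVo (half_dir H hq u))
      exact measure_ne_top_of_subset inter_subset_left hVo

lemma Hyp.map {X' Y' : ℝ} (H : Hyp X Y W) (τ : ℝ × ℝ ≃ ℝ × ℝ)
    (hvol : ∀ S : Set (ℝ × ℝ), volume {x | τ x ∈ S} = volume S)
    (hB : ∀ x, τ x ∈ Bd X' Y' ↔ x ∈ Bd X Y) (hD : ∀ x y, D2 (τ x) (τ y) = D2 x y)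
    (hX : 0 < X') (hY : 0 < Y') (hXY : X' * Y' = X * Y) : Hyp X' Y' (W.image τ) := by
  refine ⟨hX, hY, ?_, ?_⟩
  · intro p hp
    obtain ⟨p', hp', rfl⟩ := Finset.mem_image.1 hp
    exact (hB p').2 (H.sub p' hp')
  · intro B hBB hcard
    rw [← hvol, hXY]
    rw [Finset.card_image_of_injective _ τ.injective] at hcard
    refine (measure_mono ?_).trans (H.win (B.image τ.symm) ?_ (Finset.card_image_le.trans hcard))
    · rintro x ⟨h1, b, hb, h2⟩
      refine ⟨(hB x).1 h1, τ.symm b, Finset.mem_image_of_mem _ hb, fun p hp => ?_⟩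
      have := h2 (τ p) (Finset.mem_image_of_mem _ hp)
      rw [hD] at this
      rwa [← hD, τ.apply_symm_apply]
    · intro b hb
      obtain ⟨b', hb', rfl⟩ := Finset.mem_image.1 hb
      rw [← hB, τ.apply_symm_apply]
      exact hBB b' hb'

/-- reflection in the first coordinate -/
def refl1 (X : ℝ) : ℝ × ℝ ≃ ℝ × ℝ where
  toFun x := (X - x.1, x.2)
  invFun x := (X - x.1, x.2)
  left_inv x := by simp
  right_inv x := by simp

lemma Hyp.refl1 (H : Hyp X Y W) : Hyp X Y (W.image (refl1 X)) := by
  refine H.map _ ?_ ?_ ?_ H.X0 H.Y0 rfl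
  · intro S
    have h1 := vol_preimage (-1) 0 0 1 (by norm_num) ((fun y => y + (X, (0:ℝ))) ⁻¹' S)
    rw [measure_preimage_add_right] at h1
    norm_num at h1
    rw [← h1]
    congr 1
    ext x
    simp only [Vor.refl1, Equiv.coe_fn_mk, mem_ofPred_eq]
    rw [show -x.1 + X = X - x.1 by ring]
  · intro x
    simp only [Vor.refl1, Equiv.coe_fn_mk, Bd, mem_ofPred_eq]
    constructor
    · rintro ⟨h1, h2, h3, h4⟩; refine ⟨?_, ?_, ?_, ?_⟩ <;> linarith
    · rintro ⟨h1, h2, h3, h4⟩; refine ⟨?_, ?_, ?_, ?_⟩ <;> linarith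
  · intro x y
    simp only [Vor.refl1, Equiv.coe_fn_mk, D2]; ring

/-- reflection in the second coordinate -/
def refl2 (Y : ℝ) : ℝ × ℝ ≃ ℝ × ℝ where
  toFun x := (x.1, Y - x.2)
  invFun x := (x.1, Y - x.2)
  left_inv x := by simp
  right_inv x := by simp

lemma Hyp.refl2 (H : Hyp X Y W) : Hyp X Y (W.image (refl2 Y)) := by
  refine H.map _ ?_ ?_ ?_ H.X0 H.Y0 rfl
  · intro S
    have h1 := vol_preimage 1 0 0 (-1) (by norm_num) ((fun y => y + ((0:ℝ), Y)) ⁻¹' S)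
    rw [measure_preimage_add_right] at h1
    norm_num at h1
    rw [← h1]
    congr 1
    ext x
    simp only [Vor.refl2, Equiv.coe_fn_mk, mem_ofPred_eq]
    rw [show -x.2 + Y = Y - x.2 by ring]
  · intro x
    simp only [Vor.refl2, Equiv.coe_fn_mk, Bd, mem_ofPred_eq]
    constructor
    · rintro ⟨h1, h2, h3, h4⟩; refine ⟨?_, ?_, ?_, ?_⟩ <;> linarith
    · rintro ⟨h1, h2, h3, h4⟩; refine ⟨?_, ?_, ?_, ?_⟩ <;> linarith
  · intro x y
    simp only [Vor.refl2, Equiv.coe_fn_mk, D2]; ring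

lemma Hyp.swap (H : Hyp X Y W) : Hyp Y X (W.image (Equiv.prodComm ℝ ℝ)) := by
  refine H.map _ ?_ ?_ ?_ H.Y0 H.X0 (mul_comm _ _)
  · intro S
    exact vol_swap _ _ fun y => Iff.rfl
  · intro x
    simp only [Equiv.prodComm_apply, Bd, mem_ofPred_eq, Prod.fst_swap, Prod.snd_swap]; tauto
  · intro x y
    simp only [Equiv.prodComm_apply, D2, Prod.fst_swap, Prod.snd_swap]; ring

lemma Vc_map {X' Y' : ℝ} (τ : ℝ × ℝ ≃ ℝ × ℝ)
    (hB : ∀ x, τ x ∈ Bd X' Y' ↔ x ∈ Bd X Y) (hD : ∀ x y, D2 (τ x) (τ y) = D2 x y) (q x : ℝ × ℝ) :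
    τ x ∈ Vc X' Y' (W.image τ) (τ q) ↔ x ∈ Vc X Y W q := by
  simp only [Vc, mem_ofPred_eq, Finset.forall_mem_image, hB, hD]

lemma refl1_Bd (x : ℝ × ℝ) : Vor.refl1 X x ∈ Bd X Y ↔ x ∈ Bd X Y := by
  simp only [Vor.refl1, Equiv.coe_fn_mk, Bd, mem_ofPred_eq]
  constructor
  · rintro ⟨h1, h2, h3, h4⟩; refine ⟨?_, ?_, ?_, ?_⟩ <;> linarith
  · rintro ⟨h1, h2, h3, h4⟩; refine ⟨?_, ?_, ?_, ?_⟩ <;> linarith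

lemma refl1_D2 (x y : ℝ × ℝ) : D2 (Vor.refl1 X x) (Vor.refl1 X y) = D2 x y := by
  simp only [Vor.refl1, Equiv.coe_fn_mk, D2]; ring

lemma refl2_Bd (x : ℝ × ℝ) : Vor.refl2 Y x ∈ Bd X Y ↔ x ∈ Bd X Y := by
  simp only [Vor.refl2, Equiv.coe_fn_mk, Bd, mem_ofPred_eq]
  constructor
  · rintro ⟨h1, h2, h3, h4⟩; refine ⟨?_, ?_, ?_, ?_⟩ <;> linarith
  · rintro ⟨h1, h2, h3, h4⟩; refine ⟨?_, ?_, ?_, ?_⟩ <;> linarith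

lemma refl2_D2 (x y : ℝ × ℝ) : D2 (Vor.refl2 Y x) (Vor.refl2 Y y) = D2 x y := by
  simp only [Vor.refl2, Equiv.coe_fn_mk, D2]; ring

lemma swap_Bd (x : ℝ × ℝ) : Equiv.prodComm ℝ ℝ x ∈ Bd Y X ↔ x ∈ Bd X Y := by
  simp only [Equiv.prodComm_apply, Bd, mem_ofPred_eq, Prod.fst_swap, Prod.snd_swap]; tauto

lemma swap_D2 (x y : ℝ × ℝ) : D2 (Equiv.prodComm ℝ ℝ x) (Equiv.prodComm ℝ ℝ y) = D2 x y := by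
  simp only [Equiv.prodComm_apply, D2, Prod.fst_swap, Prod.snd_swap]; ring

lemma own (H : Hyp X Y W) (hne : W.Nonempty) {x : ℝ × ℝ} (hx : x ∈ Bd X Y) : ∃ q ∈ W, x ∈ Vc X Y W q := by
  obtain ⟨q0, h0, hm⟩ := W.exists_min_image (fun p => D2 x p) hne
  exact ⟨q0, h0, hx, hm⟩

lemma Vsym (H : Hyp X Y W) {q : ℝ × ℝ} (hq : q ∈ W) {x1 x2 : ℝ} (hx : (x1, x2) ∈ Vc X Y W q) :
    (2 * q.1 - x1, 2 * q.2 - x2) ∈ Vc X Y W q := by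
  have h1 : ((x1 - q.1, x2 - q.2) : ℝ × ℝ) ∈ (cellAt X Y W q).K := by
    rw [cell_K]; convert hx using 1; ext <;> simp
  have h2 := (goodAt H hq).sym _ h1
  rw [cell_K] at h2
  convert h2 using 1
  ext <;> simp <;> ring

end
end Vor

namespace Vor

open Filter Topology

section
variable {X Y : ℝ} {W : Finset (ℝ × ℝ)}

lemma L_local (H : Hyp X Y W) {q : ℝ × ℝ} (hq : q ∈ W)
    (h1 : ∀ x ∈ Vc X Y W q, x.1 ≠ X) (h2 : ∀ x ∈ Vc X Y W q, x.2 ≠ Y)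
    (hcor : ∀ x0 y0, (0, y0) ∈ Vc X Y W q → (x0, 0) ∈ Vc X Y W q → (0, 0) ∈ Vc X Y W q) : False := by
  refine mainLocal (c := cellAt X Y W q) ⟨goodAt H hq, ?_, ?_⟩ ?_
  · intro y hy
    rw [cell_K] at hy
    have a := hy.1.2.1
    have b := lt_of_le_of_ne a (h1 _ hy)
    simp only [Prod.fst_add] at b
    show y.1 < X - q.1
    linarith
  · intro y hy
    rw [cell_K] at hy
    have a := hy.1.2.2.2
    have b := lt_of_le_of_ne a (h2 _ hy)
    simp only [Prod.snd_add] at b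
    show y.2 < Y - q.2
    linarith
  · rintro ⟨y, hy, hy1⟩ ⟨z, hz, hz1⟩
    rw [cell_K] at hy hz ⊢
    have e1 : y + q = (0, y.2 + q.2) := by
      ext
      · show y.1 + q.1 = 0
        rw [hy1]; show -q.1 + q.1 = 0; ring
      · rfl
    have e2 : z + q = (z.1 + q.1, 0) := by
      ext
      · rfl
      · show z.2 + q.2 = 0
        rw [hz1]; show -q.2 + q.2 = 0; ring
    rw [e1] at hy
    rw [e2] at hz
    have := hcor _ _ hy hz
    have e3 : ((-(cellAt X Y W q).e1, -(cellAt X Y W q).d1) : ℝ × ℝ) + q = (0, 0) := by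
      ext
      · show -q.1 + q.1 = 0; ring
      · show -q.2 + q.2 = 0; ring
    rw [e3]; exact this

lemma zero_Bd (H : Hyp X Y W) : ((0, 0) : ℝ × ℝ) ∈ Bd X Y :=
  ⟨le_refl _, H.X0.le, le_refl _, H.Y0.le⟩

lemma A_claim (H : Hyp X Y W) {p : ℝ × ℝ} (hp : p ∈ W) (h0 : (0, 0) ∈ Vc X Y W p) :
    p.1 = X / 2 ∨ p.2 = Y / 2 := by
  have hs := Vsym H hp h0
  have hsB := hs.1
  obtain ⟨b1, b2, b3, b4⟩ := hsB
  simp only at b1 b2 b3 b4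
  by_contra hn
  push Not at hn
  refine L_local H hp ?_ ?_ (fun _ _ _ _ => h0)
  · rintro ⟨x, y⟩ hx hh
    simp only at hh
    subst hh
    have := (Vsym H hp hx).1.1
    simp only at this
    apply hn.1; linarith
  · rintro ⟨x, y⟩ hx hh
    simp only at hh
    subst hh
    have := (Vsym H hp hx).1.2.2.1
    simp only at this
    apply hn.2; linarith

lemma B_claim (H : Hyp X Y W) {q : ℝ × ℝ} (hq : q ∈ W) :
    (∃ x ∈ Vc X Y W q, x.1 = X) ∨ (∃ x ∈ Vc X Y W q, x.2 = Y) := by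
  by_contra hn
  push Not at hn
  refine L_local H hq hn.1 hn.2 ?_
  intro x0 y0 hy hx
  obtain ⟨p, hp, hp0⟩ := own H ⟨q, hq⟩ (zero_Bd H)
  have c0 := hp0.2 q hq
  have c1 := hy.2 p hp
  have c2 := hx.2 p hp
  have s1 := Vsym H hq hy
  have s2 := Vsym H hq hx
  have n1 := lt_of_le_of_ne s1.1.2.1 (hn.1 _ s1)
  have n2 := lt_of_le_of_ne s2.1.2.2.2 (hn.2 _ s2)
  have y0' := hy.1.2.2.1
  have x0' := hx.1.1
  simp only [D2] at *
  rcases A_claim H hp hp0 with h | h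
  · have : x0 = 0 := by nlinarith
    rw [this] at hx; exact hx
  · have : y0 = 0 := by nlinarith
    rw [this] at hy; exact hy

/-- touches bottom and top, hence centred -/
def TB (X Y : ℝ) (W : Finset (ℝ × ℝ)) (q : ℝ × ℝ) : Prop :=
  q.2 = Y / 2 ∧ (∃ x, (x, 0) ∈ Vc X Y W q) ∧ ∃ x, (x, Y) ∈ Vc X Y W q

/-- touches left and right, hence centred -/
def LR (X Y : ℝ) (W : Finset (ℝ × ℝ)) (q : ℝ × ℝ) : Prop :=
  q.1 = X / 2 ∧ (∃ y, (0, y) ∈ Vc X Y W q) ∧ ∃ y, (X, y) ∈ Vc X Y W q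

lemma C_claim (H : Hyp X Y W) {q : ℝ × ℝ} (hq : q ∈ W) : TB X Y W q ∨ LR X Y W q := by
  have h1 := B_claim H hq
  have h2 := B_claim H.refl1 (Finset.mem_image_of_mem _ hq)
  have h3 := B_claim H.refl2 (Finset.mem_image_of_mem _ hq)
  have h4 := B_claim H.refl1.refl2 (Finset.mem_image_of_mem _ (Finset.mem_image_of_mem _ hq))
  have R : (∃ x ∈ Vc X Y W q, x.1 = X) → ∃ y, (X, y) ∈ Vc X Y W q := by
    rintro ⟨⟨x, y⟩, hx, rfl⟩; exact ⟨y, hx⟩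
  have T : (∃ x ∈ Vc X Y W q, x.2 = Y) → ∃ x, (x, Y) ∈ Vc X Y W q := by
    rintro ⟨⟨x, y⟩, hx, rfl⟩; exact ⟨x, hx⟩
  have h1' : (∃ y, (X, y) ∈ Vc X Y W q) ∨ ∃ x, (x, Y) ∈ Vc X Y W q := h1.imp R T
  have h2' : (∃ y, (0, y) ∈ Vc X Y W q) ∨ ∃ x, (x, Y) ∈ Vc X Y W q := by
    rcases h2 with ⟨x, hx, e⟩ | ⟨x, hx, e⟩
    · left
      obtain ⟨x, rfl⟩ := (Vor.refl1 X).surjective x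
      rw [Vc_map _ refl1_Bd refl1_D2] at hx
      obtain ⟨x, y⟩ := x
      have : X - x = X := e
      have : x = 0 := by linarith
      subst this; exact ⟨y, hx⟩
    · right
      obtain ⟨x, rfl⟩ := (Vor.refl1 X).surjective x
      rw [Vc_map _ refl1_Bd refl1_D2] at hx
      obtain ⟨x, y⟩ := x
      have : y = Y := e
      subst this; exact ⟨x, hx⟩
  have h3' : (∃ y, (X, y) ∈ Vc X Y W q) ∨ ∃ x, (x, 0) ∈ Vc X Y W q := by
    rcases h3 with ⟨x, hx, e⟩ | ⟨x, hx, e⟩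
    · left
      obtain ⟨x, rfl⟩ := (Vor.refl2 Y).surjective x
      rw [Vc_map _ refl2_Bd refl2_D2] at hx
      obtain ⟨x, y⟩ := x
      have : x = X := e
      subst this; exact ⟨y, hx⟩
    · right
      obtain ⟨x, rfl⟩ := (Vor.refl2 Y).surjective x
      rw [Vc_map _ refl2_Bd refl2_D2] at hx
      obtain ⟨x, y⟩ := x
      have : Y - y = Y := e
      have : y = 0 := by linarith
      subst this; exact ⟨x, hx⟩
  have h4' : (∃ y, (0, y) ∈ Vc X Y W q) ∨ ∃ x, (x, 0) ∈ Vc X Y W q := by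
    rcases h4 with ⟨x, hx, e⟩ | ⟨x, hx, e⟩
    · left
      obtain ⟨x, rfl⟩ := (Vor.refl2 Y).surjective x
      obtain ⟨x, rfl⟩ := (Vor.refl1 X).surjective x
      rw [Vc_map _ refl2_Bd refl2_D2, Vc_map _ refl1_Bd refl1_D2] at hx
      obtain ⟨x, y⟩ := x
      have : X - x = X := e
      have : x = 0 := by linarith
      subst this; exact ⟨y, hx⟩
    · right
      obtain ⟨x, rfl⟩ := (Vor.refl2 Y).surjective x
      obtain ⟨x, rfl⟩ := (Vor.refl1 X).surjective x
      rw [Vc_map _ refl2_Bd refl2_D2, Vc_map _ refl1_Bd refl1_D2] at hx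
      obtain ⟨x, y⟩ := x
      have : Y - y = Y := e
      have : y = 0 := by linarith
      subst this; exact ⟨x, hx⟩
  have key : ((∃ x, (x, 0) ∈ Vc X Y W q) ∧ ∃ x, (x, Y) ∈ Vc X Y W q) ∨
      ((∃ y, (0, y) ∈ Vc X Y W q) ∧ ∃ y, (X, y) ∈ Vc X Y W q) := by
    clear R T h1 h2 h3 h4
    rcases h1' with a | a
    · rcases h2' with b | b
      · exact Or.inr ⟨b, a⟩
      · rcases h4' with c | c
        · exact Or.inr ⟨c, a⟩
        · exact Or.inl ⟨c, b⟩
    · rcases h3' with b | b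
      · rcases h4' with c | c
        · exact Or.inr ⟨c, b⟩
        · exact Or.inl ⟨c, a⟩
      · exact Or.inl ⟨b, a⟩
  rcases key with ⟨⟨x, hx⟩, x', hx'⟩ | ⟨⟨x, hx⟩, x', hx'⟩
  · left
    refine ⟨?_, ⟨x, hx⟩, x', hx'⟩
    have a := (Vsym H hq hx).1.2.2.2
    have b := (Vsym H hq hx').1.2.2.1
    simp only at a b
    linarith
  · right
    refine ⟨?_, ⟨x, hx⟩, x', hx'⟩
    have a := (Vsym H hq hx).1.2.1
    have b := (Vsym H hq hx').1.1
    simp only at a b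
    linarith

/-- all centred vertically if the south-west corner owner is -/
lemma D_claim (H : Hyp X Y W) {p : ℝ × ℝ} (hp : p ∈ W) (h0 : (0, 0) ∈ Vc X Y W p)
    (hpY : p.2 = Y / 2) : ∀ q ∈ W, q.2 = Y / 2 := by
  have hX := H.X0
  have hY := H.Y0
  have s0 := Vsym H hp h0
  have e0 : ((2 * p.1 - 0, 2 * p.2 - 0) : ℝ × ℝ) = (2 * p.1, Y) := by
    rw [hpY]; ext <;> simp; ring
  rw [e0] at s0
  have i0 := interior H hp
  have hpX : 2 * p.1 ≤ X := s0.1.2.1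
  -- the NW corner
  have hNW : (0, Y) ∈ Vc X Y W p := by
    obtain ⟨p', hp', h'⟩ := own H ⟨p, hp⟩ (x := (0, Y)) ⟨le_refl _, hX.le, hY.le, le_refl _⟩
    have s' := Vsym H hp' h'
    have i' := interior H hp'
    have c1 := h0.2 p' hp'
    have c2 := h'.2 p hp
    have c3 := s0.2 p' hp'
    have c4 := s'.2 p hp
    have s'B := s'.1
    obtain ⟨b1, b2, b3, b4⟩ := s'B
    simp only [D2] at c1 c2 c3 c4 b1 b2 b3 b4
    have : p' = p := by
      rcases C_claim H hp' with h | h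
      · have e : p'.2 = p.2 := by rw [hpY, h.1]
        have a1 : p.1 ^ 2 ≤ p'.1 ^ 2 := by rw [e] at c1; nlinarith
        have a2 : p'.1 ^ 2 ≤ p.1 ^ 2 := by rw [e] at c2; nlinarith
        ext
        · nlinarith
        · exact e
      · have e := h.1
        have a1 : 0 ≤ 2 * p.1 * (2 * p.1 - X) := by rw [e] at c2 c3; nlinarith
        have a2 : p.1 = X / 2 := by nlinarith
        ext
        · rw [a2, e]
        · rw [e, a2, hpY] at c2
          rw [hpY]
          nlinarith
    rw [this] at h'; exact h'
  intro q hq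
  rcases C_claim H hq with h | h
  · exact h.1
  · obtain ⟨e, ⟨y, hy⟩, -⟩ := h
    have d1 := hNW.2 q hq
    have d2 := h0.2 q hq
    have d3 := s0.2 q hq
    have s1 := Vsym H hp hNW
    have e1 : ((2 * p.1 - 0, 2 * p.2 - Y) : ℝ × ℝ) = (2 * p.1, 0) := by
      rw [hpY]; ext <;> simp; ring
    rw [e1] at s1
    have d4 := s1.2 q hq
    have d5 := hy.2 p hp
    have yb := hy.1
    obtain ⟨-, -, yb1, yb2⟩ := yb
    simp only [D2] at d1 d2 d3 d4 d5 yb1 yb2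
    have i1 := i0.1
    have iq := interior H hq
    clear e0 e1 s0 s1 hNW h0 hy i0
    have k2 : 0 ≤ Y * ((0 - p.1) ^ 2 + (y - p.2) ^ 2 - (0 - q.1) ^ 2 - (y - q.2) ^ 2) :=
      mul_nonneg hY.le (by linarith)
    have k3 := mul_nonneg (sub_nonneg.2 yb2) (sub_nonneg.2 d4)
    have k4 := mul_nonneg yb1 (sub_nonneg.2 d3)
    have k5 : 0 ≤ (4 * Y * p.1) * (p.1 - q.1) := by
      nlinarith only [k2, k3, k4]
    have k6 : 0 ≤ p.1 - q.1 := nonneg_of_mul_nonneg_right k5 (by positivity)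
    have k7 : p.1 = q.1 := by linarith
    rw [k7, hpY] at d1 d2
    obtain ⟨-, -, iq1, iq2⟩ := iq
    nlinarith only [d1, d2, iq1, iq2, hY]
end

end Vor

namespace Vor

open Filter Topology

lemma line1 {n : ℕ} {X : ℝ} (hX : 0 < X) (x : Fin n → ℝ) (hm : StrictMono x)
    (h0 : ∀ i, 0 < x i) (h1 : ∀ i, x i < X)
    (hs : ∀ i t, 0 ≤ t → t ≤ X → (∀ j, (t - x i) ^ 2 ≤ (t - x j) ^ 2) →
      0 ≤ 2 * x i - t ∧ 2 * x i - t ≤ X ∧ ∀ j, (2 * x i - t - x i) ^ 2 ≤ (2 * x i - t - x j) ^ 2) :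
    ∀ i : Fin n, x i = (2 * (i : ℝ) + 1) * X / (2 * n) := by
  rcases Nat.eq_zero_or_pos n with hn | hn
  · subst hn; intro i; exact i.elim0
  set d := x ⟨0, hn⟩ with hd
  have P : ∀ k (hk : k < n), x ⟨k, hk⟩ = (2 * k + 1) * d ∧
      (∀ j, (2 * k * d - x ⟨k, hk⟩) ^ 2 ≤ (2 * k * d - x j) ^ 2) ∧ 2 * k * d ≤ X ∧
      ∀ t, 0 ≤ t → t ≤ X → (∀ j, (t - x ⟨k, hk⟩) ^ 2 ≤ (t - x j) ^ 2) → 2 * k * d ≤ t := by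
    intro k
    induction k with
    | zero =>
      intro hk
      refine ⟨by simp [hd], ?_, by simpa using hX.le, ?_⟩
      · intro j
        have : x ⟨0, hk⟩ ≤ x j := hm.monotone (Fin.mk_le_of_le_val (Nat.zero_le _))
        have := h0 ⟨0, hk⟩
        simp only [Nat.cast_zero, mul_zero, zero_mul]
        nlinarith
      · intro t ht _ _; simpa using ht
    | succ k ih =>
      intro hk
      obtain ⟨a1, a2, a3, a4⟩ := ih (by omega)
      set i : Fin n := ⟨k, by omega⟩ with hi
      set i' : Fin n := ⟨k + 1, hk⟩ with hi'
      have hlt : x i < x i' := hm (by simp [hi, hi'])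
      have hdp : 0 < d := h0 _
      obtain ⟨b1, b2, b3⟩ := hs i (2 * k * d) (by positivity) a3 a2
      have b4 := b3 i'
      -- midpoint
      have m0 : ∀ j, ((x i + x i') / 2 - x i) ^ 2 ≤ ((x i + x i') / 2 - x j) ^ 2 := by
        intro j
        rcases le_or_gt j i with hj | hj
        · have := hm.monotone hj
          nlinarith
        · have : x i' ≤ x j := hm.monotone (by rw [Fin.le_def]; exact hj)
          nlinarith
      obtain ⟨c1, c2, c3⟩ := hs i _ (by have := h0 i; linarith) (by have := h1 i'; linarith) m0
      have c4 := a4 _ c1 c2 c3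
      have hx : x i' = (2 * ((k : ℝ) + 1) + 1) * d := by
        apply le_antisymm
        · linarith
        · have : 2 * x i - 2 * k * d ≤ (x i + x i') / 2 := by
            by_contra hcon
            push Not at hcon
            nlinarith
          linarith
      have hmid : (x i + x i') / 2 = 2 * ((k : ℝ) + 1) * d := by rw [hx, a1]; ring
      push_cast
      refine ⟨hx, ?_, ?_, ?_⟩
      · intro j
        rw [← hmid]
        refine le_trans (le_of_eq ?_) (m0 j)
        ring
      · rw [← hmid]; have := h1 i; have := h1 i'; linarith
      · intro t _ _ ht
        have := ht i
        rw [← hmid]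
        by_contra hcon
        push Not at hcon
        nlinarith
  obtain ⟨k, rfl⟩ : ∃ k, n = k + 1 := ⟨n - 1, by omega⟩
  obtain ⟨a1, a2, a3, a4⟩ := P k (by omega)
  have hdp : 0 < d := h0 _
  set i : Fin (k + 1) := ⟨k, by omega⟩ with hi
  obtain ⟨b1, b2, b3⟩ := hs i (2 * k * d) (by positivity) a3 a2
  obtain ⟨c1, c2, c3⟩ := hs i X hX.le le_rfl (by
    intro j
    have : x j ≤ x i := hm.monotone (Fin.mk_le_mk.2 (by have := j.2; omega))
    have := h1 i
    nlinarith)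
  have c4 := a4 _ c1 c2 c3
  have hXd : X = 2 * ((k : ℝ) + 1) * d := by rw [a1] at b2 c4; linarith
  intro j
  have := (P j j.2).1
  simp only [Fin.eta] at this
  rw [this, hXd]
  push_cast
  field_simp

section
variable {X Y : ℝ} {W : Finset (ℝ × ℝ)}

theorem E_claim (H : Hyp X Y W) {n : ℕ} (hcard : W.card = n) (hall : ∀ q ∈ W, q.2 = Y / 2) :
    W = Finset.univ.image fun i : Fin n => (((2 * (i : ℝ) + 1) * X / (2 * n), Y / 2) : ℝ × ℝ) := by
  have hinj : Set.InjOn Prod.fst (W : Set (ℝ × ℝ)) := by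
    intro a ha b hb hab
    ext
    · exact hab
    · rw [hall a ha, hall b hb]
  have hSc : (W.image Prod.fst).card = n := by rw [Finset.card_image_of_injOn hinj, hcard]
  set x : Fin n → ℝ := fun i => (W.image Prod.fst).orderEmbOfFin hSc i with hx
  have hmem : ∀ i, (x i, Y / 2) ∈ W := by
    intro i
    obtain ⟨q, hq, e⟩ := Finset.mem_image.1 ((W.image Prod.fst).orderEmbOfFin_mem hSc i)
    have : q = (x i, Y / 2) := by
      ext
      · exact e
      · exact hall q hq
    rwa [← this]
  have hsur : ∀ q ∈ W, ∃ i, q = (x i, Y / 2) := by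
    intro q hq
    have : q.1 ∈ Set.range ((W.image Prod.fst).orderEmbOfFin hSc) := by
      rw [Finset.range_orderEmbOfFin]
      exact Finset.mem_coe.2 (Finset.mem_image_of_mem _ hq)
    obtain ⟨i, hi⟩ := this
    refine ⟨i, ?_⟩
    ext
    · exact hi.symm
    · exact hall q hq
  have key := line1 H.X0 x (fun a b hab => ((W.image Prod.fst).orderEmbOfFin hSc).strictMono hab)
    (fun i => (interior H (hmem i)).1) (fun i => (interior H (hmem i)).2.1) (by
      intro i t ht0 ht1 ht
      have hV : (t, Y / 2) ∈ Vc X Y W (x i, Y / 2) := by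
        refine ⟨⟨ht0, ht1, by have := H.Y0; show 0 ≤ Y / 2; positivity, by have := H.Y0; show Y / 2 ≤ Y; linarith⟩, ?_⟩
        intro p hp
        obtain ⟨j, rfl⟩ := hsur p hp
        have := ht j
        simp only [D2]; linarith
      have hV' := Vsym H (hmem i) hV
      refine ⟨hV'.1.1, hV'.1.2.1, fun j => ?_⟩
      have := hV'.2 _ (hmem j)
      simp only [D2] at this
      linarith)
  ext q
  simp only [Finset.mem_image, Finset.mem_univ, true_and]
  constructor
  · intro hq
    obtain ⟨i, rfl⟩ := hsur q hq
    exact ⟨i, by rw [key i]⟩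
  · rintro ⟨i, rfl⟩
    rw [← key i]; exact hmem i

end

lemma alpha_ex : ∃ α : ℝ, 0 < α ∧ α < Real.pi / 2 ∧ Real.sin α ^ 2 = 4 / 29 ∧
    ∀ θ, α < θ → θ < Real.pi / 2 → Real.cos θ < 5 / 2 * Real.sin θ := by
  have hc : 0 < Real.cos (Real.arctan (2 / 5)) := Real.cos_arctan_pos _
  have ht : Real.sin (Real.arctan (2 / 5)) = 2 / 5 * Real.cos (Real.arctan (2 / 5)) := by
    have := Real.tan_arctan (2 / 5)
    rw [Real.tan_eq_sin_div_cos, div_eq_iff hc.ne'] at this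
    exact this
  refine ⟨Real.arctan (2 / 5), by rw [Real.arctan_pos]; norm_num, Real.arctan_lt_pi_div_two _, ?_, ?_⟩
  · have := Real.sin_sq_add_cos_sq (Real.arctan (2 / 5))
    rw [ht] at this ⊢
    nlinarith
  · intro θ h1 h2
    have h3 : 0 < Real.arctan (2 / 5) := by rw [Real.arctan_pos]; norm_num
    have h := Real.sin_pos_of_pos_of_lt_pi (x := θ - Real.arctan (2 / 5)) (by linarith)
      (by have := Real.pi_pos; linarith)
    rw [Real.sin_sub, ht] at h
    have : 0 < (Real.sin θ - 2 / 5 * Real.cos θ) * Real.cos (Real.arctan (2 / 5)) := by linarith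
    have := pos_of_mul_pos_left this hc.le
    linarith

/-- the local computation excluding a stack of at least three flat cells -/
lemma F_local {c : Cell} (hc : Good c) {h X : ℝ} (hh : 0 < h) (hX : 3 * h ≤ X)
    (e1 : c.e1 = X / 2) (e2 : c.e2 = X / 2) (d1 : h < c.d1) (d2 : h < c.d2)
    (hv0 : ((0 : ℝ), h) ∈ c.V) (hV : ∀ v ∈ c.V, ∃ k : ℤ, k ≠ 0 ∧ v = (0, k * h)) : False := by
  obtain ⟨α, α0, α1, hsin, hcos⟩ := alpha_ex
  have hpi := Real.pi_pos
  have hspos : ∀ θ, α ≤ θ → θ ≤ Real.pi / 2 → 0 < Real.sin θ := fun θ h1 h2 =>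
    Real.sin_pos_of_pos_of_lt_pi (by linarith) (by linarith)
  obtain ⟨hi, hint⟩ := ind_int (α := α) (β := Real.pi / 2) α1.le (by linarith) (by linarith)
    (fun θ => h / 4 * Real.cos θ / Real.sin θ ^ 3) (fun θ => -(h / 8) * (Real.sin θ ^ 2)⁻¹) (by
      intro θ hθ
      have hs := hspos θ hθ.1 hθ.2
      have := (((Real.hasDerivAt_sin θ).fun_pow 2).fun_inv (pow_pos hs 2).ne').const_mul (-(h / 8))
      refine this.congr_deriv ?_
      push_cast
      field_simp
      try ring) (by
      apply ContinuousOn.div (by fun_prop) (by fun_prop)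
      intro θ hθ
      have := hspos θ hθ.1 hθ.2
      positivity)
  have := FO c hc 0 (h / 2) (0, h / 2) (0, h) (by positivity) (by ring) (by simp) hv0 (by ring) _ hi ?_
  · rw [hint, Real.sin_pi_div_two, hsin] at this
    norm_num at this
    linarith
  · intro θ _ hg
    by_cases hθ : θ ∈ Ioo α (Real.pi / 2)
    swap
    · rw [indicator_of_notMem hθ] at hg; exact absurd hg (lt_irrefl _)
    have hs := hspos θ hθ.1.le hθ.2.le
    have hcθ := hcos θ hθ.1 hθ.2
    have hcp : 0 < Real.cos θ := Real.cos_pos_of_mem_Ioo ⟨by linarith [hθ.1], hθ.2⟩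
    set r := h / 2 / Real.sin θ with hr
    have hrp : 0 < r := by positivity
    have hrs : r * Real.sin θ = h / 2 := by rw [hr]; field_simp
    have hrc : r * Real.cos θ < X / 2 := by
      have : r * Real.cos θ < r * (5 / 2 * Real.sin θ) := mul_lt_mul_of_pos_left hcθ hrp
      nlinarith
    have hrc0 : 0 < r * Real.cos θ := by positivity
    refine ⟨r, h / 2, hrp, by positivity, ?_, ?_, ?_, by simpa using hcp, ?_, ?_⟩
    · rw [hrs]
      refine ⟨⟨?_, ?_, ?_, ?_⟩, ?_⟩
      · show -c.e1 ≤ r * Real.cos θ; linarith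
      · show r * Real.cos θ ≤ c.e2; linarith
      · show -c.d1 ≤ h / 2; linarith
      · show h / 2 ≤ c.d2; linarith
      · intro v hv
        obtain ⟨k, hk, rfl⟩ := hV v hv
        show 2 * (r * Real.cos θ * 0 + h / 2 * (k * h)) ≤ 0 ^ 2 + (k * h) ^ 2
        have : (k : ℝ) ≤ (k : ℝ) ^ 2 := by exact_mod_cast Int.le_self_sq k
        nlinarith [mul_pos hh hh]
    · intro s hrs' hK
      have := hK.2 _ hv0
      simp only at this
      have : r * Real.sin θ < s * Real.sin θ := mul_lt_mul_of_pos_right hrs' hs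
      nlinarith
    · refine ⟨by linarith, by linarith, by linarith, by linarith⟩
    · intro v hv hact
      obtain ⟨k, hk, rfl⟩ := hV v hv
      rw [hrs] at hact
      simp only at hact ⊢
      have hk' : (k : ℝ) ≠ 0 := by exact_mod_cast hk
      have : (k : ℝ) = 1 := by
        have : (k : ℝ) * h ^ 2 * (k - 1) = 0 := by linarith
        rcases mul_eq_zero.1 this with h' | h'
        · exact absurd h' (by positivity)
        · linarith
      rw [this]
      linarith
    · rw [indicator_of_mem hθ, sub_zero, hr]
      apply le_of_eq
      field_simp
      try ring

section
variable {X Y : ℝ} {W : Finset (ℝ × ℝ)}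

theorem F_claim (H : Hyp X Y W) {n : ℕ} (hn : 3 ≤ n) (hXY : Y ≤ X) (hcard : W.card = n)
    (hall : ∀ q ∈ W, q.1 = X / 2) : False := by
  have hE := E_claim (n := n) H.swap (by rw [Finset.card_image_of_injective _ (Equiv.injective _), hcard]) (by
    intro q hq
    obtain ⟨p, hp, rfl⟩ := Finset.mem_image.1 hq
    exact hall p hp)
  have hnR : (3 : ℝ) ≤ n := by exact_mod_cast hn
  have hn0 : (0 : ℝ) < n := by linarith
  set h := Y / n with hh
  have hhp : 0 < h := div_pos H.Y0 hn0
  have hYh : Y = n * h := by rw [hh]; field_simp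
  have hiff : ∀ p : ℝ × ℝ, p ∈ W ↔ ∃ i : Fin n, p = (X / 2, (2 * (i : ℝ) + 1) * h / 2) := by
    intro p
    have : p ∈ W ↔ p.swap ∈ W.image (Equiv.prodComm ℝ ℝ) := by
      rw [Finset.mem_image]
      constructor
      · intro hp; exact ⟨p, hp, rfl⟩
      · rintro ⟨p', hp', e⟩
        have : p' = p := Prod.swap_injective e
        rwa [← this]
    rw [this, hE]
    simp only [Finset.mem_image, Finset.mem_univ, true_and]
    refine exists_congr fun i => ?_
    have e : (2 * (i : ℝ) + 1) * Y / (2 * n) = (2 * (i : ℝ) + 1) * h / 2 := by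
      rw [hh]; field_simp
    rw [e]
    constructor
    · intro h'; have := congrArg Prod.swap h'; simpa using this.symm
    · rintro rfl; rfl
  set q : ℝ × ℝ := (X / 2, 3 * h / 2) with hqd
  have hq : q ∈ W := (hiff q).2 ⟨⟨1, by omega⟩, by rw [hqd]; norm_num⟩
  refine F_local (c := cellAt X Y W q) (goodAt H hq) (h := h) (X := X) hhp ?_ rfl ?_ ?_ ?_ ?_ ?_
  · nlinarith
  · show X - X / 2 = X / 2; ring
  · show h < 3 * h / 2; linarith
  · show h < Y - 3 * h / 2; nlinarith
  · show (0, h) ∈ (W.erase q).image fun p => p - q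
    refine Finset.mem_image.2 ⟨(X / 2, 5 * h / 2), Finset.mem_erase.2 ⟨?_, ?_⟩, ?_⟩
    · intro e
      have := congrArg Prod.snd e
      simp only [hqd] at this
      linarith
    · exact (hiff _).2 ⟨⟨2, by omega⟩, by norm_num⟩
    · ext
      · simp [hqd]
      · simp only [hqd, Prod.snd_sub]; ring
  · intro v hv
    obtain ⟨p, hp, rfl⟩ := Finset.mem_image.1 (show v ∈ (W.erase q).image fun p => p - q from hv)
    obtain ⟨hpq, hpW⟩ := Finset.mem_erase.1 hp
    obtain ⟨i, rfl⟩ := (hiff p).1 hpW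
    refine ⟨(i : ℤ) - 1, ?_, ?_⟩
    · intro h0
      apply hpq
      have : ((i : ℕ) : ℤ) = 1 := by linarith
      have : ((i : ℕ) : ℝ) = 1 := by exact_mod_cast this
      rw [this, hqd]; norm_num
    · ext
      · simp [hqd]
      · simp only [hqd, Prod.snd_sub]; push_cast; ring

theorem global (H : Hyp X Y W) {n : ℕ} (hn : 3 ≤ n) (hXY : Y ≤ X) (hcard : W.card = n) :
    W = Finset.univ.image fun i : Fin n => (((2 * (i : ℝ) + 1) * X / (2 * n), Y / 2) : ℝ × ℝ) := by
  have hne : W.Nonempty := Finset.card_pos.1 (by omega)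
  obtain ⟨p, hp, h0⟩ := own H hne (zero_Bd H)
  rcases A_claim H hp h0 with h | h
  · exfalso
    refine F_claim H hn hXY hcard ?_
    have := D_claim H.swap (Finset.mem_image_of_mem _ hp)
      ((Vc_map (Equiv.prodComm ℝ ℝ) swap_Bd swap_D2 p (0, 0)).2 h0) h
    intro q hq
    exact this _ (Finset.mem_image_of_mem _ hq)
  · exact E_claim H hcard (D_claim H hp h0 h)

end
end Vor

namespace Vor

/-- coordinates -/
noncomputable def co : EuclideanSpace ℝ (Fin 2) ≃ᵐ ℝ × ℝ :=
  (MeasurableEquiv.toLp 2 (Fin 2 → ℝ)).symm.trans MeasurableEquiv.finTwoArrow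

lemma co_apply (q : EuclideanSpace ℝ (Fin 2)) : co q = (q 0, q 1) := rfl

lemma co_pt (x y : ℝ) : co (pt x y) = (x, y) := rfl

lemma co_vol (S : Set (ℝ × ℝ)) : volume (co ⁻¹' S) = volume S :=
  MeasurePreserving.measure_preimage_equiv (f := co)
    ((volume_preserving_finTwoArrow ℝ).comp
      (EuclideanSpace.volume_preserving_symm_measurableEquiv_toLp (Fin 2))) S

lemma co_dist (p q : EuclideanSpace ℝ (Fin 2)) : dist p q = Real.sqrt (D2 (co p) (co q)) := by
  rw [EuclideanSpace.dist_eq]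
  simp only [Fin.sum_univ_two, Real.dist_eq, sq_abs, D2, co_apply]

lemma co_board (ρ : ℝ) (q : EuclideanSpace ℝ (Fin 2)) : q ∈ board ρ ↔ co q ∈ Bd 1 ρ := by
  simp only [board, Bd, mem_ofPred_eq, mem_Icc, co_apply]; tauto

lemma board_inf {ρ : ℝ} (h : 0 < ρ) : (board ρ).Infinite := by
  have h1 : (Icc (0 : ℝ) 1).Infinite := Icc_infinite one_pos
  have h2 := h1.image (f := fun x => pt x 0) (by
    intro a _ b _ hab
    have := congrArg co hab
    simp only [co_pt] at this
    exact congrArg Prod.fst this)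
  refine h2.mono ?_
  rintro _ ⟨x, hx, rfl⟩
  rw [co_board]
  simp only [co_pt]
  exact ⟨hx.1, hx.2, le_rfl, h.le⟩

lemma toHyp {n : ℕ} (hn : 3 ≤ n) {ρ : ℝ} (hρ0 : 0 < ρ)
    (W : Set (EuclideanSpace ℝ (Fin 2))) (hWQ : W ⊆ board ρ) (hWfin : W.Finite)
    (hWcard : W.ncard = n)
    (hnowin : ∀ B : Set (EuclideanSpace ℝ (Fin 2)), B ⊆ board ρ → B.Finite → B.ncard = n →
      volume {q | q ∈ board ρ ∧ infDist q B < infDist q W} ≤ ENNReal.ofReal (ρ / 2)) :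
    Hyp 1 ρ (hWfin.toFinset.image co) ∧ (hWfin.toFinset.image co).card = n := by
  have hc : (hWfin.toFinset.image co).card = n := by
    rw [Finset.card_image_of_injective _ co.injective, ← hWcard, ncard_eq_toFinset_card W hWfin]
  have hne : W.Nonempty := by
    rw [← ncard_pos hWfin]; omega
  refine ⟨⟨one_pos, hρ0, ?_, ?_⟩, hc⟩
  · intro p hp
    obtain ⟨q, hq, rfl⟩ := Finset.mem_image.1 hp
    exact (co_board ρ q).1 (hWQ (hWfin.mem_toFinset.1 hq))
  · intro B hB hBc
    rw [hc] at hBc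
    obtain ⟨B', h1, h2, h3⟩ := (board_inf hρ0).exists_superset_ncard_eq
      (s := ((B.image co.symm : Finset _) : Set (EuclideanSpace ℝ (Fin 2)))) (by
        intro x hx
        obtain ⟨b, hb, rfl⟩ := Finset.mem_image.1 (Finset.mem_coe.1 hx)
        rw [co_board, co.apply_symm_apply]
        exact hB b hb) (Finset.finite_toSet _) (k := n) (by
        rw [ncard_coe_finset]; exact Finset.card_image_le.trans hBc)
    have hfin : B'.Finite := finite_of_ncard_pos (by omega)
    have := hnowin B' h2 hfin h3
    rw [one_mul, ← co_vol]
    refine (measure_mono ?_).trans this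
    rintro q ⟨hq, b, hb, hlt⟩
    refine ⟨(co_board ρ q).2 hq, ?_⟩
    obtain ⟨p, hp, e⟩ := hWfin.isCompact.exists_infDist_eq_dist hne q
    rw [e]
    have hb' : co.symm b ∈ B' := h1 (Finset.mem_coe.2 (Finset.mem_image_of_mem _ hb))
    refine (infDist_le_dist_of_mem hb').trans_lt ?_
    rw [co_dist, co_dist, co.apply_symm_apply]
    refine Real.sqrt_lt_sqrt (by unfold D2; positivity) ?_
    exact hlt _ (Finset.mem_image_of_mem _ (hWfin.mem_toFinset.2 hp))

end Vor

/-- For `n ≥ 3`, if Barney cannot claim more than half the board against Wilma's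
`n`-point placement `W`, then `W` must be the `1 × n` grid along the long side:
`W = {((2i−1)/(2n), ρ/2) : i = 1, …, n}`. -/
theorem stmt_10 (n : ℕ) (hn : 3 ≤ n) (ρ : ℝ) (hρ0 : 0 < ρ) (hρ1 : ρ ≤ 1)
    (W : Set (EuclideanSpace ℝ (Fin 2))) (hWQ : W ⊆ board ρ) (hWfin : W.Finite)
    (hWcard : W.ncard = n)
    (hnowin : ∀ B : Set (EuclideanSpace ℝ (Fin 2)), B ⊆ board ρ → B.Finite → B.ncard = n →
      volume {q | q ∈ board ρ ∧ infDist q B < infDist q W} ≤ ENNReal.ofReal (ρ / 2)) :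
    W = Set.range fun i : Fin n => pt ((2 * (i : ℝ) + 1) / (2 * n)) (ρ / 2) := by
  obtain ⟨H, hc⟩ := Vor.toHyp hn hρ0 W hWQ hWfin hWcard hnowin
  have h := Vor.global H hn hρ1 hc
  ext q
  have e : q ∈ W ↔ Vor.co q ∈ hWfin.toFinset.image Vor.co := by
    rw [Finset.mem_image]
    constructor
    · intro hq; exact ⟨q, hWfin.mem_toFinset.2 hq, rfl⟩
    · rintro ⟨p, hp, e⟩
      rw [← Vor.co.injective e]; exact hWfin.mem_toFinset.1 hp
  rw [e, h]
  simp only [Finset.mem_image, Finset.mem_univ, true_and, Set.mem_range]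
  refine exists_congr fun i => ?_
  rw [← Vor.co.injective.eq_iff, Vor.co_pt, mul_one]
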